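/- arXiv:1611.06842 — 3 statements merged into one kernel-verified Lean document; each statement's English description precedes it below -/
import Mathlib

section
/- There exists an absolute constant C such that the following holds. Let P be a d-dimensional grid [a_1] × ... × [a_d]. If n ≥ C · d · |P|^4, then there exists a subset S of the Boolean lattice 2^[n] with |S| ≤ (24|P|^2)^d such that 2^[n] \ S can be partitioned into copies of P. -/
/-- A subset `A` of a poset `Q` is a *copy* of the poset `P` if the subposet of `Q`
induced on `A` is order-isomorphic to `P`. -/
def IsCopy (P : Type*) [PartialOrder P] {Q : Type*} [PartialOrder Q] (A : Set Q) : Prop :=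
  Nonempty (P ≃o A)

/-- The subset `T` of a poset `Q` is *partitioned into copies of `P`* if there is a family
of pairwise disjoint copies of `P` in `Q` whose union is `T`. -/
def PartitionedIntoCopies (P : Type*) [PartialOrder P] {Q : Type*} [PartialOrder Q]
    (T : Set Q) : Prop :=
  ∃ 𝒞 : Set (Set Q), (∀ A ∈ 𝒞, IsCopy P A) ∧ 𝒞.PairwiseDisjoint id ∧ ⋃₀ 𝒞 = T


lemma copies_of_fibres {P Q ι : Type*} [PartialOrder P] [PartialOrder Q] (T : Set Q) (Φ : Q → ι)
    (h : ∀ x ∈ T, IsCopy P {y | y ∈ T ∧ Φ y = Φ x}) : PartitionedIntoCopies P T := by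
  refine ⟨(fun x => {y | y ∈ T ∧ Φ y = Φ x}) '' T, ?_, ?_, ?_⟩
  · rintro _ ⟨x, hx, rfl⟩
    exact h x hx
  · rintro _ ⟨x, hx, rfl⟩ _ ⟨y, hy, rfl⟩ hne
    simp only [Function.onFun, id]
    rw [Set.disjoint_left]
    rintro z ⟨hz, hzx⟩ ⟨_, hzy⟩
    apply hne
    simp only [← hzx, ← hzy]
  · ext z
    simp only [Set.mem_sUnion, Set.mem_image]
    constructor
    · rintro ⟨_, ⟨x, hx, rfl⟩, hz⟩
      exact hz.1
    · intro hz
      exact ⟨_, ⟨z, hz, rfl⟩, hz, rfl⟩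

lemma copies_image {P Q Q' : Type*} [PartialOrder P] [PartialOrder Q] [PartialOrder Q']
    (φ : Q ↪o Q') (T : Set Q) (h : PartitionedIntoCopies P T) :
    PartitionedIntoCopies P (φ '' T) := by
  obtain ⟨C, h1, h2, h3⟩ := h
  refine ⟨(fun A => φ '' A) '' C, ?_, ?_, ?_⟩
  · rintro _ ⟨A, hA, rfl⟩
    obtain ⟨e⟩ := h1 A hA
    refine ⟨e.trans ?_⟩
    refine ⟨Equiv.Set.image φ A φ.injective, ?_⟩
    intro x y
    exact φ.le_iff_le
  · rintro _ ⟨A, hA, rfl⟩ _ ⟨B, hB, rfl⟩ hne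
    simp only [Function.onFun, id]
    rw [Set.disjoint_image_iff φ.injective]
    exact h2 hA hB (fun h => hne (by rw [h]))
  · rw [← h3, Set.sUnion_eq_biUnion, Set.sUnion_eq_biUnion, Set.image_iUnion₂, Set.biUnion_image]

lemma copies_iUnion {P Q ι : Type*} [PartialOrder P] [PartialOrder Q] (T : ι → Set Q)
    (h : ∀ i, PartitionedIntoCopies P (T i)) (hd : ∀ i j, i ≠ j → Disjoint (T i) (T j)) :
    PartitionedIntoCopies P (⋃ i, T i) := by
  choose C h1 h2 h3 using h
  refine ⟨⋃ i, C i, ?_, ?_, ?_⟩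
  · intro A hA
    obtain ⟨i, hi⟩ := Set.mem_iUnion.1 hA
    exact h1 i A hi
  · intro A hA B hB hne
    obtain ⟨i, hi⟩ := Set.mem_iUnion.1 hA
    obtain ⟨j, hj⟩ := Set.mem_iUnion.1 hB
    by_cases hij : i = j
    · subst hij
      exact h2 i hi hj hne
    · have := hd i j hij
      rw [← h3 i, ← h3 j] at this
      exact this.mono (Set.subset_sUnion_of_mem hi) (Set.subset_sUnion_of_mem hj)
  · rw [Set.sUnion_iUnion]
    simp only [h3]

/-- The cyclic walk: the `q`-th block of a monotone tiling of `[a] × [s]`. -/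
lemma walk (a s q : ℕ) (ha : 0 < a) (hs : a ≤ s) (hq : q < s) :
    ∃ (t : Fin a → Fin a) (e : Fin a → Fin s), Monotone t ∧ StrictMono e ∧
      ∀ (t' : Fin a) (e' : Fin s), ((t' : ℕ) * s + (s - 1 - (e' : ℕ))) / a = q ↔
        ∃ y, t' = t y ∧ e' = e y := by
  classical
  let F : Finset (Fin s) := Finset.univ.filter fun e' =>
    ∃ t' : Fin a, ((t' : ℕ) * s + (s - 1 - (e' : ℕ))) / a = q
  have key : ∀ (t1 t2 : Fin a) (e1 e2 : Fin s),
      ((t1 : ℕ) * s + (s - 1 - (e1 : ℕ))) / a = q → ((t2 : ℕ) * s + (s - 1 - (e2 : ℕ))) / a = q →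
      e1 ≤ e2 → t1 ≤ t2 := by
    intro t1 t2 e1 e2 h1 h2 h
    by_contra hlt
    push Not at hlt
    have hlt' : (t2 : ℕ) + 1 ≤ t1 := hlt
    have h' : (e1 : ℕ) ≤ e2 := h
    have he2 := e2.2
    have he1 := e1.2
    have hm : ((t2 : ℕ) + 1) * s ≤ t1 * s := Nat.mul_le_mul_right _ hlt'
    rw [Nat.div_eq_iff ha] at h1 h2
    have : ((t2 : ℕ) + 1) * s = t2 * s + s := by ring
    omega
  have hcard : F.card = a := by
    have : F = Finset.univ.image (fun c : Fin a =>
        (⟨s - 1 - (q * a + c) % s, by omega⟩ : Fin s)) := by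
      ext e'
      simp only [F, Finset.mem_filter, Finset.mem_univ, true_and, Finset.mem_image]
      have he := e'.2
      constructor
      · rintro ⟨t', h⟩
        rw [Nat.div_eq_iff ha] at h
        refine ⟨⟨(t' : ℕ) * s + (s - 1 - (e' : ℕ)) - q * a, by omega⟩, ?_⟩
        ext
        simp only
        have : q * a + ((t' : ℕ) * s + (s - 1 - (e' : ℕ)) - q * a)
          = (s - 1 - e') + s * t' := by rw [mul_comm s]; omega
        rw [this, Nat.add_mul_mod_self_left, Nat.mod_eq_of_lt (by omega)]
        omega
      · rintro ⟨c, rfl⟩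
        have hc := c.2
        have hlt : q * a + c < a * s := by nlinarith
        refine ⟨⟨(q * a + c) / s, Nat.div_lt_of_lt_mul (by rw [mul_comm s]; exact hlt)⟩, ?_⟩
        simp only
        have hmod : (q * a + c) % s < s := Nat.mod_lt _ (by omega)
        have h1 : s - 1 - (s - 1 - (q * a + c) % s) = (q * a + c) % s := by omega
        rw [h1, Nat.div_add_mod', Nat.div_eq_iff ha]
        omega
    rw [this, Finset.card_image_of_injective, Finset.card_univ, Fintype.card_fin]
    intro c1 c2 h
    simp only [Fin.mk.injEq] at h
    have hc1 := c1.2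
    have hc2 := c2.2
    have m1 : (q * a + c1) % s < s := Nat.mod_lt _ (by omega)
    have m2 : (q * a + c2) % s < s := Nat.mod_lt _ (by omega)
    have h' : (q * a + c1) % s = (q * a + c2) % s := by omega
    have h'' : (c1 : ℕ) ≡ c2 [MOD s] := Nat.ModEq.add_left_cancel' _ h'
    have := Nat.ModEq.eq_of_lt_of_lt h'' (by omega) (by omega)
    exact Fin.ext this
  have hF : ∀ y, ∃ t' : Fin a,
      ((t' : ℕ) * s + (s - 1 - ((F.orderEmbOfFin hcard y : Fin s) : ℕ))) / a = q := by
    intro y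
    have := F.orderEmbOfFin_mem hcard y
    exact (Finset.mem_filter.1 this).2
  choose t ht using hF
  refine ⟨t, F.orderEmbOfFin hcard, ?_, (F.orderEmbOfFin hcard).strictMono, ?_⟩
  · intro y1 y2 h
    exact key _ _ _ _ (ht y1) (ht y2) ((F.orderEmbOfFin hcard).monotone h)
  · intro t' e'
    constructor
    · intro h
      have he : e' ∈ F := by
        simp only [F, Finset.mem_filter, Finset.mem_univ, true_and]
        exact ⟨t', h⟩
      have : e' ∈ Set.range (F.orderEmbOfFin hcard) := by
        rw [Finset.range_orderEmbOfFin]; exact he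
      obtain ⟨y, rfl⟩ := this
      exact ⟨y, le_antisymm (key _ _ _ _ h (ht y) le_rfl) (key _ _ _ _ (ht y) h le_rfl), rfl⟩
    · rintro ⟨y, rfl, rfl⟩
      exact ht y

/-- A numbering of the grid that extends the grid order and in which coordinate `j` dominates. -/
lemma numbering {d : ℕ} (a : Fin d → ℕ) (j : Fin d) (p : ℕ) (hp : p = ∏ i, a i) :
    ∃ τ : (∀ i, Fin (a i)) ≃ Fin p, (∀ t t', t ≤ t' → τ t ≤ τ t') ∧
      ∀ t t', τ t ≤ τ t' → t j ≤ t' j := by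
  classical
  let key : (∀ i, Fin (a i)) → Fin (a j) ×ₗ LinearExtension (∀ i, Fin (a i)) :=
    fun t => toLex (t j, toLinearExtension t)
  have hinj : Function.Injective key := by
    intro t t' h
    have := congrArg (fun z => (ofLex z).2) h
    exact this
  have hcard : Fintype.card (Set.range key) = p := by
    rw [Set.card_range_of_injective hinj]; simp [hp]
  let e := Fintype.orderIsoFinOfCardEq (Set.range key) hcard
  have he : ∀ t t', e.symm ⟨key t, t, rfl⟩ ≤ e.symm ⟨key t', t', rfl⟩ ↔ key t ≤ key t' :=
    fun t t' => e.symm.le_iff_le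
  refine ⟨(Equiv.ofInjective key hinj).trans e.symm.toEquiv, ?_, ?_⟩
  · intro t t' h
    refine (he t t').2 ?_
    rw [Prod.Lex.le_iff]
    rcases (h j).lt_or_eq with h1 | h1
    · exact Or.inl h1
    · exact Or.inr ⟨h1, toLinearExtension.monotone h⟩
  · intro t t' h
    have h := (he t t').1 h
    rw [Prod.Lex.le_iff] at h
    rcases h with h | h
    · exact le_of_lt h
    · exact le_of_eq h.1

lemma box {d : ℕ} (a s : Fin d → ℕ) (ha : ∀ i, 0 < a i) (has : ∀ i, a i ≤ s i) (j : Fin d)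
    (hj : s j = ∏ i, a i) :
    PartitionedIntoCopies (∀ i, Fin (a i)) (Set.univ : Set (∀ i, Fin (s i))) := by
  classical
  obtain ⟨τ, h1, h2⟩ := numbering a j (s j) hj
  let Φ : (∀ i, Fin (s i)) → Fin d → ℕ := fun x i =>
    if i = j then 0 else ((τ.symm (x j) i : ℕ) * s i + (s i - 1 - (x i : ℕ))) / a i
  apply copies_of_fibres _ Φ
  intro x0 _
  have hW : ∀ i, ∃ (t : Fin (a i) → Fin (a i)) (e : Fin (a i) → Fin (s i)), Monotone t ∧
      (i = j → t = id) ∧ (i ≠ j → StrictMono e ∧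
      ∀ (t' : Fin (a i)) (e' : Fin (s i)),
        ((t' : ℕ) * s i + (s i - 1 - (e' : ℕ))) / a i = Φ x0 i ↔ ∃ y, t' = t y ∧ e' = e y) := by
    intro i
    by_cases hij : i = j
    · exact ⟨id, fun _ => ⟨0, (ha i).trans_le (has i)⟩, monotone_id, fun _ => rfl,
        fun h => absurd hij h⟩
    · have hq : Φ x0 i < s i := by
        simp only [Φ, if_neg hij]
        apply Nat.div_lt_of_lt_mul
        have hx := (x0 i).2
        have ht := (τ.symm (x0 j) i).2
        have : ((τ.symm (x0 j) i : ℕ) + 1) * s i ≤ a i * s i := Nat.mul_le_mul_right _ ht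
        have h3 : ((τ.symm (x0 j) i : ℕ) + 1) * s i = (τ.symm (x0 j) i : ℕ) * s i + s i := by ring
        omega
      obtain ⟨t, e, ht, he, h⟩ := walk (a i) (s i) (Φ x0 i) (ha i) (has i) hq
      exact ⟨t, e, ht, fun h => absurd h hij, fun _ => ⟨he, h⟩⟩
  choose t e ht htj hte using hW
  let G : (∀ i, Fin (a i)) → (∀ i, Fin (s i)) := fun y =>
    Function.update (fun i => e i (y i)) j (τ (fun i => t i (y i)))
  have hGj : ∀ y, G y j = τ (fun i => t i (y i)) := fun y => by simp [G]
  have hGi : ∀ y i, i ≠ j → G y i = e i (y i) := fun y i hi => by simp [G, hi]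
  have hGle : ∀ y y', G y ≤ G y' ↔ y ≤ y' := by
    intro y y'
    constructor
    · intro h i
      by_cases hij : i = j
      · subst hij
        have := h i
        rw [hGj, hGj] at this
        have := h2 _ _ this
        simpa [htj i rfl] using this
      · have := h i
        rw [hGi _ _ hij, hGi _ _ hij] at this
        exact (hte i hij).1.le_iff_le.1 this
    · intro h i
      by_cases hij : i = j
      · subst hij
        rw [hGj, hGj]
        exact h1 _ _ (fun i => ht i (h i))
      · rw [hGi _ _ hij, hGi _ _ hij]
        exact (hte i hij).1.monotone (h i)
  let G' : (∀ i, Fin (a i)) ↪o (∀ i, Fin (s i)) := OrderEmbedding.ofMapLEIff G hGle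
  have hr : Set.range G' = {y | y ∈ Set.univ ∧ Φ y = Φ x0} := by
    ext x
    simp only [Set.mem_range, Set.mem_univ, true_and, Set.mem_ofPred_eq]
    constructor
    · rintro ⟨y, rfl⟩
      funext i
      by_cases hij : i = j
      · simp [Φ, hij]
      · have : Φ (G y) i = ((τ.symm (G y j) i : ℕ) * s i + (s i - 1 - (G y i : ℕ))) / a i := by
          simp only [Φ, if_neg hij]
        change Φ (G y) i = _
        rw [this, hGj, hGi _ _ hij, Equiv.symm_apply_apply]
        exact ((hte i hij).2 _ _).2 ⟨y i, rfl, rfl⟩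
    · intro hx
      have hy : ∀ i, ∃ y, τ.symm (x j) i = t i y ∧ (i ≠ j → x i = e i y) := by
        intro i
        by_cases hij : i = j
        · exact ⟨τ.symm (x j) i, by rw [htj i hij]; rfl, fun h => absurd hij h⟩
        · have := congrFun hx i
          simp only [Φ] at this
          rw [if_neg hij, if_neg hij] at this
          have h3 : ((τ.symm (x j) i : ℕ) * s i + (s i - 1 - (x i : ℕ))) / a i = Φ x0 i := by
            simp only [Φ, if_neg hij]; exact this
          obtain ⟨y, hy1, hy2⟩ := ((hte i hij).2 _ _).1 h3
          exact ⟨y, hy1, fun _ => hy2⟩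
      choose y hy1 hy2 using hy
      refine ⟨y, ?_⟩
      change G y = x
      funext i
      by_cases hij : i = j
      · subst hij
        rw [hGj]
        rw [← Equiv.eq_symm_apply]
        funext i'
        exact (hy1 i').symm
      · rw [hGi _ _ hij, hy2 i hij]
  rw [← hr]
  exact ⟨G'.orderIso⟩

lemma chain_emb {X : Type*} [PartialOrder X] (K : Finset X) (hK : IsChain (· ≤ ·) (K : Set X))
    (s : ℕ) (hs : K.card = s) : ∃ φ : Fin s ↪o X, Set.range φ = (K : Set X) := by
  classical
  have htot : ∀ x y : K, x ≤ y ∨ y ≤ x := fun x y => hK.total x.2 y.2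
  let lo : LinearOrder K :=
    { (inferInstance : PartialOrder K) with
      le_total := htot
      toDecidableLE := Classical.decRel _ }
  let e := @Fintype.orderIsoFinOfCardEq K lo _ s (by simp [hs])
  refine ⟨OrderEmbedding.ofMapLEIff (fun i => ((e i : K) : X)) ?_, ?_⟩
  · intro i j
    exact e.le_iff_le
  · ext x
    simp only [Set.mem_range, Finset.mem_coe]
    constructor
    · rintro ⟨i, rfl⟩
      exact (e i).2
    · intro hx
      exact ⟨e.symm ⟨x, hx⟩, by simp⟩

/-- A partition of `X` into chains of size `p`, apart from one chain `S` whose size lies in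
`[p, 2 * p]`. -/
structure ChainTiling (X : Type*) [PartialOrder X] (p : ℕ) where
  blocks : Set (Finset X)
  S : Finset X
  memS : S ∈ blocks
  chain : ∀ K ∈ blocks, IsChain (· ≤ ·) (K : Set X)
  uniq : ∀ K ∈ blocks, ∀ K' ∈ blocks, ∀ x ∈ K, x ∈ K' → K = K'
  cover : ∀ x, ∃ K ∈ blocks, x ∈ K
  card_eq : ∀ K ∈ blocks, K ≠ S → K.card = p
  le_cardS : p ≤ S.card
  cardS_le : S.card ≤ 2 * p

lemma ChainTiling.le_card {X : Type*} [PartialOrder X] {p : ℕ} (c : ChainTiling X p) (K : Finset X)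
    (hK : K ∈ c.blocks) : p ≤ K.card := by
  by_cases h : K = c.S
  · rw [h]; exact c.le_cardS
  · exact (c.card_eq K hK h).ge

lemma combine {d : ℕ} (a : Fin d → ℕ) (ha : ∀ i, 0 < a i) (X : Fin d → Type*)
    [∀ i, PartialOrder (X i)] (c : ∀ i, ChainTiling (X i) (∏ i, a i)) :
    PartitionedIntoCopies (∀ i, Fin (a i)) ({x : ∀ i, X i | ∀ i, x i ∈ (c i).S}ᶜ) := by
  classical
  let ι := {K : ∀ i, Finset (X i) // (∀ i, K i ∈ (c i).blocks) ∧ ∃ i, K i ≠ (c i).S}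
  have hU : ({x : ∀ i, X i | ∀ i, x i ∈ (c i).S}ᶜ) = ⋃ K : ι, {x | ∀ i, x i ∈ K.1 i} := by
    ext x
    simp only [Set.mem_compl_iff, Set.mem_ofPred_eq, Set.mem_iUnion]
    constructor
    · intro hx
      push Not at hx
      obtain ⟨i, hi⟩ := hx
      choose K hK hxK using fun i => (c i).cover (x i)
      exact ⟨⟨K, hK, i, fun h => hi (h ▸ hxK i)⟩, hxK⟩
    · rintro ⟨⟨K, hK, i, hi⟩, hx⟩ hS
      exact hi ((c i).uniq _ (hK i) _ (c i).memS _ (hx i) (hS i))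
  rw [hU]
  apply copies_iUnion
  · rintro ⟨K, hK, j, hj⟩
    simp only
    choose φ hφ using fun i => chain_emb (K i) ((c i).chain _ (hK i)) _ rfl
    have has : ∀ i, a i ≤ (K i).card := fun i => le_trans
      (Nat.le_of_dvd (Finset.prod_pos fun i _ => ha i) (Finset.dvd_prod_of_mem a (Finset.mem_univ i)))
      ((c i).le_card _ (hK i))
    have hb := box a (fun i => (K i).card) ha has j ((c j).card_eq _ (hK j) hj)
    have hφ' : ∀ i x, x ∈ K i ↔ ∃ y, φ i y = x := by
      intro i x
      have := Set.ext_iff.1 (hφ i) x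
      simpa using this.symm
    let ψ : (∀ i, Fin (K i).card) ↪o (∀ i, X i) :=
      OrderEmbedding.ofMapLEIff (fun y i => φ i (y i)) (by
        intro y y'
        simp [Pi.le_def])
    have := copies_image ψ _ hb
    convert this using 1
    ext x
    simp only [Set.mem_ofPred_eq, Set.image_univ, Set.mem_range]
    constructor
    · intro hx
      choose y hy using fun i => (hφ' i (x i)).1 (hx i)
      exact ⟨y, funext hy⟩
    · rintro ⟨y, rfl⟩ i
      exact (hφ' i _).2 ⟨y i, rfl⟩
  · rintro ⟨K, hK, _⟩ ⟨K', hK', _⟩ hne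
    rw [Set.disjoint_left]
    intro x hx hx'
    apply hne
    apply Subtype.ext
    funext i
    exact (c i).uniq _ (hK i) _ (hK' i) _ (hx i) (hx' i)

/-- Splitting the Boolean lattice along the fibres of a map. -/
lemma split_iso {α : Type*} [Fintype α] {d : ℕ} (c : α → Fin d) :
    Nonempty ((∀ i, Finset {x // c x = i}) ≃o Finset α) := by
  classical
  let F : (∀ i, Finset {x // c x = i}) → Finset α := fun f =>
    Finset.univ.filter fun x => (⟨x, rfl⟩ : {y // c y = c x}) ∈ f (c x)
  have hF : ∀ f x, x ∈ F f ↔ (⟨x, rfl⟩ : {y // c y = c x}) ∈ f (c x) := fun f x => by simp [F]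
  have hF2 : ∀ f i (y : {x // c x = i}), y ∈ f i ↔ (y : α) ∈ F f := by
    rintro f i ⟨x, rfl⟩
    rw [hF]
  have hle : ∀ f g, F f ≤ F g ↔ f ≤ g := by
    intro f g
    constructor
    · intro h i y hy
      rw [hF2] at hy ⊢
      exact h hy
    · intro h x hx
      rw [hF] at hx ⊢
      exact h _ hx
  have hsurj : Function.Surjective F := by
    intro A
    obtain ⟨g, hg⟩ : ∃ g : ∀ i, Finset {x // c x = i}, ∀ i y, y ∈ g i ↔ (y : α) ∈ A :=
      ⟨fun i => Finset.univ.filter fun y => (y : α) ∈ A, fun i y => by simp⟩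
    refine ⟨g, ?_⟩
    ext x
    rw [hF, hg]
  exact ⟨(OrderEmbedding.ofMapLEIff F hle).orderIso.trans
    ((OrderIso.setCongr _ _ (Set.range_eq_univ.2 hsurj)).trans OrderIso.Set.univ)⟩

lemma fibre_card (n d N : ℕ) (hd : 0 < d) (h : N * d ≤ n) (i : Fin d) :
    N ≤ Fintype.card {x : Fin n // (⟨(x : ℕ) % d, Nat.mod_lt _ hd⟩ : Fin d) = i} := by
  have hlt : ∀ j : Fin N, (i : ℕ) + d * j < n := by
    intro j
    have h1 := j.2
    have h2 := i.2
    have : d * ((j : ℕ) + 1) ≤ d * N := Nat.mul_le_mul_left _ h1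
    nlinarith
  have := Fintype.card_le_of_injective (α := Fin N)
    (β := {x : Fin n // (⟨(x : ℕ) % d, Nat.mod_lt _ hd⟩ : Fin d) = i})
    (fun j => ⟨⟨i + d * j, hlt j⟩, by
      ext
      simp [Nat.add_mul_mod_self_left, Nat.mod_eq_of_lt i.2]⟩) (by
      intro j j' h
      simp only [Subtype.mk.injEq, Fin.mk.injEq, Nat.add_left_cancel_iff] at h
      exact Fin.ext (Nat.eq_of_mul_eq_mul_left hd h))
  simpa using this

theorem main_of_factor (factor : ∀ (p : ℕ), 0 < p → ∀ (α : Type) [Fintype α],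
      800 * p ^ 2 ≤ Fintype.card α → Nonempty (ChainTiling (Finset α) p)) :
    ∃ C : ℕ, ∀ (d : ℕ), 0 < d → ∀ (a : Fin d → ℕ), (∀ i, 0 < a i) →
      ∀ n : ℕ, C * d * (∏ i, a i) ^ 4 ≤ n →
        ∃ S : Finset (Finset (Fin n)), S.card ≤ (24 * (∏ i, a i) ^ 2) ^ d ∧
          PartitionedIntoCopies (∀ i, Fin (a i)) ((↑S : Set (Finset (Fin n)))ᶜ) := by
  classical
  refine ⟨800, fun d hd a ha n hn => ?_⟩
  set p := ∏ i, a i with hp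
  have hp0 : 0 < p := Finset.prod_pos fun i _ => ha i
  let c : Fin n → Fin d := fun x => ⟨(x : ℕ) % d, Nat.mod_lt _ hd⟩
  have hN : ∀ i, 800 * p ^ 2 ≤ Fintype.card {x : Fin n // c x = i} := by
    intro i
    apply fibre_card n d _ hd
    refine le_trans ?_ hn
    have : p ^ 2 ≤ p ^ 4 := Nat.pow_le_pow_right hp0 (by norm_num)
    calc 800 * p ^ 2 * d = 800 * d * p ^ 2 := by ring
      _ ≤ _ := Nat.mul_le_mul_left _ this
  have T : ∀ i, ChainTiling (Finset {x : Fin n // c x = i}) p := fun i =>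
    (factor p hp0 _ (hN i)).some
  obtain ⟨e⟩ := split_iso c
  refine ⟨(Fintype.piFinset fun i => (T i).S).map e.toEquiv.toEmbedding, ?_, ?_⟩
  · rw [Finset.card_map, Fintype.card_piFinset]
    calc ∏ i, (T i).S.card ≤ ∏ i : Fin d, (24 * p ^ 2) := by
          apply Finset.prod_le_prod'
          intro i _
          refine (T i).cardS_le.trans ?_
          nlinarith
      _ = _ := by simp
  · have := copies_image e.toOrderEmbedding _ (combine a ha _ T)
    convert this using 1
    ext A
    obtain ⟨f, rfl⟩ := e.surjective A
    simp

/-- The set can be partitioned into chains of size `p`. -/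
inductive Tile {Q : Type*} [PartialOrder Q] (p : ℕ) : Set Q → Prop
  | empty : Tile p ∅
  | add (c : Finset Q) (T : Set Q) (hc : IsChain (· ≤ ·) (c : Set Q)) (hcard : c.card = p)
      (hd : Disjoint (c : Set Q) T) (hT : Tile p T) : Tile p (↑c ∪ T)

lemma Tile.union {Q : Type*} [PartialOrder Q] {p : ℕ} {A B : Set Q} (hA : Tile p A)
    (hB : Tile p B) (hd : Disjoint A B) : Tile p (A ∪ B) := by
  induction hA with
  | empty => simpa using hB
  | add c T hc hcard hcT hT ih =>
    rw [Set.disjoint_union_left] at hd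
    rw [Set.union_assoc]
    refine Tile.add c _ hc hcard ?_ (ih hd.2)
    rw [Set.disjoint_union_right]
    exact ⟨hcT, hd.1⟩

lemma Tile.ofChain {Q : Type*} [PartialOrder Q] {p : ℕ} (k : ℕ) :
    ∀ (c : Finset Q), IsChain (· ≤ ·) (c : Set Q) → c.card = k * p → Tile p (c : Set Q) := by
  classical
  induction k with
  | zero =>
    intro c _ h
    have : c = ∅ := by simpa using h
    subst this
    simpa using Tile.empty
  | succ k ih =>
    intro c hc h
    have hk : (k + 1) * p = k * p + p := by ring
    obtain ⟨b, hb, hbc⟩ := Finset.exists_subset_card_eq (s := c) (n := p) (by omega)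
    have h1 := ih (c \ b) (hc.mono (by simp))
      (by rw [Finset.card_sdiff_of_subset hb]; omega)
    have h2 := Tile.add b _ (hc.mono (by exact_mod_cast hb)) hbc
      (by rw [Finset.disjoint_coe]; exact Finset.disjoint_sdiff) h1
    rwa [← Finset.coe_union, Finset.union_sdiff_of_subset hb] at h2

lemma Tile.biUnion {Q ι : Type*} [PartialOrder Q] {p : ℕ} (s : Finset ι) (f : ι → Set Q)
    (hf : ∀ i ∈ s, Tile p (f i)) (hd : ∀ i ∈ s, ∀ j ∈ s, i ≠ j → Disjoint (f i) (f j)) :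
    Tile p (⋃ i ∈ s, f i) := by
  classical
  induction s using Finset.induction_on with
  | empty => simpa using Tile.empty
  | insert a s ha ih =>
    rw [Finset.set_biUnion_insert]
    refine Tile.union (hf a (by simp)) (ih (fun i hi => hf i (by simp [hi]))
      (fun i hi j hj => hd i (by simp [hi]) j (by simp [hj]))) ?_
    rw [Set.disjoint_iUnion₂_right]
    intro i hi
    exact hd a (by simp) i (by simp [hi]) (fun h => ha (h ▸ hi))

lemma Tile.image {Q Q' : Type*} [PartialOrder Q] [PartialOrder Q'] {p : ℕ} (φ : Q ↪o Q')
    {A : Set Q} (hA : Tile p A) : Tile p (φ '' A) := by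
  classical
  induction hA with
  | empty => simpa using Tile.empty
  | add c T hc hcard hcT hT ih =>
    have := Tile.add (c.map φ.toEmbedding) _ ?_ (by simpa using hcard) ?_ ih
    · rw [Set.image_union]
      convert this using 2
      ext; simp
    · rintro x hx y hy _
      simp only [Finset.coe_map, Set.mem_image] at hx hy
      obtain ⟨x, hx, rfl⟩ := hx
      obtain ⟨y, hy, rfl⟩ := hy
      simpa using hc.total hx hy
    · have h2 := (Set.disjoint_image_iff φ.injective).2 hcT
      rw [Finset.coe_map]
      exact h2

lemma Tile.blocks {Q : Type*} [PartialOrder Q] {p : ℕ} {A : Set Q} (hA : Tile p A) :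
    ∃ C : Set (Finset Q), (∀ K ∈ C, IsChain (· ≤ ·) (K : Set Q)) ∧ (∀ K ∈ C, K.card = p) ∧
      (∀ K ∈ C, ∀ K' ∈ C, ∀ x ∈ K, x ∈ K' → K = K') ∧ ∀ x, x ∈ A ↔ ∃ K ∈ C, x ∈ K := by
  induction hA with
  | empty => exact ⟨∅, by simp, by simp, by simp, by simp⟩
  | add c T hc hcard hcT hT ih =>
    obtain ⟨C, h1, h2, h3, h4⟩ := ih
    refine ⟨insert c C, ?_, ?_, ?_, ?_⟩
    · rintro K (rfl | hK)
      exacts [hc, h1 K hK]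
    · rintro K (rfl | hK)
      exacts [hcard, h2 K hK]
    · rintro K (rfl | hK) K' (rfl | hK') x hx hx'
      · rfl
      · exact absurd ((h4 x).2 ⟨K', hK', hx'⟩) (Set.disjoint_left.1 hcT hx)
      · exact absurd ((h4 x).2 ⟨K, hK, hx⟩) (Set.disjoint_left.1 hcT hx')
      · exact h3 K hK K' hK' x hx hx'
    · intro x
      simp [h4 x]

lemma Tile.chainTiling {Q : Type*} [PartialOrder Q] {p : ℕ} (S : Finset Q)
    (hS : IsChain (· ≤ ·) (S : Set Q)) (h1 : p ≤ S.card) (h2 : S.card ≤ 2 * p)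
    (hT : Tile p ((S : Set Q)ᶜ)) : Nonempty (ChainTiling Q p) := by
  classical
  obtain ⟨C, c1, c2, c3, c4⟩ := hT.blocks
  refine ⟨⟨insert S C, S, by simp, ?_, ?_, ?_, ?_, h1, h2⟩⟩
  · rintro K (rfl | hK)
    exacts [hS, c1 K hK]
  · rintro K (rfl | hK) K' (rfl | hK') x hx hx'
    · rfl
    · exact absurd hx ((c4 x).2 ⟨K', hK', hx'⟩)
    · exact absurd hx' ((c4 x).2 ⟨K, hK, hx⟩)
    · exact c3 K hK K' hK' x hx hx'
  · intro x
    by_cases hx : x ∈ S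
    · exact ⟨S, by simp, hx⟩
    · obtain ⟨K, hK, hxK⟩ := (c4 x).1 hx
      exact ⟨K, by simp [hK], hxK⟩
  · rintro K (rfl | hK) hne
    · exact absurd rfl hne
    · exact c2 K hK

lemma isChain_mk {X Y : Type*} [PartialOrder X] [PartialOrder Y] (x : X) (s : Set Y)
    (hs : IsChain (· ≤ ·) s) : IsChain (· ≤ ·) (Prod.mk x '' s) := by
  rintro _ ⟨a, ha, rfl⟩ _ ⟨b, hb, rfl⟩ _
  simpa using hs.total ha hb

/-- Inside the column over `y`, leave out a part of the middle so that the rest is tiled. -/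
lemma column {X Y : Type*} [PartialOrder X] [PartialOrder Y] {p : ℕ} (hp : 0 < p) (y : X)
    (h U Mid : Finset Y) (hh : IsChain (· ≤ ·) (h : Set Y)) (hU : U ⊆ h) (hM : Mid ⊆ h)
    (hUM : Disjoint U Mid) (hcard : 2 * p ≤ Mid.card) :
    ∃ R ⊆ Mid, p ≤ R.card ∧ R.card ≤ 2 * p ∧
      Tile p (Prod.mk y '' {z | z ∈ h ∧ z ∉ U ∧ z ∉ R}) := by
  classical
  have hlt : (h.card - U.card) % p < p := Nat.mod_lt _ hp
  obtain ⟨R, hR, hRc⟩ := Finset.exists_subset_card_eq (s := Mid)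
    (n := p + (h.card - U.card) % p) (by omega)
  refine ⟨R, hR, by omega, by omega, ?_⟩
  have hUR : Disjoint U R := hUM.mono_right hR
  have hsub : U ∪ R ⊆ h := Finset.union_subset hU (hR.trans hM)
  have hc1 : (U ∪ Mid).card ≤ h.card := Finset.card_le_card (Finset.union_subset hU hM)
  rw [Finset.card_union_of_disjoint hUM] at hc1
  have hc : (h \ (U ∪ R)).card = ((h.card - U.card) / p - 1) * p := by
    rw [Finset.card_sdiff_of_subset hsub, Finset.card_union_of_disjoint hUR, hRc]
    have := Nat.div_add_mod' (h.card - U.card) p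
    rw [Nat.sub_mul]
    omega
  have := Tile.ofChain (p := p) _ ((h \ (U ∪ R)).map ⟨Prod.mk y, Prod.mk_right_injective y⟩) (by
    rw [Finset.coe_map]
    exact isChain_mk y _ (hh.mono (by simp))) (by rw [Finset.card_map]; exact hc)
  convert this using 1
  ext z
  simp [and_assoc]

lemma path_tile {X Y : Type*} [PartialOrder X] [PartialOrder Y] {p : ℕ} (hp : 0 < p)
    (H : X → Finset Y) (B Mid T : Finset Y) (hH : ∀ x, IsChain (· ≤ ·) (H x : Set Y))
    (hB : p ≤ B.card) (hM : 2 * p ≤ Mid.card) (hT : p ≤ T.card)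
    (hBH : ∀ x, B ⊆ H x) (hMH : ∀ x, Mid ⊆ H x) (hTH : ∀ x, T ⊆ H x)
    (hBM : ∀ b ∈ B, ∀ m ∈ Mid, b < m) (hMT : ∀ m ∈ Mid, ∀ t ∈ T, m < t) :
    ∀ (l : List X) (x : X), (x :: l).Nodup → (x :: l).IsChain (fun a b => a ≤ b ∨ b ≤ a) →
      ∃ R ⊆ Mid, p ≤ R.card ∧ R.card ≤ 2 * p ∧
        Tile p {z : X × Y | z.1 ∈ x :: l ∧ z.2 ∈ H z.1 ∧ ¬ (z.1 = x ∧ z.2 ∈ R)} := by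
  classical
  intro l
  induction l with
  | nil =>
    intro x _ _
    obtain ⟨R, h1, h2, h3, h4⟩ := column hp x (H x) ∅ Mid (hH x) (by simp) (hMH x) (by simp) hM
    refine ⟨R, h1, h2, h3, ?_⟩
    convert h4 using 1
    ext ⟨a, b⟩
    simp
    constructor
    · rintro ⟨rfl, h5, h6⟩
      exact ⟨⟨h5, h6 rfl⟩, rfl⟩
    · rintro ⟨⟨h5, h6⟩, rfl⟩
      exact ⟨rfl, h5, fun _ => h6⟩
  | cons x l ih =>
    intro y hnd hch
    rw [List.isChain_cons_cons] at hch
    obtain ⟨hy, hnd'⟩ := List.nodup_cons.1 hnd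
    obtain ⟨R, h1, h2, h3, h4⟩ := ih x hnd' hch.2
    obtain ⟨U, hUH, hUM, hUc, hUcmp⟩ : ∃ U : Finset Y, U ⊆ H y ∧ Disjoint U Mid ∧
        U.card = 2 * p - R.card ∧ ∀ u ∈ U, ∀ r ∈ R, (x, r) ≤ (y, u) ∨ (y, u) ≤ (x, r) := by
      rcases hch.1 with hyx | hxy
      · obtain ⟨U, hU, hUc⟩ := Finset.exists_subset_card_eq (s := B) (n := 2 * p - R.card)
          (by omega)
        refine ⟨U, hU.trans (hBH y), ?_, hUc, ?_⟩
        · rw [Finset.disjoint_left]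
          intro u hu hm
          exact lt_irrefl _ (hBM u (hU hu) u hm)
        · intro u hu r hr
          exact Or.inr ⟨hyx, (hBM u (hU hu) r (h1 hr)).le⟩
      · obtain ⟨U, hU, hUc⟩ := Finset.exists_subset_card_eq (s := T) (n := 2 * p - R.card)
          (by omega)
        refine ⟨U, hU.trans (hTH y), ?_, hUc, ?_⟩
        · rw [Finset.disjoint_left]
          intro u hu hm
          exact lt_irrefl _ (hMT u hm u (hU hu))
        · intro u hu r hr
          exact Or.inl ⟨hxy, (hMT r (h1 hr) u (hU hu)).le⟩
    have hxy : x ≠ y := fun h => hy (by simp [h])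
    obtain ⟨R', g1, g2, g3, g4⟩ := column hp y (H y) U Mid (hH y) hUH (hMH y) hUM hM
    refine ⟨R', g1, g2, g3, ?_⟩
    let c : Finset (X × Y) := R.map ⟨Prod.mk x, Prod.mk_right_injective x⟩ ∪
      U.map ⟨Prod.mk y, Prod.mk_right_injective y⟩
    have hcmem : ∀ a b, (a, b) ∈ c ↔ (a = x ∧ b ∈ R) ∨ (a = y ∧ b ∈ U) := by
      intro a b
      simp only [c, Finset.mem_union, Finset.mem_map, Function.Embedding.coeFn_mk, Prod.mk.injEq]
      constructor
      · rintro (⟨r, hr, rfl, rfl⟩ | ⟨r, hr, rfl, rfl⟩)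
        exacts [Or.inl ⟨rfl, hr⟩, Or.inr ⟨rfl, hr⟩]
      · rintro (⟨rfl, hr⟩ | ⟨rfl, hr⟩)
        exacts [Or.inl ⟨b, hr, rfl, rfl⟩, Or.inr ⟨b, hr, rfl, rfl⟩]
    have hcc : IsChain (· ≤ ·) (c : Set (X × Y)) := by
      rintro ⟨a, b⟩ hab ⟨a', b'⟩ hab' _
      rw [Finset.mem_coe, hcmem] at hab hab'
      rcases hab with ⟨rfl, hb⟩ | ⟨rfl, hb⟩ <;> rcases hab' with ⟨rfl, hb'⟩ | ⟨rfl, hb'⟩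
      · simpa using (hH a').total (hMH a' (h1 hb)) (hMH a' (h1 hb'))
      · exact hUcmp _ hb' _ hb
      · exact (hUcmp _ hb _ hb').symm
      · simpa using (hH a').total (hUH hb) (hUH hb')
    have hccard : c.card = 2 * p := by
      rw [Finset.card_union_of_disjoint, Finset.card_map, Finset.card_map, hUc]
      · omega
      · rw [Finset.disjoint_left]
        simp only [Finset.mem_map, Function.Embedding.coeFn_mk]
        rintro _ ⟨r, _, rfl⟩ ⟨u, _, h⟩
        simp only [Prod.mk.injEq] at h
        exact hxy h.1.symm
    have hct := Tile.ofChain 2 c hcc hccard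
    have h5 := (h4.union hct ?_).union g4 ?_
    · convert h5 using 1
      ext ⟨a, b⟩
      simp only [Set.mem_ofPred_eq, Set.mem_union, Finset.mem_coe, hcmem, Set.mem_image,
        Prod.mk.injEq, List.mem_cons]
      constructor
      · rintro ⟨rfl | hm, hb, hn⟩
        · by_cases hbU : b ∈ U
          · exact Or.inl (Or.inr (Or.inr ⟨rfl, hbU⟩))
          · exact Or.inr ⟨b, ⟨hb, hbU, fun h => hn ⟨rfl, h⟩⟩, rfl, rfl⟩
        · by_cases hxR : a = x ∧ b ∈ R
          · exact Or.inl (Or.inr (Or.inl hxR))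
          · exact Or.inl (Or.inl ⟨hm, hb, hxR⟩)
      · rintro ((⟨hm, hb, hn⟩ | (⟨rfl, hb⟩ | ⟨rfl, hb⟩)) | ⟨b, ⟨hb, hbU, hbR⟩, rfl, rfl⟩)
        · refine ⟨Or.inr hm, hb, ?_⟩
          rintro ⟨rfl, _⟩
          exact hy (by simpa using hm)
        · exact ⟨Or.inr (Or.inl rfl), hMH _ (h1 hb), fun h => hxy h.1⟩
        · exact ⟨Or.inl rfl, hUH hb, fun h => Finset.disjoint_left.1 hUM hb (g1 h.2)⟩
        · exact ⟨Or.inl rfl, hb, fun h => hbR h.2⟩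
    · rw [Set.disjoint_left]
      rintro ⟨a, b⟩ ⟨hm, hb, hn⟩ hab
      rw [Finset.mem_coe, hcmem] at hab
      rcases hab with h | ⟨rfl, _⟩
      · exact hn h
      · exact hy hm
    · rw [Set.disjoint_left]
      rintro ⟨a, b⟩ hab ⟨b', ⟨hb', hbU, hbR⟩, heq⟩
      simp only [Prod.mk.injEq] at heq
      obtain ⟨rfl, rfl⟩ := heq
      rcases hab with ⟨hm, _, _⟩ | hab
      · exact hy hm
      · rw [Finset.mem_coe, hcmem] at hab
        rcases hab with ⟨h, _⟩ | ⟨_, h⟩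
        · exact hxy h.symm
        · exact hbU h

/-- A Gray code: a Hamiltonian path of the cube with prescribed first vertex. -/
lemma gray {α : Type*} [DecidableEq α] (s : Finset α) : ∀ u, u ⊆ s → ∃ l : List (Finset α),
    (u :: l).Nodup ∧ (u :: l).IsChain (fun a b => a ≤ b ∨ b ≤ a) ∧ ∀ x, x ∈ u :: l ↔ x ⊆ s := by
  induction s using Finset.induction_on with
  | empty =>
    intro u hu
    have : u = ∅ := by simpa using hu
    subst this
    exact ⟨[], by simp, by simp, by simp⟩
  | insert a s ha ih =>
    have main : ∀ f g : Finset α → Finset α, (∀ x y, x ⊆ s → y ⊆ s → f x = f y → x = y) →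
        (∀ x y, x ⊆ s → y ⊆ s → g x = g y → x = y) →
        (∀ x y, x ⊆ s → y ⊆ s → f x ≠ g y) →
        Monotone f → Monotone g → (∀ x, f x ≤ g x ∨ g x ≤ f x) → ∀ u0, u0 ⊆ s → 
        ∃ l : List (Finset α), (f u0 :: l).Nodup ∧
          (f u0 :: l).IsChain (fun a b => a ≤ b ∨ b ≤ a) ∧
          ∀ x, x ∈ f u0 :: l ↔ ∃ y, y ⊆ s ∧ (x = f y ∨ x = g y) := by
      intro f g hf hg hfg mf mg hc u0 hu0
      obtain ⟨l, l1, l2, l3⟩ := ih u0 hu0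
      set v := (u0 :: l).getLast (by simp) with hv
      have hvs : v ⊆ s := (l3 v).1 (List.getLast_mem _)
      obtain ⟨l', k1, k2, k3⟩ := ih v hvs
      refine ⟨l.map f ++ (v :: l').map g, ?_, ?_, ?_⟩
      · rw [← List.cons_append, ← List.map_cons, List.nodup_append]
        refine ⟨List.Nodup.map_on (fun x hx y hy h => hf x y ((l3 x).1 hx) ((l3 y).1 hy) h) l1,
          List.Nodup.map_on (fun x hx y hy h => hg x y ((k3 x).1 hx) ((k3 y).1 hy) h) k1, ?_⟩
        intro x hx y hy
        rw [List.mem_map] at hx hy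
        obtain ⟨x, hx, rfl⟩ := hx
        obtain ⟨y, hy, rfl⟩ := hy
        exact hfg x y ((l3 x).1 hx) ((k3 y).1 hy)
      · rw [← List.cons_append, ← List.map_cons, List.isChain_append]
        refine ⟨?_, ?_, ?_⟩
        · rw [List.isChain_map]
          exact l2.imp (fun x y h => h.imp (fun h => mf h) (fun h => mf h))
        · rw [List.isChain_map]
          exact k2.imp (fun x y h => h.imp (fun h => mg h) (fun h => mg h))
        · intro x hx y hy
          rw [List.getLast?_map, List.getLast?_eq_some_getLast (by simp), ← hv] at hx
          simp at hx hy
          subst hx hy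
          exact hc v
      · intro x
        rw [← List.cons_append, ← List.map_cons, List.mem_append, List.mem_map, List.mem_map]
        constructor
        · rintro (⟨y, hy, rfl⟩ | ⟨y, hy, rfl⟩)
          · exact ⟨y, (l3 y).1 hy, Or.inl rfl⟩
          · exact ⟨y, (k3 y).1 hy, Or.inr rfl⟩
        · rintro ⟨y, hy, rfl | rfl⟩
          · exact Or.inl ⟨y, (l3 y).2 hy, rfl⟩
          · exact Or.inr ⟨y, (k3 y).2 hy, rfl⟩
    have hins : ∀ x y, x ⊆ s → y ⊆ s → insert a x = insert a y → x = y := by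
      intro x y hx hy h
      rw [← Finset.erase_insert (fun h => ha (hx h)), h, Finset.erase_insert (fun h => ha (hy h))]
    have hne : ∀ x y, x ⊆ s → y ⊆ s → x ≠ insert a y := by
      intro x y hx hy h
      exact ha (hx (h ▸ Finset.mem_insert_self a y))
    have hmon : Monotone (insert a : Finset α → Finset α) :=
      fun x y h => Finset.insert_subset_insert a h
    have hall : ∀ x, x ⊆ insert a s ↔ ∃ y, y ⊆ s ∧ (x = y ∨ x = insert a y) := by
      intro x
      constructor
      · intro hx
        refine ⟨x.erase a, by rwa [← Finset.subset_insert_iff], ?_⟩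
        by_cases h : a ∈ x
        · right; rw [Finset.insert_erase h]
        · left; rw [Finset.erase_eq_of_notMem h]
      · rintro ⟨y, hy, rfl | rfl⟩
        · exact hy.trans (Finset.subset_insert _ _)
        · exact Finset.insert_subset_insert a hy
    intro u hu
    obtain ⟨u0, hu0, rfl | rfl⟩ := (hall u).1 hu
    · obtain ⟨l, l1, l2, l3⟩ := main id (insert a) (fun x y _ _ h => h) hins hne monotone_id hmon
        (fun x => Or.inl (Finset.subset_insert _ _)) u hu0
      refine ⟨l, l1, l2, fun x => ?_⟩
      rw [hall]
      exact l3 x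
    · obtain ⟨l, l1, l2, l3⟩ := main (insert a) id hins (fun x y _ _ h => h)
        (fun x y hx hy h => hne y x hy hx h.symm) hmon monotone_id
        (fun x => Or.inr (Finset.subset_insert _ _)) u0 hu0
      refine ⟨l, l1, l2, fun x => ?_⟩
      rw [hall]
      refine (l3 x).trans ?_
      simp only [id, or_comm]

lemma split_chain {Y : Type*} [PartialOrder Y] {p : ℕ} (D : Finset Y)
    (hD : IsChain (· ≤ ·) (D : Set Y)) (hc : 4 * p ≤ D.card) :
    ∃ B Mid T : Finset Y, B ⊆ D ∧ Mid ⊆ D ∧ T ⊆ D ∧ p ≤ B.card ∧ 2 * p ≤ Mid.card ∧ p ≤ T.card ∧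
      (∀ b ∈ B, ∀ m ∈ Mid, b < m) ∧ (∀ m ∈ Mid, ∀ t ∈ T, m < t) := by
  classical
  obtain ⟨φ, hφ⟩ := chain_emb D hD _ rfl
  have hmem : ∀ i, φ i ∈ D := by
    intro i
    have : φ i ∈ (D : Set Y) := hφ ▸ ⟨i, rfl⟩
    exact this
  have seg : ∀ u v : ℕ, u + v ≤ D.card → ∃ E : Finset Y, E ⊆ D ∧ E.card = v ∧
      ∀ x ∈ E, ∃ i : Fin D.card, x = φ i ∧ u ≤ i ∧ (i : ℕ) < u + v := by
    intro u v h
    refine ⟨Finset.univ.image (fun c : Fin v => φ ⟨u + c, by omega⟩), ?_, ?_, ?_⟩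
    · intro x hx
      simp only [Finset.mem_image, Finset.mem_univ, true_and] at hx
      obtain ⟨c, rfl⟩ := hx
      exact hmem _
    · rw [Finset.card_image_of_injective]
      · simp
      · intro c c' h
        have := φ.injective h
        simp only [Fin.mk.injEq] at this
        exact Fin.ext (by omega)
    · intro x hx
      simp only [Finset.mem_image, Finset.mem_univ, true_and] at hx
      obtain ⟨c, rfl⟩ := hx
      exact ⟨_, rfl, by simp, by simp⟩
  obtain ⟨B, b1, b2, b3⟩ := seg 0 p (by omega)
  obtain ⟨M, m1, m2, m3⟩ := seg p (2 * p) (by omega)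
  obtain ⟨T, t1, t2, t3⟩ := seg (3 * p) p (by omega)
  refine ⟨B, M, T, b1, m1, t1, b2.ge, m2.ge, t2.ge, ?_, ?_⟩
  · intro b hb m hm
    obtain ⟨i, rfl, hi, hi'⟩ := b3 b hb
    obtain ⟨j, rfl, hj, hj'⟩ := m3 m hm
    rw [φ.lt_iff_lt, Fin.lt_def]
    omega
  · intro b hb m hm
    obtain ⟨i, rfl, hi, hi'⟩ := m3 b hb
    obtain ⟨j, rfl, hj, hj'⟩ := t3 m hm
    rw [φ.lt_iff_lt, Fin.lt_def]
    omega

lemma assemble {X Y : Type*} [PartialOrder X] [PartialOrder Y] [OrderBot Y] [Finite Y] {p : ℕ}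
    (hp : 0 < p) [Inhabited X]
    (hX : ∀ u : X, ∃ l : List X, (u :: l).Nodup ∧ (u :: l).IsChain (fun a b => a ≤ b ∨ b ≤ a) ∧
      ∀ x, x ∈ u :: l)
    (e : Y → Fin p → X) (hinj : ∀ y y' c c', e y c = e y' c' → y = y' ∧ c = c')
    (hmono : ∀ y, Monotone (e y))
    (Ds : Set (Finset Y)) (hch : ∀ D ∈ Ds, IsChain (· ≤ ·) (D : Set Y))
    (huniq : ∀ K ∈ Ds, ∀ K' ∈ Ds, ∀ x ∈ K, x ∈ K' → K = K') (hcov : ∀ x, ∃ K ∈ Ds, x ∈ K)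
    (hcard : ∀ D ∈ Ds, 4 * p + 1 ≤ D.card) : Nonempty (ChainTiling (X × Y) p) := by
  classical
  have := Fintype.ofFinite Y
  obtain ⟨D0, hD0, hbot⟩ := hcov ⊥
  -- each block, with its correction
  have step : ∀ D ∈ Ds, D ≠ D0 → ∃ F : Set X, (∃ ρ ∈ D, ∀ x ∈ F, ∃ c, x = e ρ c) ∧
      Tile p {z : X × Y | z.2 ∈ D ∨ (z.2 = ⊥ ∧ z.1 ∈ F)} := by
    intro D hD hne
    have hc := hcard D hD
    obtain ⟨ρ, hρ⟩ : D.Nonempty := Finset.card_pos.1 (by omega)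
    obtain ⟨B, M, T, k1, k2, k3, k4, k5, k6, k7, k8⟩ :=
      split_chain (p := p) D (hch D hD) (by omega)
    set u : X := e ρ ⟨p - 1, by omega⟩ with hu
    obtain ⟨l, l1, l2, l3⟩ := hX u
    obtain ⟨R, r1, r2, r3, r4⟩ := path_tile hp (fun _ => D) B M T (fun _ => hch D hD) k4 k5 k6
      (fun _ => k1) (fun _ => k2) (fun _ => k3) k7 k8 l u l1 l2
    have hbD : ⊥ ∉ D := fun h => hne (huniq D hD D0 hD0 ⊥ h hbot)
    let G : Finset X := (Finset.univ.filter fun c : Fin p => (c : ℕ) < 2 * p - R.card).image (e ρ)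
    have hG : ∀ x, x ∈ G ↔ ∃ c : Fin p, (c : ℕ) < 2 * p - R.card ∧ e ρ c = x := by
      intro x; simp [G]
    have hGc : G.card = 2 * p - R.card := by
      rw [Finset.card_image_of_injective _ (fun c c' h => (hinj _ _ _ _ h).2)]
      rw [Fin.card_filter_val_lt]
      omega
    refine ⟨G, ⟨ρ, hρ, ?_⟩, ?_⟩
    · intro x hx
      obtain ⟨c, _, h⟩ := (hG x).1 hx
      exact ⟨c, h.symm⟩
    let c : Finset (X × Y) := ({u} ×ˢ R) ∪ (G ×ˢ {⊥})
    have hcm : ∀ a b, (a, b) ∈ c ↔ (a = u ∧ b ∈ R) ∨ (a ∈ G ∧ b = ⊥) := by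
      intro a b; simp only [c, Finset.mem_union, Finset.mem_product, Finset.mem_singleton]
    have hcc : IsChain (· ≤ ·) (c : Set (X × Y)) := by
      rintro ⟨a, b⟩ hab ⟨a', b'⟩ hab' _
      rw [Finset.mem_coe, hcm] at hab hab'
      have hGu : ∀ x ∈ G, x ≤ u := by
        intro x hx
        obtain ⟨i, _, rfl⟩ := (hG x).1 hx
        apply hmono
        rw [Fin.le_def]
        have := i.2
        simp only
        omega
      rcases hab with ⟨rfl, hb⟩ | ⟨hb, rfl⟩ <;> rcases hab' with ⟨rfl, hb'⟩ | ⟨hb', rfl⟩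
      · simpa using (hch D hD).total (k2 (r1 hb)) (k2 (r1 hb'))
      · exact Or.inr ⟨hGu _ hb', bot_le⟩
      · exact Or.inl ⟨hGu _ hb, bot_le⟩
      · obtain ⟨i, _, rfl⟩ := (hG a).1 hb
        obtain ⟨j, _, rfl⟩ := (hG a').1 hb'
        rcases le_total i j with h | h
        · exact Or.inl ⟨hmono _ h, le_rfl⟩
        · exact Or.inr ⟨hmono _ h, le_rfl⟩
    have hcc2 : c.card = 2 * p := by
      rw [Finset.card_union_of_disjoint, Finset.card_product, Finset.card_product, hGc]
      · simp; omega
      · rw [Finset.disjoint_left]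
        rintro ⟨a, b⟩ h1 h2
        simp only [Finset.mem_product, Finset.mem_singleton] at h1 h2
        exact hbD (h2.2 ▸ k2 (r1 h1.2))
    have h5 := r4.union (Tile.ofChain 2 c hcc hcc2) ?_
    · convert h5 using 1
      ext ⟨a, b⟩
      simp only [Set.mem_ofPred_eq, Set.mem_union, Finset.mem_coe, hcm, l3, true_and]
      constructor
      · rintro (h | ⟨h1, h2⟩)
        · by_cases hh : a = u ∧ b ∈ R
          · exact Or.inr (Or.inl hh)
          · exact Or.inl ⟨h, hh⟩
        · exact Or.inr (Or.inr ⟨h2, h1⟩)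
      · rintro (⟨h, _⟩ | (⟨_, h⟩ | ⟨h1, h2⟩))
        · exact Or.inl h
        · exact Or.inl (k2 (r1 h))
        · exact Or.inr ⟨h2, h1⟩
    · rw [Set.disjoint_left]
      rintro ⟨a, b⟩ ⟨_, h1, h2⟩ h3
      rw [Finset.mem_coe, hcm] at h3
      rcases h3 with h3 | ⟨_, rfl⟩
      · exact h2 h3
      · exact hbD h1
  have step' : ∀ D, ∃ F : Set X, D ∈ Ds → D ≠ D0 → ((∃ ρ ∈ D, ∀ x ∈ F, ∃ c, x = e ρ c) ∧
      Tile p {z : X × Y | z.2 ∈ D ∨ (z.2 = ⊥ ∧ z.1 ∈ F)}) := by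
    intro D
    by_cases h : D ∈ Ds ∧ D ≠ D0
    · obtain ⟨F, hF⟩ := step D h.1 h.2
      exact ⟨F, fun _ _ => hF⟩
    · exact ⟨∅, fun h1 h2 => absurd ⟨h1, h2⟩ h⟩
  choose F hF using step'
  let I : Finset (Finset Y) := Finset.univ.filter fun D => D ∈ Ds ∧ D ≠ D0
  have hI : ∀ D, D ∈ I ↔ D ∈ Ds ∧ D ≠ D0 := by intro D; simp [I]
  have hbI : ∀ D ∈ I, ⊥ ∉ D := fun D hD h =>
    ((hI D).1 hD).2 (huniq D ((hI D).1 hD).1 D0 hD0 ⊥ h hbot)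
  have hU := Tile.biUnion (p := p) I (fun D => {z : X × Y | z.2 ∈ D ∨ (z.2 = ⊥ ∧ z.1 ∈ F D)})
    (fun D hD => (hF D ((hI D).1 hD).1 ((hI D).1 hD).2).2) (by
      intro D hD D' hD' hne
      rw [Set.disjoint_left]
      rintro ⟨a, b⟩ h h'
      simp only [Set.mem_ofPred_eq] at h h'
      have hD1 := (hI D).1 hD
      have hD1' := (hI D').1 hD'
      rcases h with h | ⟨rfl, h⟩ <;> rcases h' with h' | ⟨h'', h'⟩
      · exact hne (huniq D hD1.1 D' hD1'.1 b h h')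
      · exact hbI D hD (h'' ▸ h)
      · exact hbI D' hD' h'
      · obtain ⟨ρ, hρ, h1⟩ := (hF D hD1.1 hD1.2).1
        obtain ⟨ρ', hρ', h1'⟩ := (hF D' hD1'.1 hD1'.2).1
        obtain ⟨c, rfl⟩ := h1 a h
        obtain ⟨c', hc'⟩ := h1' _ h'
        have := (hinj _ _ _ _ hc').1
        subst this
        exact hne (huniq D hD1.1 D' hD1'.1 ρ hρ hρ'))
  let H : X → Finset Y := fun x => if ∃ D ∈ I, x ∈ F D then D0.erase ⊥ else D0
  have hH0 : ∀ x, D0.erase ⊥ ⊆ H x := by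
    intro x
    simp only [H]
    split_ifs
    · exact subset_rfl
    · exact Finset.erase_subset _ _
  have hH1 : ∀ x, H x ⊆ D0 := by
    intro x
    simp only [H]
    split_ifs
    · exact Finset.erase_subset _ _
    · exact subset_rfl
  have hHb : ∀ x, ⊥ ∈ H x ↔ ¬ ∃ D ∈ I, x ∈ F D := by
    intro x
    simp only [H]
    split_ifs with h
    · simp [h]
    · simp [h, hbot]
  have hc := hcard D0 hD0
  obtain ⟨B, M, T, k1, k2, k3, k4, k5, k6, k7, k8⟩ :=
    split_chain (p := p) (D0.erase ⊥) ((hch D0 hD0).mono (by simp))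
      (by rw [Finset.card_erase_of_mem hbot]; omega)
  obtain ⟨l, l1, l2, l3⟩ := hX default
  obtain ⟨R, r1, r2, r3, r4⟩ := path_tile hp H B M T (fun x => (hch D0 hD0).mono (hH1 x)) k4 k5 k6
      (fun x => k1.trans (hH0 x)) (fun x => k2.trans (hH0 x)) (fun x => k3.trans (hH0 x))
      k7 k8 l default l1 l2
  have hRD : R ⊆ D0.erase ⊥ := r1.trans k2
  refine Tile.chainTiling (({default} : Finset X) ×ˢ R) ?_ (by simpa using r2) (by simpa using r3) ?_
  · have := isChain_mk (default : X) (R : Set Y) ((hch D0 hD0).mono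
      (by exact_mod_cast hRD.trans (Finset.erase_subset _ _)))
    convert this using 1
    ext ⟨a, b⟩
    simp [eq_comm, and_comm]
  · have h5 := r4.union hU ?_
    · convert h5 using 1
      ext ⟨a, b⟩
      simp only [Set.mem_compl_iff, Finset.coe_product, Finset.coe_singleton, Set.mem_prod,
        Set.mem_singleton_iff, Finset.mem_coe, Set.mem_union, Set.mem_ofPred_eq, l3, true_and,
        Set.mem_iUnion, exists_prop]
      constructor
      · intro h
        by_cases hb : b ∈ H a
        · exact Or.inl ⟨hb, h⟩
        · right
          obtain ⟨D, hD, hbD⟩ := hcov b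
          by_cases hDD : D = D0
          · subst hDD
            have hb0 : b = ⊥ := by
              by_contra hne
              exact hb (hH0 a (Finset.mem_erase.2 ⟨hne, hbD⟩))
            subst hb0
            rw [hHb, not_not] at hb
            obtain ⟨D', hD', ha⟩ := hb
            exact ⟨D', hD', Or.inr ⟨rfl, ha⟩⟩
          · exact ⟨D, (hI D).2 ⟨hD, hDD⟩, Or.inl hbD⟩
      · rintro (⟨_, h⟩ | ⟨D, hD, h | ⟨rfl, h⟩⟩)
        · exact h
        · rintro ⟨_, hR⟩
          have hD1 := (hI D).1 hD
          exact hD1.2 (huniq D hD1.1 D0 hD0 b h (Finset.mem_of_mem_erase (hRD hR)))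
        · rintro ⟨_, hR⟩
          exact absurd rfl (Finset.mem_erase.1 (hRD hR)).1
    · rw [Set.disjoint_left]
      rintro ⟨a, b⟩ ⟨_, h1, _⟩ h3
      simp only [Set.mem_iUnion, exists_prop, Set.mem_ofPred_eq] at h3 h1
      obtain ⟨D, hD, h | ⟨rfl, h⟩⟩ := h3
      · have hD1 := (hI D).1 hD
        exact hD1.2 (huniq D hD1.1 D0 hD0 b h (hH1 a h1))
      · exact (hHb a).1 h1 ⟨D, hD, h⟩

lemma weighted_hall {V : Type*} [Fintype V] (s : Finset V) (w : V → V → ℚ)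
    (h0 : ∀ a ∈ s, ∀ b, 0 ≤ w a b) (hrow : ∀ a ∈ s, 1 ≤ ∑ b, w a b)
    (hcol : ∀ b, ∑ a ∈ s, w a b ≤ 1) :
    ∃ f : V → V, Set.InjOn f s ∧ ∀ a ∈ s, 0 < w a (f a) := by
  classical
  let t : s → Finset V := fun a => Finset.univ.filter (fun b => 0 < w a b)
  have key : ∀ S : Finset s, S.card ≤ (S.biUnion t).card := by
    intro S
    have h1 : (S.card : ℚ) ≤ ∑ a ∈ S, ∑ b, w a b := by
      calc (S.card : ℚ) = ∑ a ∈ S, 1 := by simp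
        _ ≤ _ := Finset.sum_le_sum (fun a _ => hrow a a.2)
    have h2 : ∑ a ∈ S, ∑ b, w a b ≤ ∑ a ∈ S, ∑ b ∈ S.biUnion t, w a b := by
      apply Finset.sum_le_sum
      intro a ha
      apply le_of_eq
      symm
      apply Finset.sum_subset (Finset.subset_univ _)
      intro b _ hb
      by_contra hne
      apply hb
      rw [Finset.mem_biUnion]
      exact ⟨a, ha, by simpa [t] using lt_of_le_of_ne (h0 a a.2 b) (Ne.symm hne)⟩
    have h3 : ∑ a ∈ S, ∑ b ∈ S.biUnion t, w a b ≤ ((S.biUnion t).card : ℚ) := by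
      rw [Finset.sum_comm]
      calc _ ≤ ∑ b ∈ S.biUnion t, (1 : ℚ) := by
            apply Finset.sum_le_sum
            intro b _
            refine le_trans ?_ (hcol b)
            have : ∑ a ∈ S, w a b = ∑ a ∈ S.map (Function.Embedding.subtype _), w a b := by
              simp
            rw [this]
            apply Finset.sum_le_sum_of_subset_of_nonneg
            · intro x hx
              simp only [Finset.mem_map, Function.Embedding.subtype_apply] at hx
              obtain ⟨y, _, rfl⟩ := hx
              exact y.2
            · intro i hi _
              exact h0 _ hi _
        _ = _ := by simp
    exact_mod_cast h1.trans (h2.trans h3)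
  obtain ⟨f, hf, hft⟩ := (Finset.all_card_le_biUnion_card_iff_exists_injective t).1 key
  refine ⟨fun a => if h : a ∈ s then f ⟨a, h⟩ else a, ?_, ?_⟩
  · intro a ha b hb hab
    have ha' : a ∈ s := ha
    have hb' : b ∈ s := hb
    simp only [ha', hb', dif_pos] at hab
    simpa using hf hab
  · intro a ha
    simp only [ha, dif_pos]
    simpa [t] using hft ⟨a, ha⟩

inductive AltReach {V : Type*} (u v : V → V) (R L : Set V) : V → Prop
  | base (B : V) (h : B ∈ L) (h' : B ∉ u '' R) : AltReach u v R L B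
  | step (B : V) (h : AltReach u v R L B) (h' : u (v B) ∈ L) : AltReach u v R L (u (v B))

lemma AltReach.mem {V : Type*} {u v : V → V} {R L : Set V} {B : V} (h : AltReach u v R L B) :
    B ∈ L := by
  cases h <;> assumption

lemma two_matchings {V : Type*} [PartialOrder V] (l : V → ℕ) (M b : ℕ) (u v : V → V)
    (hu : Set.InjOn u {A | l A < M}) (hv : Set.InjOn v {B | b ≤ l B ∧ l B ≤ M})
    (hu1 : ∀ A, l A < M → A < u A ∧ l (u A) = l A + 1)
    (hv1 : ∀ B, b ≤ l B → l B ≤ M → v B < B ∧ l (v B) < l B ∧ l B ≤ l (v B) + 2) :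
    ∃ r : V → V → Prop, (∀ A B, r A B → A < B ∧ l B ≤ l A + 2 ∧ l B ≤ M) ∧
      (∀ A B B', r A B → r A B' → B = B') ∧ (∀ A A' B, r A B → r A' B → A = A') ∧
      (∀ A, l A < M → ∃ B, r A B) ∧ (∀ B, b ≤ l B → l B ≤ M → ∃ A, r A B) := by
  let R : Set V := {A | l A < M}
  let L : Set V := {B | b ≤ l B ∧ l B ≤ M}
  let Z := AltReach u v R L
  have hZv : ∀ B, Z B → v B ∈ R := by
    intro B hB
    have h1 := hB.mem
    have h2 := hv1 B h1.1 h1.2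
    exact lt_of_lt_of_le h2.2.1 h1.2
  refine ⟨fun A B => (Z B ∧ A = v B) ∨ (A ∈ R ∧ (¬ ∃ B', Z B' ∧ A = v B') ∧ B = u A),
    ?_, ?_, ?_, ?_, ?_⟩
  · rintro A B (⟨hZ, rfl⟩ | ⟨hA, _, rfl⟩)
    · have h1 := hZ.mem
      have h2 := hv1 B h1.1 h1.2
      exact ⟨h2.1, h2.2.2, h1.2⟩
    · have h2 := hu1 A hA
      have hA' : l A < M := hA
      exact ⟨h2.1, by omega, by omega⟩
  · rintro A B B' (⟨hZ, rfl⟩ | ⟨hA, hn, rfl⟩) (⟨hZ', h'⟩ | ⟨hA', hn', rfl⟩)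
    · exact hv hZ.mem hZ'.mem h'
    · exact absurd ⟨B, hZ, rfl⟩ hn'
    · exact absurd ⟨B', hZ', h'⟩ hn
    · rfl
  · have key : ∀ B A', Z B → A' ∈ R → (¬ ∃ B', Z B' ∧ A' = v B') → B = u A' → False := by
      intro B A' hZ hA' hn hB
      cases hZ with
      | base _ h h' => exact h' ⟨A', hA', hB.symm⟩
      | step B' h h' => exact hn ⟨B', h, hu hA' (hZv B' h) hB.symm⟩
    rintro A A' B (⟨hZ, rfl⟩ | ⟨hA, hn, h⟩) (⟨hZ', h'⟩ | ⟨hA', hn', h'⟩)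
    · exact h'.symm
    · exact (key B A' hZ hA' hn' h').elim
    · exact (key B A hZ' hA hn h).elim
    · exact hu hA hA' (h.symm.trans h')
  · intro A hA
    by_cases h : ∃ B', Z B' ∧ A = v B'
    · obtain ⟨B, hB, h⟩ := h
      exact ⟨B, Or.inl ⟨hB, h⟩⟩
    · exact ⟨u A, Or.inr ⟨hA, h, rfl⟩⟩
  · intro B hb hM
    by_cases hZ : Z B
    · exact ⟨v B, Or.inl ⟨hZ, rfl⟩⟩
    · have hB : B ∈ u '' R := by
        by_contra h
        exact hZ (AltReach.base B ⟨hb, hM⟩ h)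
      obtain ⟨A, hA, rfl⟩ := hB
      refine ⟨A, Or.inr ⟨hA, ?_, rfl⟩⟩
      rintro ⟨B', hB', rfl⟩
      exact hZ (AltReach.step B' hB' ⟨hb, hM⟩)

lemma half_chains {V : Type*} [PartialOrder V] [Fintype V] (l : V → ℕ) (hl : StrictMono l)
    (M b q : ℕ) (hbq : b + 2 * q ≤ M + 2) (r : V → V → Prop)
    (hr : ∀ A B, r A B → A < B ∧ l B ≤ l A + 2 ∧ l B ≤ M)
    (hru : ∀ A B B', r A B → r A B' → B = B') (hlu : ∀ A A' B, r A B → r A' B → A = A')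
    (hup : ∀ A, l A < M → ∃ B, r A B) (hdown : ∀ B, b ≤ l B → l B ≤ M → ∃ A, r A B) :
    ∃ Ds : Set (Finset V), (∀ K ∈ Ds, IsChain (· ≤ ·) (K : Set V)) ∧
      (∀ K ∈ Ds, ∀ K' ∈ Ds, ∀ x ∈ K, x ∈ K' → K = K') ∧
      (∀ x, l x ≤ M → ∃ K ∈ Ds, x ∈ K) ∧ (∀ K ∈ Ds, ∀ x ∈ K, l x ≤ M) ∧
      (∀ K ∈ Ds, q + 1 ≤ K.card) := by
  classical
  have hle : ∀ A B, Relation.ReflTransGen r A B → A ≤ B := by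
    intro A B h
    induction h with
    | refl => exact le_rfl
    | tail _ h ih => exact ih.trans (hr _ _ h).1.le
  let K : V → Finset V := fun t => Finset.univ.filter (fun A => Relation.ReflTransGen r A t)
  have hK : ∀ t A, A ∈ K t ↔ Relation.ReflTransGen r A t := by
    intro t A; simp [K]
  refine ⟨{D | ∃ t, l t = M ∧ D = K t}, ?_, ?_, ?_, ?_, ?_⟩
  · rintro _ ⟨t, ht, rfl⟩ A hA A' hA' _
    rw [Finset.mem_coe, hK] at hA hA'
    have h1 := Relation.reflTransGen_swap.2 hA
    have h2 := Relation.reflTransGen_swap.2 hA'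
    have hsw : Relator.RightUnique (Function.swap r) := fun a b c h h' => hlu _ _ _ h h'
    rcases Relation.ReflTransGen.total_of_right_unique hsw h1 h2 with h | h
    · exact Or.inr (hle _ _ (Relation.reflTransGen_swap.1 h))
    · exact Or.inl (hle _ _ (Relation.reflTransGen_swap.1 h))
  · rintro _ ⟨t, ht, rfl⟩ _ ⟨t', ht', rfl⟩ A hA hA'
    rw [hK] at hA hA'
    have hru' : Relator.RightUnique r := fun a b c h h' => hru _ _ _ h h'
    have : ∀ x y, l x = M → l y = M → Relation.ReflTransGen r x y → x = y := by
      intro x y hx hy h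
      by_contra hne
      have := hl (lt_of_le_of_ne (hle _ _ h) hne)
      omega
    rcases Relation.ReflTransGen.total_of_right_unique hru' hA hA' with h | h
    · rw [this t t' ht ht' h]
    · rw [this t' t ht' ht h]
  · have : ∀ n x, l x ≤ M → M - l x ≤ n → ∃ t, l t = M ∧ Relation.ReflTransGen r x t := by
      intro n
      induction n with
      | zero => intro x hx h; exact ⟨x, by omega, .refl⟩
      | succ n ih =>
        intro x hx h
        by_cases hx' : l x = M
        · exact ⟨x, hx', .refl⟩
        · obtain ⟨B, hB⟩ := hup x (by omega)
          have h1 := hr _ _ hB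
          have h2 := hl h1.1
          obtain ⟨t, ht, h3⟩ := ih B h1.2.2 (by omega)
          exact ⟨t, ht, .head hB h3⟩
    intro x hx
    obtain ⟨t, ht, h⟩ := this _ x hx le_rfl
    exact ⟨K t, ⟨t, ht, rfl⟩, (hK _ _).2 h⟩
  · rintro _ ⟨t, ht, rfl⟩ A hA
    rw [← ht]
    exact hl.monotone (hle _ _ ((hK _ _).1 hA))
  · rintro _ ⟨t, ht, rfl⟩
    have : ∀ i ≤ q, ∃ G ⊆ K t, G.card = i + 1 ∧ ∃ x ∈ G, M ≤ l x + 2 * i ∧ ∀ y ∈ G, x ≤ y := by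
      intro i
      induction i with
      | zero =>
        intro _
        exact ⟨{t}, by simpa [hK] using Relation.ReflTransGen.refl, by simp, t, by simp,
          by omega, by simp⟩
      | succ i ih =>
        intro hi
        obtain ⟨G, hG, hc, x, hx, hlx, hmin⟩ := ih (by omega)
        have hxt := (hK _ _).1 (hG hx)
        have hxM : l x ≤ M := ht ▸ hl.monotone (hle _ _ hxt)
        obtain ⟨A, hA⟩ := hdown x (by omega) hxM
        have h1 := hr _ _ hA
        refine ⟨insert A G, ?_, ?_, A, Finset.mem_insert_self _ _, by omega, ?_⟩
        · intro y hy
          rcases Finset.mem_insert.1 hy with rfl | hy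
          · exact (hK _ _).2 (.head hA hxt)
          · exact hG hy
        · rw [Finset.card_insert_of_notMem, hc]
          intro hAG
          exact absurd (hmin A hAG) (not_le_of_gt h1.1)
        · intro y hy
          rcases Finset.mem_insert.1 hy with rfl | hy
          · exact le_rfl
          · exact h1.1.le.trans (hmin y hy)
    obtain ⟨G, hG, hc, _⟩ := this q le_rfl
    rw [← hc]
    exact Finset.card_le_card hG

lemma card_sup {α : Type*} [Fintype α] [DecidableEq α] (A : Finset α) (j : ℕ) :
    (Finset.univ.filter (fun B : Finset α => A ⊆ B ∧ B.card = A.card + j)).card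
      = (Fintype.card α - A.card).choose j := by
  rw [← Finset.card_compl, ← Finset.card_powersetCard]
  symm
  apply Finset.card_bij (fun C _ => A ∪ C)
  · intro C hC
    rw [Finset.mem_powersetCard] at hC
    have hd : Disjoint A C := by
      rw [← Finset.subset_compl_iff_disjoint_left]; exact hC.1
    simp [Finset.card_union_of_disjoint hd, hC.2]
  · intro C hC C' hC' h
    rw [Finset.mem_powersetCard] at hC hC'
    ext x
    have h1 := @hC.1 x
    have h2 := @hC'.1 x
    have h3 := Finset.ext_iff.1 h x
    simp only [Finset.mem_compl, Finset.mem_union] at h1 h2 h3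
    tauto
  · intro B hB
    simp only [Finset.mem_filter, Finset.mem_univ, true_and] at hB
    refine ⟨B \ A, ?_, Finset.union_sdiff_of_subset hB.1⟩
    rw [Finset.mem_powersetCard]
    refine ⟨?_, ?_⟩
    · intro x hx
      simp at hx ⊢
      exact hx.2
    · rw [Finset.card_sdiff_of_subset hB.1]; omega

lemma card_sub {α : Type*} [Fintype α] [DecidableEq α] (A : Finset α) (j : ℕ) (hj : j ≤ A.card) :
    (Finset.univ.filter (fun B : Finset α => B ⊆ A ∧ A.card = B.card + j)).card
      = A.card.choose j := by
  rw [← Nat.choose_symm hj, ← Finset.card_powersetCard]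
  congr 1
  ext B
  simp only [Finset.mem_filter, Finset.mem_univ, true_and, Finset.mem_powersetCard]
  constructor
  · rintro ⟨h, h'⟩; exact ⟨h, by omega⟩
  · rintro ⟨h, h'⟩; exact ⟨h, by omega⟩

lemma up_matching {α : Type*} [Fintype α] [DecidableEq α] (M : ℕ)
    (hk : Fintype.card α = 2 * M + 1) :
    ∃ u : Finset α → Finset α, Set.InjOn u {A | A.card < M} ∧
      ∀ A, A.card < M → A < u A ∧ (u A).card = A.card + 1 := by
  obtain ⟨f, hf, hf'⟩ := weighted_hall (Finset.univ.filter (fun A : Finset α => A.card < M))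
    (fun A B => if A ⊆ B ∧ B.card = A.card + 1 then (1 : ℚ) / ((2 * M + 1 - A.card : ℕ) : ℚ) else 0)
    (by intro a _ b; split_ifs <;> positivity)
    (by
      intro A hA
      simp only [Finset.mem_filter, Finset.mem_univ, true_and] at hA
      rw [← Finset.sum_filter, Finset.sum_const, card_sup, hk, Nat.choose_one_right, nsmul_eq_mul]
      have : ((2 * M + 1 - A.card : ℕ) : ℚ) ≠ 0 := by
        have : 0 < 2 * M + 1 - A.card := by omega
        positivity
      rw [mul_one_div_cancel this])
    (by
      intro B
      have h1 : ∀ A ∈ Finset.univ.filter (fun A : Finset α => A.card < M),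
          (if A ⊆ B ∧ B.card = A.card + 1 then (1 : ℚ) / ((2 * M + 1 - A.card : ℕ) : ℚ) else 0) ≤
          if A ⊆ B ∧ B.card = A.card + 1 then (if B.card ≤ M ∧ 1 ≤ B.card then 1 / ((B.card : ℕ) : ℚ) else 0) else 0 := by
        intro A hA
        simp only [Finset.mem_filter, Finset.mem_univ, true_and] at hA
        by_cases h : A ⊆ B ∧ B.card = A.card + 1
        · rw [if_pos h, if_pos h, if_pos ⟨by omega, by omega⟩]
          have h2 : 0 < B.card := by omega
          apply one_div_le_one_div_of_le
          · exact_mod_cast h2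
          · have : B.card ≤ 2 * M + 1 - A.card := by omega
            exact_mod_cast this
        · rw [if_neg h, if_neg h]
      refine (Finset.sum_le_sum h1).trans ?_
      by_cases h : B.card ≤ M ∧ 1 ≤ B.card
      · simp only [h, and_self, if_true]
        refine (Finset.sum_le_sum_of_subset_of_nonneg (Finset.filter_subset _ _) ?_).trans ?_
        · intros
          split_ifs <;> positivity
        · rw [← Finset.sum_filter, Finset.sum_const, card_sub B 1 h.2, Nat.choose_one_right,
            nsmul_eq_mul]
          have : (B.card : ℚ) ≠ 0 := by
            have := h.2
            positivity
          rw [mul_one_div_cancel this]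
      · simp only [h, if_false]
        simp)
  refine ⟨f, by simpa using hf, ?_⟩
  intro A hA
  have := hf' A (by simpa using hA)
  split_ifs at this with h
  · refine ⟨?_, h.2⟩
    apply lt_of_le_of_ne h.1
    intro he
    have := h.2
    rw [← he] at this
    omega
  · exact absurd this (lt_irrefl _)

lemma central_est (M t : ℕ) (ht : t ≤ M) :
    (2 * M + 1).choose M * M ≤ (2 * M + 1).choose (M - t) * M + (2 * M + 1).choose M * (t * (t + 1)) := by
  have hmid : ∀ i, (2 * M + 1).choose i ≤ (2 * M + 1).choose M := by
    intro i
    have := Nat.choose_le_middle i (2 * M + 1)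
    rwa [show (2 * M + 1) / 2 = M by omega] at this
  induction t with
  | zero => simp
  | succ t ih =>
    have h := ih (by omega)
    obtain ⟨s, hs⟩ : ∃ s, M = s + 1 + t := ⟨M - t - 1, by omega⟩
    have h1 := Nat.choose_succ_right_eq (2 * M + 1) s
    rw [show M - t = s + 1 by omega] at h
    rw [show M - (t + 1) = s by omega]
    rw [show 2 * M + 1 - s = M + t + 2 by omega] at h1
    have hx := hmid (s + 1)
    have hy := hmid s
    generalize (2 * M + 1).choose (s + 1) = x at *
    generalize (2 * M + 1).choose s = y at *
    generalize (2 * M + 1).choose M = N at *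
    have e1 : x * M = x * (s + 1) + x * t := by rw [hs]; ring
    have e2 : x * t ≤ N * t := Nat.mul_le_mul_right _ hx
    have e3 : y * (t + 2) ≤ N * (t + 2) := Nat.mul_le_mul_right _ hy
    have e4 : y * (M + t + 2) = y * M + y * (t + 2) := by ring
    have e5 : N * ((t + 1) * (t + 1 + 1)) = N * (t * (t + 1)) + N * t + N * (t + 2) := by ring
    omega

lemma central_half (M T : ℕ) (hT : 2 * (T * (T + 1)) ≤ M) (i : ℕ) (h1 : M ≤ i + T)
    (h2 : i ≤ M) : (2 * M + 1).choose M ≤ 2 * (2 * M + 1).choose i := by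
  rcases Nat.eq_zero_or_pos M with rfl | hM
  · have : i = 0 := by omega
    subst this; simp
  have h := central_est M (M - i) (by omega)
  rw [show M - (M - i) = i by omega] at h
  generalize hd : M - i = d at h
  have hd' : d ≤ T := by omega
  have h3 : d * (d + 1) ≤ T * (T + 1) := Nat.mul_le_mul hd' (by omega)
  generalize (2 * M + 1).choose M = N at *
  generalize (2 * M + 1).choose i = x at *
  have h4 : N * (2 * (d * (d + 1))) ≤ N * M := Nat.mul_le_mul_left _ (by omega)
  have h5 : N * M ≤ (2 * x) * M := by
    have e : N * (2 * (d * (d + 1))) = 2 * (N * (d * (d + 1))) := by ring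
    have e' : (2 * x) * M = 2 * (x * M) := by ring
    omega
  exact Nat.le_of_mul_le_mul_right h5 hM

lemma col_sum {α : Type*} [Fintype α] [DecidableEq α] (b M j : ℕ) (g : ℕ → ℚ) (B : Finset α) :
    ∑ A ∈ Finset.univ.filter (fun A : Finset α => b ≤ A.card ∧ A.card ≤ M),
      (if B ⊆ A ∧ A.card = B.card + j then g A.card else 0) =
    if b ≤ B.card + j ∧ B.card + j ≤ M then
      ((Fintype.card α - B.card).choose j : ℚ) * g (B.card + j) else 0 := by
  rw [Finset.sum_filter]
  have : ∀ A : Finset α, (if b ≤ A.card ∧ A.card ≤ M then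
      (if B ⊆ A ∧ A.card = B.card + j then g A.card else 0) else 0) =
      if B ⊆ A ∧ A.card = B.card + j then
        (if b ≤ B.card + j ∧ B.card + j ≤ M then g (B.card + j) else 0) else 0 := by
    intro A
    by_cases h : B ⊆ A ∧ A.card = B.card + j
    · simp only [h, and_self, if_true]
    · simp only [h, if_false, ite_self]
  rw [Finset.sum_congr rfl (fun A _ => this A), ← Finset.sum_filter, Finset.sum_const, card_sup,
    nsmul_eq_mul]
  split_ifs <;> simp

lemma ratio (k j e : ℕ) (h : j + e ≤ k) (x : ℚ) :
    ((k - j).choose e : ℚ) * (x / (k.choose (j + e)) / ((j + e).choose e)) = x / k.choose j := by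
  have h1 := Nat.choose_mul (n := k) (Nat.le_add_right j e)
  rw [show j + e - j = e by omega, Nat.choose_symm_add] at h1
  have p1 : (k.choose (j + e) : ℚ) ≠ 0 := by
    have := Nat.choose_pos h
    positivity
  have p2 : ((j + e).choose e : ℚ) ≠ 0 := by
    have := Nat.choose_pos (Nat.le_add_left e j)
    positivity
  have p3 : (k.choose j : ℚ) ≠ 0 := by
    have := Nat.choose_pos (show j ≤ k by omega)
    positivity
  have h2 : (k.choose (j + e) : ℚ) * (j + e).choose e = k.choose j * (k - j).choose e := by
    exact_mod_cast h1
  rw [div_div, h2]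
  have p4 : ((k - j).choose e : ℚ) ≠ 0 := by
    have := Nat.choose_pos (show e ≤ k - j by omega)
    positivity
  field_simp

lemma down_matching {α : Type*} [Fintype α] [DecidableEq α] (M b : ℕ) (hb : 2 ≤ b)
    (hk : Fintype.card α = 2 * M + 1)
    (hN : ∀ i, b ≤ i + 2 → i ≤ M → (2 * M + 1).choose M ≤ 2 * (2 * M + 1).choose i) :
    ∃ v : Finset α → Finset α, Set.InjOn v {B | b ≤ B.card ∧ B.card ≤ M} ∧
      ∀ B, b ≤ B.card → B.card ≤ M → v B < B ∧ (v B).card < B.card ∧ B.card ≤ (v B).card + 2 := by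
  let N : ℕ → ℚ := fun i => ((2 * M + 1).choose i : ℚ)
  have hNpos : ∀ i, i ≤ M → 0 < N i := by
    intro i hi
    have := Nat.choose_pos (show i ≤ 2 * M + 1 by omega)
    simp only [N]; positivity
  have hmid : ∀ i, N i ≤ N M := by
    intro i
    have := Nat.choose_le_middle i (2 * M + 1)
    rw [show (2 * M + 1) / 2 = M by omega] at this
    simp only [N]; exact_mod_cast this
  have hhalf : ∀ i, b ≤ i + 2 → i ≤ M → N M ≤ 2 * N i := by
    intro i h1 h2
    have := hN i h1 h2
    simp only [N]; exact_mod_cast this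
  let g1 : ℕ → ℚ := fun i => (N i - N M + N (i - 1)) / N i / (i.choose 1)
  let g2 : ℕ → ℚ := fun i => (N M - N (i - 1)) / N i / (i.choose 2)
  have hg1 : ∀ i, b ≤ i → i ≤ M → 0 ≤ g1 i := by
    intro i h1 h2
    have h3 := hhalf i (by omega) h2
    have h4 := hhalf (i - 1) (by omega) (by omega)
    have h5 := hNpos i h2
    have : 0 ≤ N i - N M + N (i - 1) := by linarith
    simp only [g1]; positivity
  have hg2 : ∀ i, i ≤ M → 0 ≤ g2 i := by
    intro i h2
    have h3 := hmid (i - 1)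
    have h5 := hNpos i h2
    have : 0 ≤ N M - N (i - 1) := by linarith
    simp only [g2]; positivity
  obtain ⟨f, hf, hf'⟩ := weighted_hall
    (Finset.univ.filter (fun A : Finset α => b ≤ A.card ∧ A.card ≤ M))
    (fun A B => (if B ⊆ A ∧ A.card = B.card + 1 then g1 A.card else 0) +
      (if B ⊆ A ∧ A.card = B.card + 2 then g2 A.card else 0))
    (by
      intro A hA B
      simp only [Finset.mem_filter, Finset.mem_univ, true_and] at hA
      have h1 := hg1 _ hA.1 hA.2
      have h2 := hg2 _ hA.2
      apply add_nonneg <;> split_ifs <;> first | assumption | exact le_rfl)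
    (by
      intro A hA
      simp only [Finset.mem_filter, Finset.mem_univ, true_and] at hA
      rw [Finset.sum_add_distrib, ← Finset.sum_filter, ← Finset.sum_filter, Finset.sum_const,
        Finset.sum_const, card_sub A 1 (by omega), card_sub A 2 (by omega), nsmul_eq_mul,
        nsmul_eq_mul]
      have p1 : ((A.card.choose 1 : ℕ) : ℚ) ≠ 0 := by
        have := Nat.choose_pos (show 1 ≤ A.card by omega)
        positivity
      have p2 : ((A.card.choose 2 : ℕ) : ℚ) ≠ 0 := by
        have := Nat.choose_pos (show 2 ≤ A.card by omega)
        positivity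
      have p3 := hNpos _ hA.2
      simp only [g1, g2]
      rw [mul_div_cancel₀ _ p1, mul_div_cancel₀ _ p2, ← add_div, le_div_iff₀ p3]
      linarith)
    (by
      intro B
      rw [Finset.sum_add_distrib, col_sum, col_sum, hk]
      have e1 : B.card + 1 ≤ M → ((2 * M + 1 - B.card).choose 1 : ℚ) * g1 (B.card + 1) =
          (N (B.card + 1) - N M + N B.card) / N B.card := by
        intro h
        exact ratio (2 * M + 1) B.card 1 (by omega) _
      have e2 : B.card + 2 ≤ M → ((2 * M + 1 - B.card).choose 2 : ℚ) * g2 (B.card + 2) =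
          (N M - N (B.card + 1)) / N B.card := by
        intro h
        exact ratio (2 * M + 1) B.card 2 (by omega) _
      by_cases h1 : b ≤ B.card + 1 ∧ B.card + 1 ≤ M
      · have p := hNpos B.card (by omega)
        rw [if_pos h1, e1 h1.2]
        by_cases h2 : b ≤ B.card + 2 ∧ B.card + 2 ≤ M
        · rw [if_pos h2, e2 h2.2, ← add_div, div_le_one p]
          linarith
        · rw [if_neg h2, add_zero, div_le_one p, show B.card + 1 = M by omega]
          linarith
      · rw [if_neg h1]
        by_cases h2 : b ≤ B.card + 2 ∧ B.card + 2 ≤ M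
        · have p := hNpos B.card (by omega)
          have q1 := hhalf B.card (by omega) (by omega)
          have q2 := hhalf (B.card + 1) (by omega) (by omega)
          rw [if_pos h2, e2 h2.2, zero_add, div_le_one p]
          linarith
        · rw [if_neg h2]
          norm_num)
  refine ⟨f, by simpa using hf, ?_⟩
  intro A hA hA'
  have := hf' A (by simpa using ⟨hA, hA'⟩)
  have key : f A ⊆ A ∧ (A.card = (f A).card + 1 ∨ A.card = (f A).card + 2) := by
    by_contra hne
    rw [if_neg (fun h => hne ⟨h.1, Or.inl h.2⟩), if_neg (fun h => hne ⟨h.1, Or.inr h.2⟩)] at this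
    norm_num at this
  refine ⟨?_, by omega, by omega⟩
  apply lt_of_le_of_ne key.1
  intro he
  rw [he] at key
  omega

lemma long_chains {α : Type*} [Fintype α] [DecidableEq α] (M q : ℕ) (hq : 0 < q)
    (hk : Fintype.card α = 2 * M + 1) (hM : 2 * (2 * q * (2 * q + 1)) ≤ M) :
    ∃ Ds : Set (Finset (Finset α)), (∀ K ∈ Ds, IsChain (· ≤ ·) (K : Set (Finset α))) ∧
      (∀ K ∈ Ds, ∀ K' ∈ Ds, ∀ x ∈ K, x ∈ K' → K = K') ∧
      (∀ x, ∃ K ∈ Ds, x ∈ K) ∧ (∀ K ∈ Ds, q + 1 ≤ K.card) := by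
  have hqM : 2 * q ≤ M := by nlinarith
  obtain ⟨u, hu, hu1⟩ := up_matching (α := α) M hk
  obtain ⟨v, hv, hv1⟩ := down_matching (α := α) M (M - 2 * q + 2) (by omega) hk
    (fun i h1 h2 => central_half M (2 * q) hM i (by omega) h2)
  obtain ⟨r, r1, r2, r3, r4, r5⟩ := two_matchings (fun A : Finset α => A.card) M _ u v hu hv hu1 hv1
  obtain ⟨Ds, d1, d2, d3, d4, d5⟩ := half_chains (fun A : Finset α => A.card)
    Finset.card_strictMono M _ q (by omega) r r1 r2 r3 r4 r5
  have hcM : ∀ A : Finset α, Aᶜ.card ≤ M ↔ ¬ A.card ≤ M := by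
    intro A
    have := Finset.card_compl A
    have := Finset.card_le_univ A
    omega
  have hmem : ∀ (K : Finset (Finset α)) x, x ∈ K.image compl ↔ xᶜ ∈ K := by
    intro K x
    rw [Finset.mem_image]
    constructor
    · rintro ⟨y, hy, rfl⟩; simpa using hy
    · intro h; exact ⟨_, h, by simp⟩
  refine ⟨Ds ∪ (fun K => K.image compl) '' Ds, ?_, ?_, ?_, ?_⟩
  · rintro K (hK | ⟨K, hK, rfl⟩)
    · exact d1 K hK
    · intro x hx y hy hne
      rw [Finset.mem_coe, hmem] at hx hy
      rcases d1 K hK hx hy (by simpa using hne) with h | h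
      · exact Or.inr (by simpa using h)
      · exact Or.inl (by simpa using h)
  · rintro K (hK | ⟨K, hK, rfl⟩) K' (hK' | ⟨K', hK', rfl⟩) x hx hx'
    · exact d2 K hK K' hK' x hx hx'
    · rw [hmem] at hx'
      exact absurd (d4 K hK x hx) ((hcM x).1 (d4 K' hK' _ hx'))
    · rw [hmem] at hx
      exact absurd (d4 K' hK' x hx') ((hcM x).1 (d4 K hK _ hx))
    · rw [hmem] at hx hx'
      rw [d2 K hK K' hK' _ hx hx']
  · intro x
    by_cases hx : x.card ≤ M
    · obtain ⟨K, hK, h⟩ := d3 x hx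
      exact ⟨K, Or.inl hK, h⟩
    · obtain ⟨K, hK, h⟩ := d3 xᶜ ((hcM x).2 hx)
      exact ⟨_, Or.inr ⟨K, hK, rfl⟩, (hmem _ _).2 h⟩
  · rintro K (hK | ⟨K, hK, rfl⟩)
    · exact d5 K hK
    · rw [Finset.card_image_of_injective _ compl_injective]
      exact d5 K hK

lemma ChainTiling.transport {X Y : Type*} [PartialOrder X] [PartialOrder Y] {p : ℕ}
    (φ : X ≃o Y) (c : ChainTiling X p) : Nonempty (ChainTiling Y p) := by
  have hm : ∀ (K : Finset X) y, y ∈ K.map φ.toEquiv.toEmbedding ↔ φ.symm y ∈ K := by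
    intro K y
    rw [Finset.mem_map]
    constructor
    · rintro ⟨x, hx, rfl⟩; simpa using hx
    · intro h; exact ⟨_, h, by simp⟩
  refine ⟨⟨(fun K => K.map φ.toEquiv.toEmbedding) '' c.blocks, c.S.map φ.toEquiv.toEmbedding,
    ⟨_, c.memS, rfl⟩, ?_, ?_, ?_, ?_, ?_, ?_⟩⟩
  · rintro _ ⟨K, hK, rfl⟩ x hx y hy hne
    rw [Finset.mem_coe, hm] at hx hy
    rcases c.chain K hK hx hy (by simpa using hne) with h | h
    · exact Or.inl (by simpa using h)
    · exact Or.inr (by simpa using h)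
  · rintro _ ⟨K, hK, rfl⟩ _ ⟨K', hK', rfl⟩ x hx hx'
    rw [hm] at hx hx'
    rw [c.uniq K hK K' hK' _ hx hx']
  · intro y
    obtain ⟨K, hK, h⟩ := c.cover (φ.symm y)
    exact ⟨_, ⟨K, hK, rfl⟩, (hm _ _).2 h⟩
  · rintro _ ⟨K, hK, rfl⟩ hne
    rw [Finset.card_map]
    exact c.card_eq K hK (fun h => hne (by rw [h]))
  · rw [Finset.card_map]; exact c.le_cardS
  · rw [Finset.card_map]; exact c.cardS_le

def finsetOrderIso {α β : Type*} (e : α ≃ β) : Finset α ≃o Finset β where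
  toEquiv := e.finsetCongr
  map_rel_iff' := by
    intro a b
    simp

lemma label (p k m : ℕ) (h : k + p ≤ m) : ∃ e : Finset (Fin k) → Fin p → Finset (Fin m),
    (∀ y y' c c', e y c = e y' c' → y = y' ∧ c = c') ∧ ∀ y, Monotone (e y) := by
  let e : Finset (Fin k) → Fin p → Finset (Fin m) := fun y c =>
    Finset.univ.filter (fun x : Fin m => (∃ z ∈ y, (z : ℕ) = x) ∨ (k ≤ (x : ℕ) ∧ (x : ℕ) < k + c))
  have he : ∀ y c x, x ∈ e y c ↔ (∃ z ∈ y, (z : ℕ) = x) ∨ (k ≤ (x : ℕ) ∧ (x : ℕ) < k + c) := by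
    intro y c x; simp [e]
  have hc : ∀ y y' c c', e y c ⊆ e y' c' → c ≤ c' := by
    intro y y' c c' hs
    by_contra hlt
    have hlt' : (c' : ℕ) < c := by
      simpa using hlt
    have hcp := c.2
    have h1 : (⟨k + c', by omega⟩ : Fin m) ∈ e y c := (he _ _ _).2 (Or.inr ⟨by simp, by simpa using hlt'⟩)
    rcases (he _ _ _).1 (hs h1) with ⟨z, _, hz⟩ | ⟨_, hz⟩
    · have := z.2
      simp only at hz
      omega
    · simp at hz
  have hy : ∀ y y' c c', e y c ⊆ e y' c' → y ⊆ y' := by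
    intro y y' c c' hs z hz
    have h1 : (⟨z, by omega⟩ : Fin m) ∈ e y c := (he _ _ _).2 (Or.inl ⟨z, hz, rfl⟩)
    rcases (he _ _ _).1 (hs h1) with ⟨z', hz', h2⟩ | ⟨h2, _⟩
    · have : z' = z := Fin.ext h2
      exact this ▸ hz'
    · have := z.2
      simp only at h2
      omega
  refine ⟨e, ?_, ?_⟩
  · intro y y' c c' h
    exact ⟨(hy _ _ _ _ h.subset).antisymm (hy _ _ _ _ h.symm.subset),
      (hc _ _ _ _ h.subset).antisymm (hc _ _ _ _ h.symm.subset)⟩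
  · intro y c c' h x hx
    rw [he] at hx ⊢
    have : (c : ℕ) ≤ c' := h
    rcases hx with hx | hx
    · exact Or.inl hx
    · exact Or.inr ⟨hx.1, by omega⟩

theorem factor (p : ℕ) (hp : 0 < p) (α : Type) [Fintype α] (h : 800 * p ^ 2 ≤ Fintype.card α) :
    Nonempty (ChainTiling (Finset α) p) := by
  have hpp : p ≤ p ^ 2 := by nlinarith
  obtain ⟨m, hm⟩ : ∃ m, Fintype.card α = m + (2 * (180 * p ^ 2) + 1) :=
    ⟨Fintype.card α - (2 * (180 * p ^ 2) + 1), by omega⟩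
  generalize hk : 2 * (180 * p ^ 2) + 1 = k at hm
  obtain ⟨e, he1, he2⟩ := label p k m (by omega)
  obtain ⟨Ds, d1, d2, d3, d4⟩ := long_chains (α := Fin k) (180 * p ^ 2) (4 * p) (by omega)
    (by rw [Fintype.card_fin]; omega) (by nlinarith)
  obtain ⟨c⟩ := assemble (X := Finset (Fin m)) (Y := Finset (Fin k)) hp
    (by
      intro u
      obtain ⟨l, l1, l2, l3⟩ := gray (Finset.univ : Finset (Fin m)) u (Finset.subset_univ _)
      exact ⟨l, l1, l2, fun x => (l3 x).2 (Finset.subset_univ _)⟩) e he1 he2 Ds d1 d2 d3 d4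
  have eq : (Fin m ⊕ Fin k) ≃ α := Fintype.equivOfCardEq (by simp [hm])
  exact c.transport (Finset.sumEquiv.symm.trans (finsetOrderIso eq))


/-- There is an absolute constant `C` such that: if `P` is the `d`-dimensional grid
`[a 1] × ... × [a d]` (modelled as `∀ i, Fin (a i)` with the componentwise order,
with `|P| = ∏ i, a i`) and `n ≥ C · d · |P|^4`, then all but at most `(24 |P|^2)^d`
elements of the Boolean lattice `2^[n]` can be partitioned into copies of `P`. -/
theorem boolean_lattice_almost_partition_into_grids :
    ∃ C : ℕ, ∀ (d : ℕ), 0 < d → ∀ (a : Fin d → ℕ), (∀ i, 0 < a i) →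
      ∀ n : ℕ, C * d * (∏ i, a i) ^ 4 ≤ n →
        ∃ S : Finset (Finset (Fin n)), S.card ≤ (24 * (∏ i, a i) ^ 2) ^ d ∧
          PartitionedIntoCopies (∀ i, Fin (a i)) ((↑S : Set (Finset (Fin n)))ᶜ) := by
  exact main_of_factor factor
end

section
/- There exists an absolute constant C such that for every positive integer h and every n ≥ C·h^2, the Boolean lattice 2^[n] can be partitioned into chains C_1,...,C_r such that h ≤ |C_1| < 2h and |C_2| = ... = |C_r| = h. -/
open Finset

theorem cyc_succ (J : Finset ℕ) (hJ : J.Nonempty) :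
    ∃ nx : ℕ → ℕ, (∀ l ∈ J, nx l ∈ J) ∧ Set.InjOn nx J ∧
      ∀ l ∈ J, (l < nx l ∧ ∀ z ∈ J, z ≤ l ∨ nx l ≤ z) ∨ (∀ z ∈ J, nx l ≤ z ∧ z ≤ l) := by
  classical
  let nx : ℕ → ℕ := fun l =>
    if h : (J.filter (l < ·)).Nonempty then (J.filter (l < ·)).min' h else J.min' hJ
  have key : ∀ l ∈ J, nx l ∈ J ∧
      ((l < nx l ∧ ∀ z ∈ J, z ≤ l ∨ nx l ≤ z) ∨ (∀ z ∈ J, nx l ≤ z ∧ z ≤ l)) := by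
    intro l hl
    by_cases h : (J.filter (l < ·)).Nonempty
    · have e : nx l = (J.filter (l < ·)).min' h := by simp only [nx]; rw [dif_pos h]
      have hm := Finset.min'_mem _ h
      rw [← e, Finset.mem_filter] at hm
      refine ⟨hm.1, Or.inl ⟨hm.2, fun z hz => ?_⟩⟩
      by_cases hzl : z ≤ l
      · exact Or.inl hzl
      · right
        rw [e]
        exact Finset.min'_le _ _ (Finset.mem_filter.2 ⟨hz, by omega⟩)
    · have e : nx l = J.min' hJ := by simp only [nx]; rw [dif_neg h]
      refine ⟨e ▸ Finset.min'_mem _ _, Or.inr fun z hz => ⟨e ▸ Finset.min'_le _ _ hz, ?_⟩⟩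
      by_contra hc
      exact h ⟨z, Finset.mem_filter.2 ⟨hz, by omega⟩⟩
  refine ⟨nx, fun l hl => (key l hl).1, ?_, fun l hl => (key l hl).2⟩
  intro a ha b hb hab
  have ha' : a ∈ J := ha
  have hb' : b ∈ J := hb
  rcases (key a ha').2 with ⟨h1, h2⟩ | h1 <;> rcases (key b hb').2 with ⟨h3, h4⟩ | h3
  · have := h2 b hb'; have := h4 a ha'; omega
  · have := (h3 a ha').1; omega
  · have := (h1 b hb').1; omega
  · have := (h1 b hb').2; have := (h3 a ha').2; omega

/-- the prefix of size `l` of a numbering -/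
def prefixSet {n : ℕ} (f : Numbering (Fin n)) (l : ℕ) : Finset (Fin n) :=
  univ.filter fun x => (f x : ℕ) < l

theorem card_prefixSet {n : ℕ} (f : Numbering (Fin n)) (l : ℕ) (hl : l ≤ n) :
    (prefixSet f l).card = l := by
  have : (prefixSet f l).map f.toEmbedding = univ.filter fun i : Fin (Fintype.card (Fin n)) => (i : ℕ) < l := by
    ext i
    simp [prefixSet]
  rw [← Finset.card_map f.toEmbedding, this, Fin.card_filter_val_lt]
  simp [hl]

theorem isPrefix_prefixSet {n : ℕ} (f : Numbering (Fin n)) (l : ℕ) (hl : l ≤ n) :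
    f.IsPrefix (prefixSet f l) := by
  intro x
  rw [card_prefixSet f l hl]
  simp [prefixSet]

theorem level_perm (n N : ℕ) (J : Fin N → Finset ℕ)
    (hJ : ∀ l ≤ n, (univ.filter fun t => l ∈ J t).card = n.choose l)
    (hJn : ∀ t, ∀ l ∈ J t, l ≤ n)
    (nx : Fin N → ℕ → ℕ) (hnx : ∀ t, ∀ l ∈ J t, nx t l ∈ J t)
    (hinj : ∀ t, Set.InjOn (nx t) (J t)) :
    ∃ σ : Finset (Fin n) → Finset (Fin n), Function.Injective σ ∧
      ∀ x, ∃ (f : Numbering (Fin n)) (t : Fin N), f.IsPrefix x ∧ f.IsPrefix (σ x) ∧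
        x.card ∈ J t ∧ (σ x).card = nx t x.card := by
  classical
  rw [← Fintype.all_card_le_filter_rel_iff_exists_injective
    (fun x y : Finset (Fin n) => ∃ (f : Numbering (Fin n)) (t : Fin N), f.IsPrefix x ∧
      f.IsPrefix y ∧ x.card ∈ J t ∧ y.card = nx t x.card)]
  intro A
  set B := univ.filter fun b : Finset (Fin n) => ∃ a ∈ A, ∃ (f : Numbering (Fin n)) (t : Fin N),
    f.IsPrefix a ∧ f.IsPrefix b ∧ a.card ∈ J t ∧ b.card = nx t a.card with hB
  let F : Finset (Fin n) → Finset (Numbering (Fin n) × Fin N) := fun x =>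
    Numbering.prefixed x ×ˢ (univ.filter fun t => x.card ∈ J t)
  have hF : ∀ x, (F x).card = n.factorial := by
    intro x
    have hx : x.card ≤ n := by simpa using x.card_le_univ
    simp only [F, card_product, Numbering.card_prefixed, hJ _ hx, Fintype.card_fin]
    rw [← Nat.choose_mul_factorial_mul_factorial hx]
    ring
  have hs : ∀ S : Finset (Finset (Fin n)), (S.sigma F).card = S.card * n.factorial := by
    intro S
    rw [Finset.card_sigma]
    simp [hF]
  have hle : (A.sigma F).card ≤ (B.sigma F).card := by
    apply Finset.card_le_card_of_injOn
      (fun p => ⟨prefixSet p.2.1 (nx p.2.2 p.1.card), p.2⟩)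
    · rintro ⟨x, f, t⟩ h
      simp only [Finset.mem_coe, Finset.mem_sigma, F, Finset.mem_product, Numbering.mem_prefixed,
        Finset.mem_filter, Finset.mem_univ, true_and] at h ⊢
      obtain ⟨hxA, hfx, hxt⟩ := h
      have hln := hJn t _ (hnx t _ hxt)
      refine ⟨?_, isPrefix_prefixSet _ _ hln, ?_⟩
      · rw [hB, Finset.mem_filter]
        exact ⟨mem_univ _, x, hxA, f, t, hfx, isPrefix_prefixSet _ _ hln, hxt,
          card_prefixSet _ _ hln⟩
      · rw [card_prefixSet _ _ hln]; exact hnx t _ hxt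
    · rintro ⟨x, f, t⟩ h ⟨x', f', t'⟩ h' heq
      simp only [Finset.mem_coe, Finset.mem_sigma, F, Finset.mem_product, Numbering.mem_prefixed,
        Finset.mem_filter, Finset.mem_univ, true_and] at h h'
      simp only [Sigma.mk.injEq, heq_eq_eq, Prod.mk.injEq] at heq
      obtain ⟨h1, rfl, rfl⟩ := heq
      have hc := congrArg Finset.card h1
      rw [card_prefixSet _ _ (hJn t _ (hnx t _ h.2.2)),
        card_prefixSet _ _ (hJn t _ (hnx t _ h'.2.2))] at hc
      have hc' := hinj t h.2.2 h'.2.2 hc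
      have : x = x' := by
        ext a
        rw [h.2.1 a, h'.2.1 a, hc']
      subst this
      rfl
  rw [hs, hs] at hle
  exact Nat.le_of_mul_le_mul_right hle (Nat.factorial_pos n)

open Classical in
/-- follow `τ` downwards as long as it decreases -/
noncomputable def rootFn {V : Type*} [PartialOrder V] [WellFoundedLT V] (τ : V → V) : V → V :=
  (wellFounded_lt (α := V)).fix fun x ih => if h : τ x < x then ih (τ x) h else x

theorem rootFn_of_lt {V : Type*} [PartialOrder V] [WellFoundedLT V] (τ : V → V) (x : V)
    (h : τ x < x) : rootFn τ x = rootFn τ (τ x) := by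
  rw [rootFn, WellFounded.fix_eq, dif_pos h]

theorem rootFn_of_not_lt {V : Type*} [PartialOrder V] [WellFoundedLT V] (τ : V → V) (x : V)
    (h : ¬ τ x < x) : rootFn τ x = x := by
  rw [rootFn, WellFounded.fix_eq, dif_neg h]

theorem chains_of_perm {V : Type*} [PartialOrder V] [Fintype V] [DecidableEq V]
    (σ : V → V) (hσ : Function.Injective σ) (g : V → ℕ) (d : ℕ) (hd : 0 < d)
    (H : ∀ x, (x < σ x ∧ g (σ x) ≤ g x + 2) ∨ (2 * d - 1 ≤ g x ∧ g (σ x) ≤ 1 ∧ σ x ≤ x)) :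
    ∃ c : V → V, (∀ x, c (c x) = c x) ∧ (∀ x, c x ≤ x) ∧
      (∀ x y, c x = c y → x ≤ y ∨ y ≤ x) ∧
      ∀ x, d ≤ (univ.filter fun y => c y = c x).card := by
  classical
  let e : V ≃ V := Equiv.ofBijective σ (Finite.injective_iff_bijective.1 hσ)
  let τ : V → V := e.symm
  have hτσ : ∀ x, τ (σ x) = x := fun x => e.symm_apply_apply x
  have hστ : ∀ x, σ (τ x) = x := fun x => e.apply_symm_apply x
  have hroot : ∀ x, ¬ τ (rootFn τ x) < rootFn τ x := by
    intro x
    induction x using WellFoundedLT.induction with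
    | ind x ih =>
      by_cases h : τ x < x
      · rw [rootFn_of_lt τ x h]; exact ih _ h
      · rw [rootFn_of_not_lt τ x h]; exact h
  have hle : ∀ x, rootFn τ x ≤ x := by
    intro x
    induction x using WellFoundedLT.induction with
    | ind x ih =>
      by_cases h : τ x < x
      · rw [rootFn_of_lt τ x h]; exact (ih _ h).trans h.le
      · rw [rootFn_of_not_lt τ x h]
  have hrep : ∀ x, ∃ i, x = σ^[i] (rootFn τ x) ∧
      ∀ j < i, σ^[j] (rootFn τ x) < σ^[j+1] (rootFn τ x) := by
    intro x
    induction x using WellFoundedLT.induction with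
    | ind x ih =>
      by_cases h : τ x < x
      · obtain ⟨i, h1, h2⟩ := ih _ h
        rw [rootFn_of_lt τ x h]
        refine ⟨i+1, ?_, ?_⟩
        · rw [Function.iterate_succ_apply', ← h1, hστ]
        · intro j hj
          rcases Nat.lt_succ_iff_lt_or_eq.1 hj with hj | rfl
          · exact h2 j hj
          · rw [Function.iterate_succ_apply', ← h1, hστ]; exact h
      · rw [rootFn_of_not_lt τ x h]
        exact ⟨0, rfl, by simp⟩
  have hmono : ∀ (r : V) (i : ℕ), (∀ j < i, σ^[j] r < σ^[j+1] r) → ∀ a ≤ i, ∀ b ≤ a,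
      σ^[b] r ≤ σ^[a] r := by
    intro r i hi a
    induction a with
    | zero => intro _ b hb; rw [Nat.le_zero.1 hb]
    | succ a ih =>
      intro ha b hb
      rcases Nat.le_succ_iff.1 hb with hb | rfl
      · exact (ih (by omega) b hb).trans (hi a (by omega)).le
      · exact le_rfl
  refine ⟨rootFn τ, fun x => rootFn_of_not_lt _ _ (hroot x), hle, ?_, ?_⟩
  · intro x y hxy
    obtain ⟨i, hi, hi'⟩ := hrep x
    obtain ⟨j, hj, hj'⟩ := hrep y
    rw [← hxy] at hj hj'
    rw [hi, hj]
    rcases le_total i j with h | h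
    · exact Or.inl (hmono _ j hj' j le_rfl i h)
    · exact Or.inr (hmono _ i hi' i le_rfl j h)
  · intro x
    set r := rootFn τ x with hr
    have hrr : rootFn τ r = r := rootFn_of_not_lt _ _ (hroot x)
    have hg0 : g r ≤ 1 := by
      have h1 := hroot x
      rw [← hr] at h1
      rcases H (τ r) with h | h
      · rw [hστ] at h; exact absurd h.1 h1
      · rw [hστ] at h; exact h.2.1
    have hstep : ∀ j < d, (∀ i < j, σ^[i] r < σ^[i+1] r) ∧ g (σ^[j] r) ≤ 1 + 2 * j ∧
        rootFn τ (σ^[j] r) = r := by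
      intro j
      induction j with
      | zero => intro _; exact ⟨by simp, by simpa using hg0, by simpa using hrr⟩
      | succ j ih =>
        intro hj
        obtain ⟨h1, h2, h3⟩ := ih (by omega)
        have hH := H (σ^[j] r)
        rw [show σ (σ^[j] r) = σ^[j+1] r from (Function.iterate_succ_apply' σ j r).symm] at hH
        rcases hH with h | h
        · refine ⟨?_, by omega, ?_⟩
          · intro i hi
            rcases Nat.lt_succ_iff_lt_or_eq.1 hi with hi | rfl
            · exact h1 i hi
            · exact h.1
          · have e1 : τ (σ^[j+1] r) = σ^[j] r := by
              rw [Function.iterate_succ_apply', hτσ]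
            rw [rootFn_of_lt, e1, h3]
            rw [e1]; exact h.1
        · omega
    have : (range d).card ≤ (univ.filter fun y => rootFn τ y = r).card := by
      apply Finset.card_le_card_of_injOn (fun j => σ^[j] r)
      · intro j hj
        simpa using (hstep j (by simpa using hj)).2.2
      · have aux : ∀ a b, a < b → b < d → σ^[a] r < σ^[b] r := by
          intro a b hab hb
          have h := (hstep b hb).1
          exact (h a hab).trans_le (hmono r b h b le_rfl (a+1) hab)
        intro a ha b hb hab
        simp only [coe_range, Set.mem_Iio] at ha hb
        rcases lt_trichotomy a b with h | h | h
        · exact absurd hab (aux a b h hb).ne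
        · exact h
        · exact absurd hab (aux b a h ha).ne'
    simpa using this

theorem choose_near_middle (n j : ℕ) : n.choose (n/2) * n ≤ n.choose (n/2 + j) * n + n.choose (n/2) * (2 * j^2) := by
  induction j with
  | zero => simp
  | succ j ih =>
    have h1 := Nat.choose_succ_right_eq n (n/2+j)
    have hm : n.choose (n/2+j) ≤ n.choose (n/2) := Nat.choose_le_middle _ _
    have e : n/2 + (j+1) = n/2+j+1 := rfl
    rw [e]
    set a := n.choose (n/2+j)
    set b := n.choose (n/2+j+1)
    set N := n.choose (n/2)
    have hn : n ≤ 2 * (n/2) + 1 := by omega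
    have hn' : 2 * (n/2) ≤ n := by omega
    by_cases hc : n ≤ 2 * (j+1)^2
    · nlinarith [Nat.mul_le_mul_left N hc]
    · have hjn : n/2 + j ≤ n := by nlinarith
      -- b*(M+j+1) = a*(n-M-j)
      have h2 : a * n ≤ b * n + a * (2 * (2*j+1)) := by
        set M := n/2
        obtain ⟨q, hq⟩ := Nat.exists_eq_add_of_le hjn
        have hq' : n - (M+j) = q := by omega
        rw [hq'] at h1
        have hba : b ≤ a := by
          by_contra hh
          push Not at hh
          have : q ≤ M + j + 1 := by omega
          nlinarith
        have h3 : a * (M+j+1) ≤ b*(M+j+1) + a * (2*j+1) := by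
          rw [h1]; rw [← mul_add]
          apply Nat.mul_le_mul_left; omega
        have h4 : (a - b) * (M + j + 1) ≤ a * (2*j+1) := by
          rw [Nat.sub_mul]; omega
        have h5 : (a - b) * n ≤ (a-b) * (2*(M+j+1)) := Nat.mul_le_mul_left _ (by omega)
        have h6 : a * n = b * n + (a-b)*n := by rw [← add_mul]; congr 1; omega
        nlinarith
      nlinarith [Nat.mul_le_mul_right (2 * (2*j+1)) hm]

theorem long_chains_s14 (d n : ℕ) (hd : 0 < d) (hn : 36 * d^2 ≤ n) :
    ∃ c : Finset (Fin n) → Finset (Fin n), (∀ x, c (c x) = c x) ∧ (∀ x, c x ≤ x) ∧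
      (∀ x y, c x = c y → x ≤ y ∨ y ≤ x) ∧
      ∀ x, d ≤ (univ.filter fun y => c y = c x).card := by
  classical
  set s := n/2 with hs
  set N := n.choose s with hN
  let J : Fin N → Finset ℕ := fun t => (range (n+1)).filter fun l =>
    (l % 2 = 0 ∧ (t:ℕ) < n.choose l) ∨ (l % 2 = 1 ∧ N ≤ t + n.choose l)
  have hJn : ∀ t, ∀ l ∈ J t, l ≤ n := by
    intro t l hl
    simp only [J, mem_filter, mem_range] at hl
    omega
  have hJ : ∀ l ≤ n, (univ.filter fun t => l ∈ J t).card = n.choose l := by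
    intro l hl
    have hle : n.choose l ≤ N := Nat.choose_le_middle _ _
    rcases Nat.mod_two_eq_zero_or_one l with h | h
    · have : (univ.filter fun t => l ∈ J t) = univ.filter fun t : Fin N => (t:ℕ) < n.choose l := by
        ext t
        simp [J, h]; omega
      rw [this, Fin.card_filter_val_lt]; omega
    · have : (univ.filter fun t => l ∈ J t) = univ.filter fun t : Fin N => ¬ (t:ℕ) < N - n.choose l := by
        ext t
        simp [J, h]; omega
      rw [this, Finset.filter_not, Finset.card_sdiff_of_subset (Finset.filter_subset _ _), Fin.card_filter_val_lt]
      simp; omega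
  have hbig : ∀ j ≤ 2 * d, N ≤ 2 * n.choose (s + j) := by
    intro j hj
    have h := choose_near_middle n j
    rw [← hs, ← hN] at h
    have h2 : 2 * (2 * j^2) ≤ n := by nlinarith
    have h3 : 0 < n := by nlinarith
    have h4 : N * (2 * (2 * j^2)) ≤ N * n := Nat.mul_le_mul_left _ h2
    have : N * n ≤ (2 * n.choose (s+j)) * n := by nlinarith
    exact Nat.le_of_mul_le_mul_right this h3
  have hsn : s + 2 * d ≤ n := by
    have : 4 * d ≤ n := by nlinarith
    omega
  have hhit : ∀ t, ∀ l, s ≤ l → l + 1 ≤ s + 2 * d → l ∈ J t ∨ l + 1 ∈ J t := by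
    intro t l h1 h2
    have b1 := hbig (l - s) (by omega)
    have b2 := hbig (l + 1 - s) (by omega)
    rw [show s + (l - s) = l by omega] at b1
    rw [show s + (l + 1 - s) = l + 1 by omega] at b2
    simp only [J, mem_filter, mem_range]
    omega
  have hne : ∀ t, (J t).Nonempty := by
    intro t
    rcases hhit t s le_rfl (by omega) with h | h
    · exact ⟨_, h⟩
    · exact ⟨_, h⟩
  choose nx hnx hinj hprop using fun t => cyc_succ (J t) (hne t)
  obtain ⟨σ, hσ, hrel⟩ := level_perm n N J hJ hJn nx hnx hinj
  refine chains_of_perm σ hσ (fun x => min (x.card - s) (2 * d)) d hd ?_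
  intro x
  obtain ⟨f, t, hx, hy, hxt, hcard⟩ := hrel x
  rcases hprop t _ hxt with ⟨h1, h2⟩ | h1
  · left
    rw [← hcard] at h1 h2
    constructor
    · have hsub := hx.subset_of_card_le_card hy h1.le
      refine lt_of_le_of_ne hsub ?_
      intro h; rw [← h] at h1; exact lt_irrefl _ h1
    · have p1 := hhit t s le_rfl (by omega)
      have p2 := hhit t (x.card + 1)
      have q1 := h2 s
      have q2 := h2 (s+1)
      have q3 := h2 (x.card + 1)
      have q4 := h2 (x.card + 1 + 1)
      by_cases hh : s ≤ x.card + 1 ∧ x.card + 1 + 1 ≤ s + 2 * d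
      · rcases p2 hh.1 hh.2 with h | h
        · have := q3 h; omega
        · have := q4 h; omega
      · rcases p1 with h | h
        · have := q1 h; omega
        · have := q2 h; omega
  · right
    rw [← hcard] at h1
    refine ⟨?_, ?_, hy.subset_of_card_le_card hx (h1 _ hxt).1⟩
    · have p := hhit t (s + 2 * d - 1) (by omega) (by omega)
      rcases p with h | h
      · have := (h1 _ h).2; omega
      · have := (h1 _ h).2; omega
    · rcases hhit t s le_rfl (by omega) with h | h
      · have := (h1 _ h).1; omega
      · have := (h1 _ h).1; omega

/-- a finset that can be partitioned into chains of size `h` -/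
inductive Good {P : Type*} [PartialOrder P] [DecidableEq P] (h : ℕ) : Finset P → Prop
  | empty : Good h ∅
  | add (A S : Finset P) : IsChain (· ≤ ·) (A : Set P) → A.card = h → Disjoint A S →
      Good h S → Good h (A ∪ S)

theorem Good.union {P : Type*} [PartialOrder P] [DecidableEq P] {h : ℕ} {S T : Finset P}
    (hS : Good h S) (hT : Good h T) (hd : Disjoint S T) : Good h (S ∪ T) := by
  induction hS with
  | empty => simpa using hT
  | add A S hA hc hAS _ ih =>
    rw [Finset.disjoint_union_left] at hd
    rw [Finset.union_assoc]
    exact Good.add _ _ hA hc (Finset.disjoint_union_right.2 ⟨hAS, hd.1⟩) (ih hd.2)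

theorem Good.of_chain {P : Type*} [PartialOrder P] [DecidableEq P] {h : ℕ} (q : ℕ) :
    ∀ A : Finset P, IsChain (· ≤ ·) (A : Set P) → A.card = q * h → Good h A := by
  induction q with
  | zero =>
    intro A _ hc
    have : A = ∅ := by simpa using hc
    rw [this]; exact Good.empty
  | succ q ih =>
    intro A hA hc
    obtain ⟨B, hB, hBc⟩ := Finset.exists_subset_card_eq (s := A) (n := h) (by rw [hc]; nlinarith)
    have e : A = B ∪ (A \ B) := by rw [Finset.union_sdiff_of_subset hB]
    rw [e]
    refine Good.add _ _ (hA.mono (by exact_mod_cast hB)) hBc Finset.disjoint_sdiff (ih _ (hA.mono ?_) ?_)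
    · exact_mod_cast Finset.sdiff_subset
    · rw [Finset.card_sdiff_of_subset hB, hc, hBc, Nat.succ_mul]; omega

theorem link {P ι : Type*} [PartialOrder P] [DecidableEq P] [DecidableEq ι] (h : ℕ) (hh : 0 < h)
    (root : ι) (p : ι → ι) (rk : ι → ℕ) (Q R : ι → Finset P) (S : Finset ι) :
    root ∈ S → (∀ v ∈ S, v ≠ root → p v ∈ S ∧ rk (p v) < rk v) →
    (∀ v ∈ S, (Q v).card = h) →
    (∀ v ∈ S, v ≠ root → (R v).card = h ∧ IsChain (· ≤ ·) ((Q v ∪ R v : Finset P) : Set P)) →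
    (∀ v ∈ S, ∀ w ∈ S, v ≠ root → w ≠ root → v ≠ w → Disjoint (R v) (R w)) →
    (∀ v ∈ S, ∀ w ∈ S, v ≠ root → Disjoint (R v) (Q w)) →
    ∀ A : ι → Finset P, (∀ v ∈ S, IsChain (· ≤ ·) (A v : Set P)) →
    (∀ v ∈ S, ∀ w ∈ S, v ≠ w → Disjoint (A v) (A w)) →
    (∀ v ∈ S, Q v ⊆ A v) → (∀ v ∈ S, v ≠ root → R v ⊆ A (p v)) →
    ∃ C0 : Finset P, IsChain (· ≤ ·) (C0 : Set P) ∧ h ≤ C0.card ∧ C0.card < 2 * h ∧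
      C0 ⊆ S.biUnion A ∧ Good h (S.biUnion A \ C0) := by
  induction S using Finset.strongInduction with
  | H S ih =>
  intro hroot hp hQ hR hRR hRQ A hA hAA hQA hRA
  by_cases hS : ∃ v ∈ S, v ≠ root
  · obtain ⟨v, hv, hvmax⟩ := Finset.exists_max_image (S.filter (· ≠ root)) rk
      (by obtain ⟨v, h1, h2⟩ := hS; exact ⟨v, Finset.mem_filter.2 ⟨h1, h2⟩⟩)
    rw [Finset.mem_filter] at hv
    obtain ⟨hvS, hvr⟩ := hv
    have hnochild : ∀ w ∈ S, w ≠ root → p w ≠ v := by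
      intro w hw hwr he
      have h1 := (hp w hw hwr).2
      have h2 := hvmax w (Finset.mem_filter.2 ⟨hw, hwr⟩)
      rw [he] at h1; omega
    have hAcard : h ≤ (A v).card := by
      rw [← hQ v hvS]; exact Finset.card_le_card (hQA v hvS)
    obtain ⟨t, q, ht, hth, hAq⟩ : ∃ t q, 0 < t ∧ t ≤ h ∧ (A v).card = t + q * h := by
      refine ⟨((A v).card - 1) % h + 1, ((A v).card - 1) / h, by omega, Nat.mod_lt _ hh, ?_⟩
      have := Nat.mod_add_div ((A v).card - 1) h
      rw [mul_comm h] at this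
      omega
    obtain ⟨Q', hQ', hQc⟩ := Finset.exists_subset_card_eq (s := Q v) (n := t) (by rw [hQ v hvS]; exact hth)
    obtain ⟨R', hR', hRc⟩ := Finset.exists_subset_card_eq (s := R v) (n := h - t)
      (by rw [(hR v hvS hvr).1]; omega)
    obtain ⟨hpS, hprk⟩ := hp v hvS hvr
    have hpv : p v ≠ v := hnochild v hvS hvr
    let A' : ι → Finset P := Function.update A (p v) (A (p v) \ R')
    have hA'sub : ∀ w, A' w ⊆ A w := by
      intro w
      by_cases hw : w = p v
      · subst hw; simp [A']
      · simp [A', hw]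
    have hA'mem : ∀ w ∈ S, ∀ a, a ∈ A' w ↔ a ∈ A w ∧ a ∉ R' := by
      intro w hw a
      by_cases hwp : w = p v
      · subst hwp; simp [A']
      · simp only [A', Function.update_of_ne hwp]
        refine ⟨fun ha => ⟨ha, fun haR => ?_⟩, fun ha => ha.1⟩
        exact Finset.disjoint_left.1 (hAA w hw (p v) hpS hwp) ha (hRA v hvS hvr (hR' haR))
    have hSv : S.erase v ⊂ S := Finset.erase_ssubset hvS
    have hsub : ∀ {w}, w ∈ S.erase v → w ∈ S := fun hw => Finset.mem_of_mem_erase hw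
    obtain ⟨C0, hC1, hC2, hC3, hC4, hC5⟩ := ih (S.erase v) hSv
      (Finset.mem_erase.2 ⟨hvr.symm, hroot⟩)
      (fun w hw hwr => ⟨Finset.mem_erase.2 ⟨hnochild w (hsub hw) hwr, (hp w (hsub hw) hwr).1⟩,
        (hp w (hsub hw) hwr).2⟩)
      (fun w hw => hQ w (hsub hw)) (fun w hw => hR w (hsub hw))
      (fun w hw w' hw' => hRR w (hsub hw) w' (hsub hw'))
      (fun w hw w' hw' => hRQ w (hsub hw) w' (hsub hw'))
      A' (fun w hw => (hA w (hsub hw)).mono (by exact_mod_cast hA'sub w))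
      (fun w hw w' hw' hne => (hAA w (hsub hw) w' (hsub hw') hne).mono (hA'sub w) (hA'sub w'))
      (by
        intro w hw a ha
        rw [hA'mem w (hsub hw)]
        refine ⟨hQA w (hsub hw) ha, fun haR => ?_⟩
        exact Finset.disjoint_left.1 (hRQ v hvS w (hsub hw) hvr) (hR' haR) ha)
      (by
        intro w hw hwr a ha
        rw [hA'mem (p w) (hp w (hsub hw) hwr).1]
        refine ⟨hRA w (hsub hw) hwr ha, fun haR => ?_⟩
        exact Finset.disjoint_left.1
          (hRR v hvS w (hsub hw) hvr hwr (Finset.ne_of_mem_erase hw).symm) (hR' haR) ha)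
    have hU' : ∀ a, a ∈ (S.erase v).biUnion A' ↔ (∃ w ∈ S, w ≠ v ∧ a ∈ A w) ∧ a ∉ R' := by
      intro a
      simp only [Finset.mem_biUnion, Finset.mem_erase]
      constructor
      · rintro ⟨w, ⟨h1, h2⟩, h3⟩
        rw [hA'mem w h2] at h3
        exact ⟨⟨w, h2, h1, h3.1⟩, h3.2⟩
      · rintro ⟨⟨w, h1, h2, h3⟩, h4⟩
        exact ⟨w, ⟨h2, h1⟩, (hA'mem w h1 a).2 ⟨h3, h4⟩⟩
    have hR'A : ∀ a ∈ R', a ∈ A (p v) := fun a ha => hRA v hvS hvr (hR' ha)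
    have hQ'A : ∀ a ∈ Q', a ∈ A v := fun a ha => hQA v hvS (hQ' ha)
    have hvU' : ∀ a ∈ A v, a ∉ (S.erase v).biUnion A' := by
      intro a ha hc
      obtain ⟨⟨w, h1, h2, h3⟩, _⟩ := (hU' a).1 hc
      exact Finset.disjoint_left.1 (hAA w h1 v hvS h2) h3 ha
    have hR'v : ∀ a ∈ R', a ∉ A v := fun a ha hc =>
      Finset.disjoint_left.1 (hAA _ hpS v hvS hpv) (hR'A a ha) hc
    have hU'sub : (S.erase v).biUnion A' ⊆ S.biUnion A := by
      intro a ha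
      obtain ⟨⟨w, h1, h2, h3⟩, _⟩ := (hU' a).1 ha
      exact Finset.mem_biUnion.2 ⟨w, h1, h3⟩
    refine ⟨C0, hC1, hC2, hC3, hC4.trans hU'sub, ?_⟩
    have hEq : S.biUnion A \ C0 = (A v \ Q') ∪ ((Q' ∪ R') ∪ ((S.erase v).biUnion A' \ C0)) := by
      ext a
      simp only [Finset.mem_sdiff, Finset.mem_union]
      constructor
      · rintro ⟨h1, h2⟩
        obtain ⟨w, hw, haw⟩ := Finset.mem_biUnion.1 h1
        by_cases hwv : w = v
        · subst hwv
          by_cases haq : a ∈ Q'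
          · exact Or.inr (Or.inl (Or.inl haq))
          · exact Or.inl ⟨haw, haq⟩
        · by_cases har : a ∈ R'
          · exact Or.inr (Or.inl (Or.inr har))
          · exact Or.inr (Or.inr ⟨(hU' a).2 ⟨⟨w, hw, hwv, haw⟩, har⟩, h2⟩)
      · rintro (⟨h1, _⟩ | (h1 | h1) | h1)
        · exact ⟨Finset.mem_biUnion.2 ⟨v, hvS, h1⟩, fun hc => hvU' a h1 (hC4 hc)⟩
        · exact ⟨Finset.mem_biUnion.2 ⟨v, hvS, hQ'A a h1⟩, fun hc => hvU' a (hQ'A a h1) (hC4 hc)⟩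
        · exact ⟨Finset.mem_biUnion.2 ⟨p v, hpS, hR'A a h1⟩, fun hc => ((hU' a).1 (hC4 hc)).2 h1⟩
        · exact ⟨hU'sub h1.1, h1.2⟩
    rw [hEq]
    have hQR : Disjoint Q' R' := Finset.disjoint_left.2 fun a h1 h2 => hR'v a h2 (hQ'A a h1)
    have g1 : Good h (A v \ Q') := by
      apply Good.of_chain q
      · exact (hA v hvS).mono (by exact_mod_cast Finset.sdiff_subset)
      · rw [Finset.card_sdiff_of_subset (hQ'.trans (hQA v hvS)), hAq, hQc]; omega
    refine g1.union (Good.add _ _ ?_ ?_ ?_ hC5) ?_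
    · refine (hR v hvS hvr).2.mono ?_
      exact_mod_cast Finset.union_subset_union hQ' hR'
    · rw [Finset.card_union_of_disjoint hQR]; omega
    · rw [Finset.disjoint_left]
      intro a ha hc
      rw [Finset.mem_sdiff] at hc
      rcases Finset.mem_union.1 ha with ha | ha
      · exact hvU' a (hQ'A a ha) hc.1
      · exact ((hU' a).1 hc.1).2 ha
    · rw [Finset.disjoint_left]
      intro a ha hc
      rw [Finset.mem_sdiff] at ha
      simp only [Finset.mem_union, Finset.mem_sdiff] at hc
      rcases hc with (hc | hc) | hc
      · exact ha.2 hc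
      · exact hR'v a hc ha.1
      · exact hvU' a ha.1 hc.1
  · push Not at hS
    have hS1 : S = {root} := Finset.eq_singleton_iff_unique_mem.2 ⟨hroot, hS⟩
    have hU : S.biUnion A = A root := by rw [hS1]; simp
    rw [hU]
    have hAcard : h ≤ (A root).card := by
      rw [← hQ root hroot]; exact Finset.card_le_card (hQA root hroot)
    have hmd := Nat.mod_add_div ((A root).card - h) h
    have hml := Nat.mod_lt ((A root).card - h) hh
    obtain ⟨C0, hC, hCc⟩ := Finset.exists_subset_card_eq (s := A root)
      (n := h + ((A root).card - h) % h) (by have := Nat.mod_le ((A root).card - h) h; omega)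
    refine ⟨C0, (hA root hroot).mono (by exact_mod_cast hC), by omega, by omega, hC, ?_⟩
    apply Good.of_chain (((A root).card - h) / h)
    · exact (hA root hroot).mono (by exact_mod_cast Finset.sdiff_subset)
    · rw [Finset.card_sdiff_of_subset hC, hCc, mul_comm]; omega

theorem chain_bottom {P : Type*} [PartialOrder P] [DecidableEq P] (h : ℕ) (D : Finset P)
    (hD : IsChain (· ≤ ·) (D : Set P)) (hc : h ≤ D.card) :
    ∃ S ⊆ D, S.card = h ∧ ∀ x ∈ S, ∀ y ∈ D \ S, x ≤ y := by
  induction h with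
  | zero => exact ⟨∅, by simp, by simp, by simp⟩
  | succ h ih =>
    obtain ⟨S, hS, hSc, hSl⟩ := ih (by omega)
    have hne : (D \ S).Nonempty := by
      rw [← Finset.card_pos, Finset.card_sdiff_of_subset hS]; omega
    obtain ⟨a, ha⟩ := Finset.exists_minimal hne
    have haD := Finset.mem_sdiff.1 ha.1
    refine ⟨insert a S, Finset.insert_subset haD.1 hS, ?_, ?_⟩
    · rw [Finset.card_insert_of_notMem haD.2, hSc]
    · intro x hx y hy
      simp only [Finset.mem_sdiff, Finset.mem_insert, not_or] at hy
      rcases Finset.mem_insert.1 hx with rfl | hx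
      · rcases hD.total haD.1 hy.1 with hl | hl
        · exact hl
        · exact ha.2 (Finset.mem_sdiff.2 ⟨hy.1, hy.2.2⟩) hl
      · exact hSl x hx y (Finset.mem_sdiff.2 ⟨hy.1, hy.2.2⟩)

theorem chain_segments {P : Type*} [PartialOrder P] [DecidableEq P] (h : ℕ) (q : ℕ) :
    ∀ D : Finset P, IsChain (· ≤ ·) (D : Set P) → q * h ≤ D.card →
    ∃ s : ℕ → Finset P, (∀ i < q, s i ⊆ D ∧ (s i).card = h) ∧
      ∀ j < q, ∀ i < j, Disjoint (s i) (s j) ∧ ∀ x ∈ s i, ∀ y ∈ s j, x ≤ y := by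
  induction q with
  | zero => intro D _ _; exact ⟨fun _ => ∅, by simp, by simp⟩
  | succ q ih =>
    intro D hD hc
    rw [Nat.succ_mul] at hc
    obtain ⟨S, hS, hSc, hSl⟩ := chain_bottom h D hD (by omega)
    obtain ⟨s, hs1, hs2⟩ := ih (D \ S) (hD.mono (by exact_mod_cast Finset.sdiff_subset))
      (by rw [Finset.card_sdiff_of_subset hS]; omega)
    refine ⟨fun i => Nat.casesOn i S s, ?_, ?_⟩
    · rintro (_ | i) hi
      · exact ⟨hS, hSc⟩
      · exact ⟨(hs1 i (by omega)).1.trans Finset.sdiff_subset, (hs1 i (by omega)).2⟩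
    · rintro (_ | j) hj (_ | i) hi
      · omega
      · omega
      · refine ⟨?_, fun x hx y hy => hSl x hx y ((hs1 j (by omega)).1 hy)⟩
        exact Finset.disjoint_left.2 fun a ha hb =>
          (Finset.mem_sdiff.1 ((hs1 j (by omega)).1 hb)).2 ha
      · exact hs2 j (by omega) i (by omega)

theorem gray_path {α : Type*} [DecidableEq α] (s : Finset α) :
    ∃ (N : ℕ) (g : ℕ → Finset α), 0 < N ∧ g 0 = ∅ ∧
      (∀ i < N, ∀ j < N, g i = g j → i = j) ∧
      (∀ y, y ⊆ s ↔ ∃ i < N, g i = y) ∧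
      ∀ i, i + 1 < N → g i ≤ g (i+1) ∨ g (i+1) ≤ g i := by
  induction s using Finset.induction_on with
  | empty =>
    refine ⟨1, fun _ => ∅, by omega, rfl, by intros; omega, ?_, by intros; omega⟩
    intro y
    simp only [Finset.subset_empty]
    exact ⟨fun h => ⟨0, by omega, h.symm⟩, fun ⟨_, _, h⟩ => h.symm⟩
  | insert a s ha ih =>
    obtain ⟨N, g, hN, h0, hinj, hsurj, hstep⟩ := ih
    have hna : ∀ i < N, a ∉ g i := fun i hi hc => ha ((hsurj (g i)).2 ⟨i, hi, rfl⟩ hc)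
    refine ⟨2 * N, fun i => if i < N then g i else insert a (g (2 * N - 1 - i)), by omega,
      by simp [hN, h0], ?_, ?_, ?_⟩
    · intro i hi j hj hij
      by_cases h1 : i < N <;> by_cases h2 : j < N <;> simp only [h1, h2, if_true, if_false] at hij
      · exact hinj i h1 j h2 hij
      · exact absurd (hij ▸ Finset.mem_insert_self a _) (hna i h1)
      · exact absurd (hij ▸ Finset.mem_insert_self a _) (hna j h2)
      · have h3 := hna (2 * N - 1 - i) (by omega)
        have h4 := hna (2 * N - 1 - j) (by omega)
        have := congrArg (fun z => Finset.erase z a) hij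
        simp only [Finset.erase_insert h3, Finset.erase_insert h4] at this
        have := hinj _ (by omega) _ (by omega) this
        omega
    · intro y
      constructor
      · intro hy
        by_cases hay : a ∈ y
        · obtain ⟨i, hi, hgi⟩ := (hsurj (y.erase a)).1 (by
            intro b hb
            rw [Finset.mem_erase] at hb
            exact (Finset.mem_insert.1 (hy hb.2)).resolve_left hb.1)
          refine ⟨2 * N - 1 - i, by omega, ?_⟩
          beta_reduce
          rw [if_neg (by omega), show 2 * N - 1 - (2 * N - 1 - i) = i by omega, hgi,
            Finset.insert_erase hay]
        · obtain ⟨i, hi, hgi⟩ := (hsurj y).1 ((Finset.subset_insert_iff_of_notMem hay).1 hy)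
          exact ⟨i, by omega, by beta_reduce; rw [if_pos hi, hgi]⟩
      · rintro ⟨i, hi, rfl⟩
        beta_reduce
        by_cases h1 : i < N
        · rw [if_pos h1]
          exact ((hsurj _).2 ⟨i, h1, rfl⟩).trans (Finset.subset_insert _ _)
        · rw [if_neg h1]
          exact Finset.insert_subset_insert _ ((hsurj _).2 ⟨_, by omega, rfl⟩)
    · intro i hi
      beta_reduce
      by_cases h1 : i + 1 < N
      · rw [if_pos (by omega), if_pos h1]; exact hstep i h1
      · by_cases h2 : i < N
        · rw [if_pos h2, if_neg h1, show 2 * N - 1 - (i + 1) = i by omega]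
          exact Or.inl (Finset.subset_insert _ _)
        · rw [if_neg h2, if_neg h1]
          have := hstep (2 * N - 1 - (i+1)) (by omega)
          rw [show 2 * N - 1 - (i+1) + 1 = 2 * N - 1 - i by omega] at this
          rcases this with h | h
          · exact Or.inr (Finset.insert_subset_insert _ h)
          · exact Or.inl (Finset.insert_subset_insert _ h)

theorem gray_parent (k : ℕ) : ∃ (K : ℕ) (idx : Finset (Fin k) → ℕ)
    (par : Finset (Fin k) → Finset (Fin k)), (∀ y, idx y < K) ∧
      (∀ y, y ≠ ∅ → idx (par y) < idx y) ∧ (∀ y, y ≠ ∅ → y ≤ par y ∨ par y ≤ y) ∧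
      ∀ y y', y ≠ ∅ → y' ≠ ∅ → par y = par y' → y = y' := by
  obtain ⟨N, g, hN, h0, hinj, hsurj, hstep⟩ := gray_path (Finset.univ : Finset (Fin k))
  choose idx hidx hg using fun y => (hsurj y).1 (Finset.subset_univ y)
  have hpos : ∀ y, y ≠ ∅ → 0 < idx y := by
    intro y hy
    rcases Nat.eq_zero_or_pos (idx y) with h | h
    · have := hg y; rw [h, h0] at this; exact absurd this.symm hy
    · exact h
  have hidg : ∀ i < N, idx (g i) = i := fun i hi => hinj _ (hidx _) _ hi (hg _)
  refine ⟨N, idx, fun y => g (idx y - 1), hidx, ?_, ?_, ?_⟩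
  · intro y hy
    have := hpos y hy; have := hidx y
    show idx (g (idx y - 1)) < idx y
    rw [hidg _ (by omega)]; omega
  · intro y hy
    have h1 := hpos y hy; have h2 := hidx y
    have := hstep (idx y - 1) (by omega)
    rw [show idx y - 1 + 1 = idx y by omega, hg] at this
    exact this.symm
  · intro y y' hy hy' h
    have := hpos y hy; have := hpos y' hy'; have := hidx y; have := hidx y'
    have := hinj _ (by omega) _ (by omega) h
    rw [← hg y, ← hg y', show idx y = idx y' by omega]

theorem fibers_many (k : ℕ) (c : Finset (Fin k) → Finset (Fin k)) (hcc : ∀ x, c (c x) = c x)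
    (hch : ∀ x y, c x = c y → x ≤ y ∨ y ≤ x) :
    2 ^ k ≤ (univ.filter fun w => c w = w).card * (k + 1) := by
  classical
  have h1 : (univ : Finset (Finset (Fin k))).card ≤
      (univ.filter fun w => c w = w).card * (k + 1) := by
    rw [mul_comm]
    apply Finset.card_le_mul_card_image_of_maps_to (f := c)
    · intro a _
      simp [hcc]
    · intro b _
      have : (range (k+1)).card = k + 1 := by simp
      rw [← this]
      apply Finset.card_le_card_of_injOn Finset.card
      · intro a _
        have := a.card_le_univ
        simp at this ⊢
        omega
      · intro x hx y hy hxy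
        simp only [coe_filter, mem_univ, true_and, Set.mem_setOf_eq] at hx hy
        rcases hch x y (hx.trans hy.symm) with h | h
        · exact Finset.eq_of_subset_of_card_le h hxy.ge
        · exact (Finset.eq_of_subset_of_card_le h hxy.le).symm
  simpa using h1

theorem product_partition (h m k : ℕ) (hh : 0 < h) (hm : 36 * (6 * h)^2 ≤ m)
    (hk : 36 * (6 * h)^2 ≤ k) (hmk : 2 ^ m * (k + 1) ≤ 2 ^ k) :
    ∃ C0 : Finset (Finset (Fin m) × Finset (Fin k)), IsChain (· ≤ ·)
      (C0 : Set (Finset (Fin m) × Finset (Fin k))) ∧ h ≤ C0.card ∧ C0.card < 2 * h ∧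
      Good h (univ \ C0) := by
  classical
  obtain ⟨c, hcc, _, hch, hcb⟩ := long_chains_s14 (6 * h) m (by omega) hm
  obtain ⟨b, hbb, hble, hbh, hbc⟩ := long_chains_s14 (6 * h) k (by omega) hk
  obtain ⟨K, idx, par, hK, hpar, hcomp, hparinj⟩ := gray_parent k
  -- injection between labels
  obtain ⟨e, hemap, heinj⟩ : ∃ e : Finset (Fin m) → Finset (Fin k),
      (∀ u, c u = u → b (e u) = e u) ∧ ∀ u u', c u = u → c u' = u' → e u = e u' → u = u' := by
    have h1 : (univ.filter fun u => c u = u).card ≤ (univ.filter fun w => b w = w).card := by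
      have h2 := fibers_many k b hbb hbh
      have h3 : (univ.filter fun u => c u = u).card ≤ 2 ^ m := by
        have := Finset.card_le_univ (univ.filter fun u => c u = u)
        simpa using this
      exact h3.trans (Nat.le_of_mul_le_mul_right (hmk.trans h2) (by omega))
    have h4 : Fintype.card {u // c u = u} ≤ Fintype.card {w // b w = w} := by
      rw [Fintype.card_subtype, Fintype.card_subtype]
      exact h1
    obtain ⟨f⟩ := Function.Embedding.nonempty_of_card_le h4
    refine ⟨fun u => if hu : c u = u then (f ⟨u, hu⟩).1 else ∅, ?_, ?_⟩
    · intro u hu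
      simp only [dif_pos hu]
      exact (f ⟨u, hu⟩).2
    · intro u u' hu hu' heq
      simp only [dif_pos hu, dif_pos hu'] at heq
      exact congrArg Subtype.val (f.injective (Subtype.ext heq))
  -- segments
  have hseg : ∀ u, ∃ s : ℕ → Finset (Finset (Fin m)), c u = u →
      (∀ i < 5, s i ⊆ (univ.filter fun x => c x = u ∧ x ≠ univ) ∧ (s i).card = h) ∧
      ∀ j < 5, ∀ i < j, Disjoint (s i) (s j) ∧ ∀ x ∈ s i, ∀ y ∈ s j, x ≤ y := by
    intro u
    by_cases hu : c u = u
    · obtain ⟨s, hs⟩ := chain_segments h 5 (univ.filter fun x => c x = u ∧ x ≠ univ)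
        (by
          intro x hx y hy _
          simp only [coe_filter, mem_univ, true_and, Set.mem_setOf_eq] at hx hy
          exact hch x y (hx.1.trans hy.1.symm))
        (by
          have h1 := hcb u
          rw [hu] at h1
          have h2 : (univ.filter fun x => c x = u) ⊆
              insert univ (univ.filter fun x => c x = u ∧ x ≠ univ) := by
            intro x hx
            simp only [mem_filter, mem_univ, true_and, mem_insert] at hx ⊢
            tauto
          have h3 := (Finset.card_le_card h2).trans (Finset.card_insert_le _ _)
          omega)
      exact ⟨s, fun _ => hs⟩
    · exact ⟨fun _ => ∅, fun h => absurd h hu⟩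
  choose seg hseg using hseg
  have hsegc : ∀ u i, c u = u → i < 5 → (seg u i).card = h := fun u i hu hi =>
    ((hseg u hu).1 i hi).2
  have hsegm : ∀ u i x, c u = u → i < 5 → x ∈ seg u i → c x = u ∧ x ≠ univ := by
    intro u i x hu hi hx
    have := ((hseg u hu).1 i hi).1 hx
    simpa using this
  have hsegle : ∀ u i j x y, c u = u → i < j → j < 5 → x ∈ seg u i → y ∈ seg u j → x ≤ y :=
    fun u i j x y hu hij hj hx hy => ((hseg u hu).2 j hj i hij).2 x hx y hy
  have hsegd : ∀ u i j x, c u = u → i < 5 → j < 5 → x ∈ seg u i → x ∈ seg u j → i = j := by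
    intro u i j x hu hi hj hxi hxj
    rcases lt_trichotomy i j with h1 | h1 | h1
    · exact absurd hxj (Finset.disjoint_left.1 ((hseg u hu).2 j hj i h1).1 hxi)
    · exact h1
    · exact absurd hxi (Finset.disjoint_left.1 ((hseg u hu).2 i hi j h1).1 hxj)
  have htop : ∀ w, ∃ s : ℕ → Finset (Finset (Fin k)), b w = w →
      (∀ i < 2, s i ⊆ (univ.filter fun x => b x = w) ∧ (s i).card = h) ∧
      Disjoint (s 0) (s 1) := by
    intro w
    by_cases hw : b w = w
    · obtain ⟨s, hs⟩ := chain_segments h 2 (univ.filter fun x => b x = w)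
        (by
          intro x hx y hy _
          simp only [coe_filter, mem_univ, true_and, Set.mem_setOf_eq] at hx hy
          exact hbh x y (hx.trans hy.symm))
        (by
          have h1 := hbc w
          rw [hw] at h1
          omega)
      exact ⟨s, fun _ => ⟨hs.1, (hs.2 1 (by omega) 0 (by omega)).1⟩⟩
    · exact ⟨fun _ => ∅, fun h => absurd h hw⟩
  choose top htop using htop
  have htopc : ∀ w i, b w = w → i < 2 → (top w i).card = h := fun w i hw hi =>
    ((htop w hw).1 i hi).2
  have htopm : ∀ w i x, b w = w → i < 2 → x ∈ top w i → b x = w := by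
    intro w i x hw hi hx
    have := ((htop w hw).1 i hi).1 hx
    simpa using this
  have htopd : ∀ w x, b w = w → x ∈ top w 0 → x ∉ top w 1 := fun w x hw =>
    fun hx => Finset.disjoint_left.1 (htop w hw).2 hx
  clear hseg htop
  set u0 := c univ with hu0
  have hu0c : c u0 = u0 := hcc _
  let ι := (Finset (Fin m) × Finset (Fin k)) ⊕ Finset (Fin k)
  let P := Finset (Fin m) × Finset (Fin k)
  let p : ι → ι := fun v => match v with
    | Sum.inl (u, y) => if y = ∅ then Sum.inr (e u) else Sum.inl (u, par y)
    | Sum.inr w => Sum.inl (u0, w)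
  -- segment used for output, and for input at the parent
  let qi : Finset (Fin k) → ℕ := fun y => if par y ≤ y then 3 else 0
  let ri : Finset (Fin k) → ℕ := fun y => if par y ≤ y then 1 else 2
  have hqi : ∀ y, qi y = 0 ∨ qi y = 3 := by intro y; simp only [qi]; split_ifs <;> simp
  have hri : ∀ y, ri y = 1 ∨ ri y = 2 := by intro y; simp only [ri]; split_ifs <;> simp
  let Q : ι → Finset P := fun v => match v with
    | Sum.inl (u, y) => seg u (qi y) ×ˢ {y}
    | Sum.inr w => {univ} ×ˢ top w 1
  let R : ι → Finset P := fun v => match v with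
    | Sum.inl (u, y) => if y = ∅ then {univ} ×ˢ top (e u) 0 else seg u (ri y) ×ˢ {par y}
    | Sum.inr w => seg u0 4 ×ˢ {w}
  let rk : ι → ℕ := fun v => match v with
    | Sum.inl (u, y) => if u = u0 then idx y else K + 1 + idx y
    | Sum.inr _ => K
  let A : ι → Finset P := fun v => match v with
    | Sum.inl (u, y) => (univ.filter fun x => c x = u ∧ x ≠ univ) ×ˢ {y}
    | Sum.inr w => {univ} ×ˢ (univ.filter fun x => b x = w)
  let S : Finset ι := univ.filter fun v => match v with
    | Sum.inl (u, _) => c u = u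
    | Sum.inr w => b w = w
  have hSl : ∀ u y, (Sum.inl (u, y) : ι) ∈ S ↔ c u = u := by intro u y; simp [S]
  have hSr : ∀ w, (Sum.inr w : ι) ∈ S ↔ b w = w := by intro w; simp [S]
  -- membership descriptions
  have hQl : ∀ u y x z, (x, z) ∈ Q (Sum.inl (u, y)) ↔ x ∈ seg u (qi y) ∧ z = y := by
    intro u y x z; exact Finset.mem_product.trans (and_congr Iff.rfl Finset.mem_singleton)
  have hQr : ∀ w x z, (x, z) ∈ Q (Sum.inr w) ↔ x = univ ∧ z ∈ top w 1 := by
    intro w x z; exact Finset.mem_product.trans (and_congr Finset.mem_singleton Iff.rfl)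
  have hRl0 : ∀ u x z, (x, z) ∈ R (Sum.inl (u, ∅)) ↔ x = univ ∧ z ∈ top (e u) 0 := by
    intro u x z; simp only [R, if_true]; exact Finset.mem_product.trans (and_congr Finset.mem_singleton Iff.rfl)
  have hRl : ∀ u y x z, y ≠ ∅ → ((x, z) ∈ R (Sum.inl (u, y)) ↔ x ∈ seg u (ri y) ∧ z = par y) := by
    intro u y x z hy; simp only [R, if_neg hy]; exact Finset.mem_product.trans (and_congr Iff.rfl Finset.mem_singleton)
  have hRr : ∀ w x z, (x, z) ∈ R (Sum.inr w) ↔ x ∈ seg u0 4 ∧ z = w := by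
    intro w x z; exact Finset.mem_product.trans (and_congr Iff.rfl Finset.mem_singleton)
  have hAl : ∀ u y x z, (x, z) ∈ A (Sum.inl (u, y)) ↔ (c x = u ∧ x ≠ univ) ∧ z = y := by
    intro u y x z
    exact Finset.mem_product.trans (and_congr (by simp) Finset.mem_singleton)
  have hAr : ∀ w x z, (x, z) ∈ A (Sum.inr w) ↔ x = univ ∧ b z = w := by
    intro w x z
    exact Finset.mem_product.trans (and_congr Finset.mem_singleton (by simp))
  have hpl0 : ∀ u, p (Sum.inl (u, ∅)) = Sum.inr (e u) := by intro u; simp [p]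
  have hpl : ∀ u y, y ≠ ∅ → p (Sum.inl (u, y)) = Sum.inl (u, par y) := by
    intro u y hy; simp [p, hy]
  have hpr : ∀ w, p (Sum.inr w) = Sum.inl (u0, w) := fun w => rfl
  have hq5 : ∀ y, qi y < 5 := fun y => by have := hqi y; omega
  have hr5 : ∀ y, ri y < 5 := fun y => by have := hri y; omega
  have hU : S.biUnion A = univ := by
    ext ⟨x, z⟩
    simp only [mem_biUnion, mem_univ, iff_true]
    by_cases hx : x = univ
    · exact ⟨Sum.inr (b z), (hSr _).2 (hbb z), (hAr _ _ _).2 ⟨hx, rfl⟩⟩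
    · exact ⟨Sum.inl (c x, z), (hSl _ _).2 (hcc x), (hAl _ _ _ _).2 ⟨⟨rfl, hx⟩, rfl⟩⟩
  have main := link h hh (Sum.inl (u0, ∅)) p rk Q R S ?_ ?_ ?_ ?_ ?_ ?_ A ?_ ?_ ?_ ?_
  · obtain ⟨C0, h1, h2, h3, _, h5⟩ := main
    rw [hU] at h5
    exact ⟨C0, h1, h2, h3, h5⟩
  · exact (hSl _ _).2 hu0c
  · -- parents
    rintro (⟨u, y⟩ | w) hv hne
    · rw [hSl] at hv
      by_cases hy : y = ∅
      · subst hy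
        have hu : u ≠ u0 := fun h => hne (by rw [h])
        rw [hpl0, hSr]
        refine ⟨hemap u hv, ?_⟩
        simp only [rk, if_neg hu]; omega
      · rw [hpl u y hy, hSl]
        refine ⟨hv, ?_⟩
        have := hpar y hy
        simp only [rk]; split_ifs <;> omega
    · rw [hpr, hSl]
      refine ⟨hu0c, ?_⟩
      simp only [rk, if_true]; exact hK w
  · rintro (⟨u, y⟩ | w) hv
    · rw [hSl] at hv
      simp [Q, hsegc u _ hv (hq5 y)]
    · rw [hSr] at hv
      simp [Q, htopc w 1 hv (by omega)]
  · rintro (⟨u, y⟩ | w) hv hne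
    · rw [hSl] at hv
      by_cases hy : y = ∅
      · subst hy
        refine ⟨by simp [R, htopc (e u) 0 (hemap u hv) (by omega)], ?_⟩
        rintro ⟨x, z⟩ h1 ⟨x', z'⟩ h2 _
        simp only [coe_union, Set.mem_union, mem_coe, hQl, hRl0] at h1 h2
        rcases h1 with ⟨h1, rfl⟩ | ⟨rfl, h1⟩ <;> rcases h2 with ⟨h2, rfl⟩ | ⟨rfl, h2⟩
        · have q1 := hsegm _ _ _ hv (hq5 _) h1
          have q2 := hsegm _ _ _ hv (hq5 _) h2
          rcases hch x x' (q1.1.trans q2.1.symm) with h | h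
          · exact Or.inl ⟨h, le_rfl⟩
          · exact Or.inr ⟨h, le_rfl⟩
        · exact Or.inl ⟨Finset.subset_univ _, Finset.empty_subset _⟩
        · exact Or.inr ⟨Finset.subset_univ _, Finset.empty_subset _⟩
        · have q1 := htopm _ _ _ (hemap u hv) (by omega) h1
          have q2 := htopm _ _ _ (hemap u hv) (by omega) h2
          rcases hbh z z' (q1.trans q2.symm) with h | h
          · exact Or.inl ⟨le_rfl, h⟩
          · exact Or.inr ⟨le_rfl, h⟩
      · refine ⟨by simp [R, hy, hsegc u _ hv (hr5 y)], ?_⟩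
        have hqr : ∀ x x', x ∈ seg u (qi y) → x' ∈ seg u (ri y) →
            ((x, y) : P) ≤ (x', par y) ∨ ((x', par y) : P) ≤ (x, y) := by
          intro x x' hx hx'
          by_cases hpy : par y ≤ y
          · simp only [qi, ri, if_pos hpy] at hx hx'
            exact Or.inr ⟨hsegle u 1 3 x' x hv (by omega) (by omega) hx' hx, hpy⟩
          · simp only [qi, ri, if_neg hpy] at hx hx'
            exact Or.inl ⟨hsegle u 0 2 x x' hv (by omega) (by omega) hx hx',
              (hcomp y hy).resolve_right hpy⟩
        rintro ⟨x, z⟩ h1 ⟨x', z'⟩ h2 _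
        simp only [coe_union, Set.mem_union, mem_coe, hQl, hRl _ _ _ _ hy] at h1 h2
        rcases h1 with ⟨h1, rfl⟩ | ⟨h1, rfl⟩ <;> rcases h2 with ⟨h2, rfl⟩ | ⟨h2, rfl⟩
        · have q1 := hsegm _ _ _ hv (hq5 _) h1
          have q2 := hsegm _ _ _ hv (hq5 _) h2
          rcases hch x x' (q1.1.trans q2.1.symm) with h | h
          · exact Or.inl ⟨h, le_rfl⟩
          · exact Or.inr ⟨h, le_rfl⟩
        · exact hqr x x' h1 h2
        · exact (hqr x' x h2 h1).symm
        · have q1 := hsegm _ _ _ hv (hr5 _) h1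
          have q2 := hsegm _ _ _ hv (hr5 _) h2
          rcases hch x x' (q1.1.trans q2.1.symm) with h | h
          · exact Or.inl ⟨h, le_rfl⟩
          · exact Or.inr ⟨h, le_rfl⟩
    · rw [hSr] at hv
      refine ⟨by simp [R, hsegc u0 4 hu0c (by omega)], ?_⟩
      have hwle : ∀ z ∈ top w 1, w ≤ z := by
        intro z hz
        have := htopm w 1 z hv (by omega) hz
        rw [← this]; exact hble z
      rintro ⟨x, z⟩ h1 ⟨x', z'⟩ h2 _
      simp only [coe_union, Set.mem_union, mem_coe, hQr, hRr] at h1 h2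
      rcases h1 with ⟨rfl, h1⟩ | ⟨h1, rfl⟩ <;> rcases h2 with ⟨rfl, h2⟩ | ⟨h2, rfl⟩
      · have q1 := htopm _ _ _ hv (by omega) h1
        have q2 := htopm _ _ _ hv (by omega) h2
        rcases hbh z z' (q1.trans q2.symm) with h | h
        · exact Or.inl ⟨le_rfl, h⟩
        · exact Or.inr ⟨le_rfl, h⟩
      · exact Or.inr ⟨Finset.subset_univ _, hwle _ h1⟩
      · exact Or.inl ⟨Finset.subset_univ _, hwle _ h2⟩
      · have q1 := hsegm _ _ _ hu0c (by omega) h1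
        have q2 := hsegm _ _ _ hu0c (by omega) h2
        rcases hch x x' (q1.1.trans q2.1.symm) with h | h
        · exact Or.inl ⟨h, le_rfl⟩
        · exact Or.inr ⟨h, le_rfl⟩
  · -- R disjoint from R
    have key0 : ∀ u, c u = u → ∀ u' y', c u' = u' → y' ≠ ∅ →
        Disjoint (R (Sum.inl (u, ∅))) (R (Sum.inl (u', y'))) := by
      intro u hu u' y' hu' hy'
      rw [Finset.disjoint_left]
      rintro ⟨x, z⟩ h1 h2
      rw [hRl0] at h1
      rw [hRl _ _ _ _ hy'] at h2
      exact (hsegm _ _ _ hu' (hr5 _) h2.1).2 h1.1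
    have key1 : ∀ u y w, c u = u → Disjoint (R (Sum.inl (u, y))) (R (Sum.inr w)) := by
      intro u y w hu
      rw [Finset.disjoint_left]
      rintro ⟨x, z⟩ h1 h2
      rw [hRr] at h2
      have q2 := hsegm _ _ _ hu0c (by omega) h2.1
      by_cases hy : y = ∅
      · subst hy
        rw [hRl0] at h1
        exact q2.2 h1.1
      · rw [hRl _ _ _ _ hy] at h1
        have q1 := hsegm _ _ _ hu (hr5 _) h1.1
        have : u = u0 := q1.1.symm.trans q2.1
        subst this
        have := hsegd _ _ _ _ hu (hr5 _) (by omega) h1.1 h2.1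
        have := hri y
        omega
    rintro (⟨u, y⟩ | w) hv (⟨u', y'⟩ | w') hv' _ _ hne
    · rw [hSl] at hv hv'
      by_cases hy : y = ∅ <;> by_cases hy' : y' = ∅
      · subst hy hy'
        rw [Finset.disjoint_left]
        rintro ⟨x, z⟩ h1 h2
        rw [hRl0] at h1 h2
        have q1 := htopm _ _ _ (hemap u hv) (by omega) h1.2
        have q2 := htopm _ _ _ (hemap u' hv') (by omega) h2.2
        exact hne (by rw [heinj u u' hv hv' (q1.symm.trans q2)])
      · subst hy
        exact key0 u hv u' y' hv' hy'
      · subst hy'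
        exact (key0 u' hv' u y hv hy).symm
      · rw [Finset.disjoint_left]
        rintro ⟨x, z⟩ h1 h2
        rw [hRl _ _ _ _ hy] at h1
        rw [hRl _ _ _ _ hy'] at h2
        have q1 := hsegm _ _ _ hv (hr5 _) h1.1
        have q2 := hsegm _ _ _ hv' (hr5 _) h2.1
        exact hne (by rw [q1.1.symm.trans q2.1, hparinj y y' hy hy' (h1.2.symm.trans h2.2)])
    · rw [hSl] at hv
      exact key1 u y w' hv
    · rw [hSl] at hv'
      exact (key1 u' y' w hv').symm
    · rw [Finset.disjoint_left]
      rintro ⟨x, z⟩ h1 h2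
      rw [hRr] at h1 h2
      exact hne (by rw [h1.2.symm.trans h2.2])
  · -- R disjoint from Q
    rintro (⟨u, y⟩ | w) hv (⟨u', y'⟩ | w') hv' _ <;> rw [Finset.disjoint_left] <;>
      rintro ⟨x, z⟩ h1 h2
    · rw [hSl] at hv hv'
      rw [hQl] at h2
      have q2 := hsegm _ _ _ hv' (hq5 _) h2.1
      by_cases hy : y = ∅
      · subst hy
        rw [hRl0] at h1
        exact q2.2 h1.1
      · rw [hRl _ _ _ _ hy] at h1
        have q1 := hsegm _ _ _ hv (hr5 _) h1.1
        have : u = u' := q1.1.symm.trans q2.1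
        subst this
        have := hsegd _ _ _ _ hv (hr5 _) (hq5 _) h1.1 h2.1
        have := hri y
        have := hqi y'
        omega
    · rw [hSl] at hv
      rw [hSr] at hv'
      rw [hQr] at h2
      by_cases hy : y = ∅
      · subst hy
        rw [hRl0] at h1
        have q1 := htopm _ _ _ (hemap u hv) (by omega) h1.2
        have q2 := htopm _ _ _ hv' (by omega) h2.2
        have : e u = w' := q1.symm.trans q2
        rw [← this] at h2
        exact htopd _ _ (hemap u hv) h1.2 h2.2
      · rw [hRl _ _ _ _ hy] at h1
        exact (hsegm _ _ _ hv (hr5 _) h1.1).2 h2.1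
    · rw [hSl] at hv'
      rw [hRr] at h1
      rw [hQl] at h2
      have q1 := hsegm _ _ _ hu0c (by omega) h1.1
      have q2 := hsegm _ _ _ hv' (hq5 _) h2.1
      have : u' = u0 := q2.1.symm.trans q1.1
      subst this
      have := hsegd _ _ _ _ hv' (by omega) (hq5 _) h1.1 h2.1
      have := hqi y'
      omega
    · rw [hRr] at h1
      rw [hQr] at h2
      exact (hsegm _ _ _ hu0c (by omega) h1.1).2 h2.1
  · -- A chains
    rintro (⟨u, y⟩ | w) _ ⟨x, z⟩ h1 ⟨x', z'⟩ h2 _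
    · rw [mem_coe, hAl] at h1 h2
      obtain ⟨h1, rfl⟩ := h1
      obtain ⟨h2, rfl⟩ := h2
      rcases hch x x' (h1.1.trans h2.1.symm) with h | h
      · exact Or.inl ⟨h, le_rfl⟩
      · exact Or.inr ⟨h, le_rfl⟩
    · rw [mem_coe, hAr] at h1 h2
      obtain ⟨rfl, h1⟩ := h1
      obtain ⟨rfl, h2⟩ := h2
      rcases hbh z z' (h1.trans h2.symm) with h | h
      · exact Or.inl ⟨le_rfl, h⟩
      · exact Or.inr ⟨le_rfl, h⟩
  · -- A disjoint
    rintro (⟨u, y⟩ | w) _ (⟨u', y'⟩ | w') _ hne <;> rw [Finset.disjoint_left] <;>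
      rintro ⟨x, z⟩ h1 h2
    · rw [hAl] at h1 h2
      exact hne (by rw [h1.1.1.symm.trans h2.1.1, h1.2.symm.trans h2.2])
    · rw [hAl] at h1
      rw [hAr] at h2
      exact h1.1.2 h2.1
    · rw [hAr] at h1
      rw [hAl] at h2
      exact h2.1.2 h1.1
    · rw [hAr] at h1 h2
      exact hne (by rw [h1.2.symm.trans h2.2])
  · -- Q inside A
    rintro (⟨u, y⟩ | w) hv ⟨x, z⟩ h1
    · rw [hSl] at hv
      rw [hQl] at h1
      rw [hAl]
      exact ⟨hsegm _ _ _ hv (hq5 _) h1.1, h1.2⟩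
    · rw [hSr] at hv
      rw [hQr] at h1
      rw [hAr]
      exact ⟨h1.1, htopm _ _ _ hv (by omega) h1.2⟩
  · -- R inside the parent
    rintro (⟨u, y⟩ | w) hv _ ⟨x, z⟩ h1
    · rw [hSl] at hv
      by_cases hy : y = ∅
      · subst hy
        rw [hRl0] at h1
        rw [hpl0, hAr]
        exact ⟨h1.1, htopm _ _ _ (hemap u hv) (by omega) h1.2⟩
      · rw [hRl _ _ _ _ hy] at h1
        rw [hpl _ _ hy, hAl]
        exact ⟨hsegm _ _ _ hv (hr5 _) h1.1, h1.2⟩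
    · rw [hRr] at h1
      rw [hpr, hAl]
      exact ⟨hsegm _ _ _ hu0c (by omega) h1.1, h1.2⟩

theorem Good.exists_fin {P : Type*} [PartialOrder P] [DecidableEq P] {h : ℕ} {S : Finset P}
    (hS : Good h S) : ∃ (r : ℕ) (ch : Fin r → Finset P),
      (∀ i, IsChain (· ≤ ·) (ch i : Set P)) ∧ (∀ i j, i ≠ j → Disjoint (ch i) (ch j)) ∧
      Finset.univ.biUnion ch = S ∧ ∀ i, (ch i).card = h := by
  induction hS with
  | empty => exact ⟨0, Fin.elim0, fun i => i.elim0, fun i => i.elim0, by simp, fun i => i.elim0⟩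
  | add A S hA hc hAS _ ih =>
    obtain ⟨r, ch, h1, h2, h3, h4⟩ := ih
    have hsub : ∀ i, ch i ⊆ S := fun i => h3 ▸ Finset.subset_biUnion_of_mem ch (mem_univ i)
    refine ⟨r + 1, Fin.cons A ch, ?_, ?_, ?_, ?_⟩
    · intro i
      refine Fin.cases ?_ (fun i => ?_) i
      · simpa using hA
      · simpa using h1 i
    · intro i j
      refine Fin.cases ?_ (fun i => ?_) i <;> refine Fin.cases ?_ (fun j => ?_) j <;> intro hij
      · exact absurd rfl hij
      · simpa using hAS.mono_right (hsub j)
      · simpa using (hAS.mono_right (hsub i)).symm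
      · simpa using h2 i j (fun h => hij (by rw [h]))
    · ext a
      rw [← h3]
      simp [Fin.exists_fin_succ]
    · intro i
      refine Fin.cases ?_ (fun i => ?_) i
      · simpa using hc
      · simpa using h4 i

/-- Finsets of a sum as pairs of finsets. -/
theorem exists_prod_iso (m k : ℕ) :
    Nonempty (Finset (Fin m) × Finset (Fin k) ≃o Finset (Fin (m + k))) := by
  refine ⟨(Finset.sumEquiv (α := Fin m) (β := Fin k)).symm.trans
    { toEquiv := finSumFinEquiv.finsetCongr, map_rel_iff' := ?_ }⟩
  intro a b
  simp

/-- There is an absolute constant `C` such that for every positive integer `h` and every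
`n ≥ C · h²`, the Boolean lattice `2^[n]` (modelled as `Finset (Fin n)` ordered by
inclusion) can be partitioned into chains `C_0, C_1, ..., C_r` with `h ≤ |C_0| < 2h` and
`|C_i| = h` for all `i ≠ 0`. -/
theorem boolean_lattice_chain_partition :
    ∃ C : ℕ, ∀ h n : ℕ, 0 < h → C * h ^ 2 ≤ n →
      ∃ (r : ℕ) (ch : Fin (r + 1) → Finset (Finset (Fin n))),
        (∀ i, IsChain (· ≤ ·) (↑(ch i) : Set (Finset (Fin n)))) ∧
        (∀ i j, i ≠ j → Disjoint (ch i) (ch j)) ∧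
        Finset.univ.biUnion ch = Finset.univ ∧
        h ≤ (ch 0).card ∧ (ch 0).card < 2 * h ∧
        (∀ i, i ≠ 0 → (ch i).card = h) := by
  classical
  refine ⟨5000, fun h n hh hn => ?_⟩
  have hh1 : 1 ≤ h ^ 2 := Nat.one_le_pow _ _ hh
  obtain ⟨m, k, rfl, hm1, hm2⟩ : ∃ m k, n = m + k ∧ 1296 * h^2 ≤ m ∧ 2 * m ≤ k ∧ k ≤ 2 * m + 2 :=
    ⟨n / 3, n - n / 3, by omega, by omega, by omega, by omega⟩
  have hmk : 2 ^ m * (k + 1) ≤ 2 ^ k := by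
    have h1 : k + 1 ≤ 2 ^ (k - m) := by
      have h2 : k - m = (k - m - 2) + 2 := by omega
      have h3 : k - m - 2 < 2 ^ (k - m - 2) := Nat.lt_two_pow_self
      rw [h2, pow_add]
      omega
    calc 2 ^ m * (k + 1) ≤ 2 ^ m * 2 ^ (k - m) := Nat.mul_le_mul_left _ h1
      _ = 2 ^ k := by rw [← pow_add]; congr 1; omega
  have e36 : 36 * (6 * h) ^ 2 = 1296 * h ^ 2 := by ring
  obtain ⟨C0, hC1, hC2, hC3, hC4⟩ := product_partition h m k hh (by omega) (by omega) hmk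
  obtain ⟨r, ch, h1, h2, h3, h4⟩ := hC4.exists_fin
  obtain ⟨φ⟩ := exists_prod_iso m k
  have hdis : ∀ i, Disjoint C0 (ch i) := by
    intro i
    have : ch i ⊆ univ \ C0 := h3 ▸ Finset.subset_biUnion_of_mem ch (mem_univ i)
    exact (Finset.disjoint_sdiff (s := C0) (t := univ)).mono_right this
  have hchain : ∀ D : Finset (Finset (Fin m) × Finset (Fin k)),
      IsChain (· ≤ ·) (D : Set (Finset (Fin m) × Finset (Fin k))) →
      IsChain (· ≤ ·) ((D.map φ.toEquiv.toEmbedding : Finset (Finset (Fin (m + k)))) :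
        Set (Finset (Fin (m + k)))) := by
    intro D hD a ha b hb _
    rw [mem_coe, Finset.mem_map] at ha hb
    obtain ⟨a, ha, rfl⟩ := ha
    obtain ⟨b, hb, rfl⟩ := hb
    rcases hD.total ha hb with h | h
    · exact Or.inl (φ.le_iff_le.2 h)
    · exact Or.inr (φ.le_iff_le.2 h)
  refine ⟨r, fun i => (Fin.cons C0 ch : Fin (r+1) → _) i |>.map φ.toEquiv.toEmbedding, ?_, ?_, ?_, ?_, ?_, ?_⟩
  · intro i
    refine Fin.cases ?_ (fun i => ?_) i
    · exact hchain _ hC1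
    · exact hchain _ (h1 i)
  · intro i j hij
    rw [Finset.disjoint_map]
    revert hij
    refine Fin.cases ?_ (fun i => ?_) i <;> refine Fin.cases ?_ (fun j => ?_) j <;> intro hij
    · exact absurd rfl hij
    · simpa using hdis j
    · simpa using (hdis i).symm
    · simpa using h2 i j (fun h => hij (by rw [h]))
  · rw [Finset.eq_univ_iff_forall]
    intro y
    rw [Finset.mem_biUnion]
    by_cases hy : φ.symm y ∈ C0
    · exact ⟨0, mem_univ _, Finset.mem_map.2 ⟨φ.symm y, by simpa using hy, φ.apply_symm_apply y⟩⟩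
    · have : φ.symm y ∈ Finset.univ.biUnion ch := by rw [h3]; simpa using hy
      obtain ⟨i, _, hi⟩ := Finset.mem_biUnion.1 this
      exact ⟨i.succ, mem_univ _, Finset.mem_map.2 ⟨φ.symm y, by simpa using hi, φ.apply_symm_apply y⟩⟩
  · simpa using hC2
  · simpa using hC3
  · intro i
    refine Fin.cases ?_ (fun i => ?_) i
    · intro h; exact absurd rfl h
    · intro _; simpa using h4 i
end

section
/- Let P be a finite poset with a unique maximal element and a unique minimal element such that |P| = 2^k for some natural number k. Then for all sufficiently large positive integers n, the Boolean lattice 2^[n] can be partitioned into copies of P. -/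
namespace GLT
universe u v w

/-- `Q` is the disjoint union of the ranges of a family of order embeddings of `P`. -/
def Til (P : Type u) [PartialOrder P] (Q : Type v) [PartialOrder Q] : Prop :=
  ∃ (I : Type u) (f : I → P → Q), (∀ i a b, f i a ≤ f i b ↔ a ≤ b) ∧
    Function.Bijective (Function.uncurry f)

lemma Til.partitioned {P : Type u} [PartialOrder P] {Q : Type v} [PartialOrder Q]
    (h : Til P Q) : PartitionedIntoCopies P (Set.univ : Set Q) := by
  obtain ⟨I, f, hf, hinj, hsurj⟩ := h
  refine ⟨Set.range fun i => Set.range (f i), ?_, ?_, ?_⟩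
  · rintro _ ⟨i, rfl⟩
    exact ⟨(OrderEmbedding.ofMapLEIff (f i) (hf i)).orderIso⟩
  · rintro _ ⟨i, rfl⟩ _ ⟨j, rfl⟩ hij
    refine Set.disjoint_left.2 ?_
    rintro _ ⟨a, rfl⟩ ⟨b, hb⟩
    have : (j, b) = (i, a) := hinj hb
    simp only [Prod.mk.injEq] at this
    exact hij (by rw [this.1])
  · refine Set.eq_univ_of_forall fun q => ?_
    obtain ⟨⟨i, p⟩, rfl⟩ := hsurj q
    exact ⟨_, ⟨i, rfl⟩, p, rfl⟩

lemma Til.congr {P : Type u} [PartialOrder P] {Q : Type v} [PartialOrder Q]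
    {R : Type w} [PartialOrder R] (h : Til P Q) (e : Q ≃o R) : Til P R := by
  obtain ⟨I, f, hf, hb⟩ := h
  refine ⟨I, fun i p => e (f i p), fun i a b => by simp [hf], ?_⟩
  exact e.bijective.comp hb

lemma Til.prod {P : Type u} [PartialOrder P] {Q : Type v} [PartialOrder Q]
    {R : Type} [PartialOrder R] (h : Til P Q) : Til P (Q × R) := by
  obtain ⟨I, f, hf, hinj, hsurj⟩ := h
  refine ⟨I × ULift.{u} R, fun i p => (f i.1 p, i.2.down), fun i a b => by simp [hf], ?_, ?_⟩
  · rintro ⟨⟨i, ⟨r⟩⟩, p⟩ ⟨⟨j, ⟨s⟩⟩, q⟩ h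
    simp only [Function.uncurry, Prod.mk.injEq] at h
    have : (i, p) = (j, q) := hinj h.1
    simp_all
  · rintro ⟨q, r⟩
    obtain ⟨⟨i, p⟩, rfl⟩ := hsurj q
    exact ⟨((i, ⟨r⟩), p), rfl⟩

section Replace
variable {P : Type u} [PartialOrder P] [BoundedOrder P] {Q : Type v} [PartialOrder Q]

open Classical in
lemma replace_top {f : P → Q} (hf : ∀ a b, f a ≤ f b ↔ a ≤ b) {w : Q}
    (hw : ∀ q, q ≠ ⊤ → f q < w) (a b : P) :
    Function.update f ⊤ w a ≤ Function.update f ⊤ w b ↔ a ≤ b := by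
  by_cases ha : a = ⊤ <;> by_cases hb : b = ⊤
  · simp [ha, hb]
  · subst ha
    simp [hb, (hw b hb).not_ge]
  · subst hb
    simp [ha, (hw a ha).le]
  · simp [ha, hb, hf]

open Classical in
lemma replace_bot {f : P → Q} (hf : ∀ a b, f a ≤ f b ↔ a ≤ b) {w : Q}
    (hw : ∀ q, q ≠ ⊥ → w < f q) (a b : P) :
    Function.update f ⊥ w a ≤ Function.update f ⊥ w b ↔ a ≤ b := by
  by_cases ha : a = ⊥ <;> by_cases hb : b = ⊥
  · simp [ha, hb]
  · subst ha
    simp [hb, (hw b hb).le]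
  · subst hb
    simp [ha, (hw a ha).not_ge]
  · simp [ha, hb, hf]

end Replace

/-- The assembly lemma. -/
theorem assembly {P : Type u} [PartialOrder P] [BoundedOrder P] [Finite P]
    {A Q : Type u} [PartialOrder A] [PartialOrder Q] [Finite A] [Finite Q]
    (K : Set Q) {J : Type u} (t : J → P → Q) (ht : ∀ i a b, t i a ≤ t i b ↔ a ≤ b)
    (htinj : Function.Injective (Function.uncurry t))
    (htr : ∀ x, x ∉ K ↔ ∃ j p, t j p = x)
    {Λ Δ : Type u} (U : Λ → P → A) (L : Δ → P → A) (B : P → P → A)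
    (hU : ∀ i a b, U i a ≤ U i b ↔ a ≤ b) (hL : ∀ i a b, L i a ≤ L i b ↔ a ≤ b)
    (hB : ∀ i a b, B i a ≤ B i b ↔ a ≤ b)
    (hz : ∀ a b, B a ⊤ ≤ B b ⊤ ↔ a ≤ b)
    (F : Λ ⊕ Δ ⊕ P → P → A)
    (hF : F = Sum.elim U (Sum.elim L B))
    (hinj : Function.Injective (Function.uncurry F))
    {G : Type u} (e : {a : A // ∀ i p, F i p ≠ a} ≃ G × P)
    (up : {a : A // ∀ i p, F i p ≠ a} → Λ)
    (dn : {a : A // ∀ i p, F i p ≠ a} → Option Δ)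
    (h1 : ∀ s, dn s = none → s.1 ≤ U (up s) ⊥)
    (h2 : ∀ s d, dn s = some d → L d ⊤ ≤ s.1 ∧ L d ⊤ ≤ U (up s) ⊥)
    (h3 : ∀ i p q, q ≠ ⊤ → B p q < U i ⊥)
    (φ ψ : K → {a : A // ∀ i p, F i p ≠ a} → Q)
    (hφ : Function.Injective (Function.uncurry φ))
    (hψ : Function.Injective (Function.uncurry ψ))
    (hφ' : ∀ x s, x.1 ≤ φ x s) (hψ' : ∀ x s, ψ x s ≤ x.1) :
    Til P (A × Q) := by
  classical
  let H := {a : A // ∀ i p, F i p ≠ a}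
  -- what stands before the bottom of an up tile
  let prevU : K → H → A × Q := fun x s =>
    match dn s with
    | none => (s.1, x.1)
    | some d => (L d ⊤, ψ x s)
  let gU : Λ × Q → P → A × Q := fun i =>
    if h : ∃ c : K × H, φ c.1 c.2 = i.2 ∧ up c.2 = i.1 then
      Function.update (fun p => (U i.1 p, i.2)) ⊥ (prevU h.choose.1 h.choose.2)
    else fun p => (U i.1 p, i.2)
  let gL : Δ × Q → P → A × Q := fun i =>
    if h : ∃ c : K × H, ψ c.1 c.2 = i.2 ∧ dn c.2 = some i.1 then
      Function.update (fun p => (L i.1 p, i.2)) ⊤ (h.choose.2.1, h.choose.1.1)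
    else fun p => (L i.1 p, i.2)
  let gB : P × Q → P → A × Q := fun i =>
    if h : ∃ c : K × G, ψ c.1 (e.symm (c.2, ⊥)) = i.2 then
      Function.update (fun p => (B i.1 p, i.2)) ⊤
        (U (up (e.symm (h.choose.2, i.1))) ⊥, φ h.choose.1 (e.symm (h.choose.2, i.1)))
    else fun p => (B i.1 p, i.2)
  let gN : K × G → P → A × Q := fun c p => (B p ⊤, ψ c.1 (e.symm (c.2, ⊥)))
  let gT : H × J → P → A × Q := fun c p => (c.1.1, t c.2 p)
  have gU_eq : ∀ x s, gU (up s, φ x s) =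
      Function.update (fun p => (U (up s) p, φ x s)) ⊥ (prevU x s) := by
    intro x s
    have h : ∃ c : K × H, φ c.1 c.2 = (up s, φ x s).2 ∧ up c.2 = (up s, φ x s).1 :=
      ⟨(x, s), rfl, rfl⟩
    have hc : h.choose = (x, s) := hφ h.choose_spec.1
    simp only [gU]
    rw [dif_pos h, hc]
  have gL_eq : ∀ x s d, dn s = some d → gL (d, ψ x s) =
      Function.update (fun p => (L d p, ψ x s)) ⊤ (s.1, x.1) := by
    intro x s d hd
    have h : ∃ c : K × H, ψ c.1 c.2 = (d, ψ x s).2 ∧ dn c.2 = some (d, ψ x s).1 :=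
      ⟨(x, s), rfl, hd⟩
    have hc : h.choose = (x, s) := hψ h.choose_spec.1
    simp only [gL]
    rw [dif_pos h, hc]
  have gB_eq : ∀ x g p, gB (p, ψ x (e.symm (g, ⊥))) =
      Function.update (fun q => (B p q, ψ x (e.symm (g, ⊥)))) ⊤
        (U (up (e.symm (g, p))) ⊥, φ x (e.symm (g, p))) := by
    intro x g p
    have h : ∃ c : K × G, ψ c.1 (e.symm (c.2, ⊥)) = (p, ψ x (e.symm (g, ⊥))).2 :=
      ⟨(x, g), rfl⟩
    have hc0 : (h.choose.1, e.symm (h.choose.2, ⊥)) = (x, e.symm (g, ⊥)) := hψ h.choose_spec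
    have hc : h.choose = (x, g) := by
      have h1 := congrArg Prod.fst hc0
      have h2 := congrArg Prod.snd hc0
      have h3 := congrArg Prod.fst (e.symm.injective h2)
      exact Prod.ext h1 h3
    simp only [gB]
    rw [dif_pos h, hc]
  let g : (H × J) ⊕ ((Λ × Q) ⊕ (Δ × Q) ⊕ (P × Q)) ⊕ (K × G) → P → A × Q :=
    Sum.elim gT (Sum.elim (Sum.elim gU (Sum.elim gL gB)) gN)
  have hpr : ∀ x s, prevU x s ≤ (U (up s) ⊥, φ x s) := by
    intro x s
    simp only [prevU]
    split
    · rename_i hd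
      exact ⟨h1 s hd, hφ' x s⟩
    · rename_i d hd
      exact ⟨(h2 s d hd).2, (hψ' x s).trans (hφ' x s)⟩
  refine ⟨_, g, ?_, ?_⟩
  · rintro (⟨s, j⟩ | (⟨i, y⟩ | ⟨i, y⟩ | ⟨i, y⟩) | ⟨x, c⟩)
    · intro a b
      simp [g, gT, ht]
    · change ∀ a b, gU (i, y) a ≤ gU (i, y) b ↔ a ≤ b
      by_cases h : ∃ c : K × H, φ c.1 c.2 = y ∧ up c.2 = i
      · obtain ⟨⟨x, s⟩, rfl, rfl⟩ := h
        simp only [gU_eq]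
        refine replace_bot (by intro a b; simp [hU]) ?_
        intro q hq
        refine (hpr x s).trans_lt ?_
        refine Prod.mk_lt_mk_iff_left.2 ?_
        exact lt_of_le_not_ge ((hU _ _ _).2 bot_le) fun h => hq (le_bot_iff.1 ((hU _ _ _).1 h))
      · intro a b
        simp only [gU]
        rw [dif_neg h]
        simp [hU]
    · change ∀ a b, gL (i, y) a ≤ gL (i, y) b ↔ a ≤ b
      by_cases h : ∃ c : K × H, ψ c.1 c.2 = y ∧ dn c.2 = some i
      · obtain ⟨⟨x, s⟩, rfl, hd⟩ := h
        simp only [gL_eq x s i hd]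
        refine replace_top (by intro a b; simp [hL]) ?_
        intro q hq
        have : ((L i ⊤, ψ x s) : A × Q) ≤ (s.1, x.1) := ⟨(h2 s i hd).1, hψ' x s⟩
        refine lt_of_lt_of_le ?_ this
        refine Prod.mk_lt_mk_iff_left.2 ?_
        exact lt_of_le_not_ge ((hL _ _ _).2 le_top) fun h => hq (top_le_iff.1 ((hL _ _ _).1 h))
      · intro a b
        simp only [gL]
        rw [dif_neg h]
        simp [hL]
    · change ∀ a b, gB (i, y) a ≤ gB (i, y) b ↔ a ≤ b
      by_cases h : ∃ c : K × G, ψ c.1 (e.symm (c.2, ⊥)) = y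
      · obtain ⟨⟨x, c⟩, rfl⟩ := h
        simp only [gB_eq]
        refine replace_top (by intro a b; simp [hB]) ?_
        intro q hq
        exact Prod.mk_lt_mk_of_lt_of_le (h3 _ i q hq) ((hψ' _ _).trans (hφ' _ _))
      · intro a b
        simp only [gB]
        rw [dif_neg h]
        simp [hB]
    · intro a b
      simp [g, gN, hz]
  · have : Finite J := Finite.of_injective (fun j => t j ⊥)
      fun i j h => congrArg Prod.fst (htinj (a₁ := (i, ⊥)) (a₂ := (j, ⊥)) h)
    have : Finite (Λ ⊕ Δ ⊕ P) := Finite.of_injective (fun j => F j ⊥)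
      fun i j h => congrArg Prod.fst (hinj (a₁ := (i, ⊥)) (a₂ := (j, ⊥)) h)
    have : Finite Λ := Finite.of_injective (Sum.inl : Λ → Λ ⊕ Δ ⊕ P) Sum.inl_injective
    have : Finite Δ := Finite.of_injective (fun d => (Sum.inr (Sum.inl d) : Λ ⊕ Δ ⊕ P))
      (Sum.inr_injective.comp Sum.inl_injective)
    have : Finite G := Finite.of_injective (fun c => e.symm (c, ⊥))
      fun i j h => congrArg Prod.fst (e.symm.injective h)
    refine Function.Surjective.bijective_of_nat_card_le ?_ ?_
    · rintro ⟨a, y⟩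
      by_cases ha : ∀ i p, F i p ≠ a
      · by_cases hy : y ∈ K
        · rcases hd : dn ⟨a, ha⟩ with _ | d
          · refine ⟨(Sum.inr (Sum.inl (Sum.inl (up ⟨a, ha⟩, φ ⟨y, hy⟩ ⟨a, ha⟩))), ⊥), ?_⟩
            change gU _ _ = _
            rw [gU_eq]
            simp [prevU, hd]
          · refine ⟨(Sum.inr (Sum.inl (Sum.inr (Sum.inl (d, ψ ⟨y, hy⟩ ⟨a, ha⟩)))), ⊤), ?_⟩
            change gL _ _ = _
            rw [gL_eq _ _ _ hd]
            simp
        · obtain ⟨j, p, rfl⟩ := (htr y).1 hy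
          exact ⟨(Sum.inl (⟨a, ha⟩, j), p), rfl⟩
      · push Not at ha
        obtain ⟨i, p, rfl⟩ := ha
        subst hF
        rcases i with i | i | i
        · by_cases h : p = ⊥ ∧ ∃ c : K × H, φ c.1 c.2 = y ∧ up c.2 = i
          · obtain ⟨rfl, ⟨x, s⟩, rfl, rfl⟩ := h
            refine ⟨(Sum.inr (Sum.inl (Sum.inr (Sum.inr ((e s).2, ψ x (e.symm ((e s).1, ⊥)))))), ⊤), ?_⟩
            change gB _ _ = _
            rw [gB_eq]
            simp
          · refine ⟨(Sum.inr (Sum.inl (Sum.inl (i, y))), p), ?_⟩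
            change gU _ _ = _
            simp only [gU]
            split_ifs with h'
            · have hp : p ≠ ⊥ := fun hp => h ⟨hp, h'⟩
              simp [hp]
            · rfl
        · by_cases h : p = ⊤ ∧ ∃ c : K × H, ψ c.1 c.2 = y ∧ dn c.2 = some i
          · obtain ⟨rfl, ⟨x, s⟩, rfl, hd⟩ := h
            refine ⟨(Sum.inr (Sum.inl (Sum.inl (up s, φ x s))), ⊥), ?_⟩
            change gU _ _ = _
            rw [gU_eq]
            simp only at hd
            simp [prevU, hd]
          · refine ⟨(Sum.inr (Sum.inl (Sum.inr (Sum.inl (i, y)))), p), ?_⟩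
            change gL _ _ = _
            simp only [gL]
            split_ifs with h'
            · have hp : p ≠ ⊤ := fun hp => h ⟨hp, h'⟩
              simp [hp]
            · rfl
        · by_cases h : p = ⊤ ∧ ∃ c : K × G, ψ c.1 (e.symm (c.2, ⊥)) = y
          · obtain ⟨rfl, ⟨x, c⟩, rfl⟩ := h
            exact ⟨(Sum.inr (Sum.inr (x, c)), i), rfl⟩
          · refine ⟨(Sum.inr (Sum.inl (Sum.inr (Sum.inr (i, y)))), p), ?_⟩
            change gB _ _ = _
            simp only [gB]
            split_ifs with h'
            · have hp : p ≠ ⊤ := fun hp => h ⟨hp, h'⟩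
              simp [hp]
            · rfl
    · have cA : Nat.card A = Nat.card H + (Nat.card Λ + (Nat.card Δ + Nat.card P)) * Nat.card P := by
        have : Nat.card (H ⊕ (Λ ⊕ Δ ⊕ P) × P) = Nat.card A := by
          refine Nat.card_eq_of_bijective (Sum.elim Subtype.val (Function.uncurry F)) ⟨?_, ?_⟩
          · refine Function.Injective.sumElim Subtype.val_injective hinj ?_
            rintro ⟨a, ha⟩ ⟨i, p⟩ h
            exact ha i p h.symm
          · intro a
            by_cases ha : ∀ i p, F i p ≠ a
            · exact ⟨Sum.inl ⟨a, ha⟩, rfl⟩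
            · push Not at ha
              obtain ⟨i, p, rfl⟩ := ha
              exact ⟨Sum.inr (i, p), rfl⟩
        rw [← this]
        simp [Nat.card_sum, Nat.card_prod]
      have cQ : Nat.card Q = Nat.card K + Nat.card J * Nat.card P := by
        have : Nat.card (K ⊕ J × P) = Nat.card Q := by
          refine Nat.card_eq_of_bijective (Sum.elim Subtype.val (Function.uncurry t)) ⟨?_, ?_⟩
          · refine Function.Injective.sumElim Subtype.val_injective htinj ?_
            rintro ⟨a, ha⟩ ⟨i, p⟩ h
            exact (htr a).2 ⟨i, p, h.symm⟩ ha
          · intro a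
            by_cases ha : a ∈ K
            · exact ⟨Sum.inl ⟨a, ha⟩, rfl⟩
            · obtain ⟨i, p, rfl⟩ := (htr a).1 ha
              exact ⟨Sum.inr (i, p), rfl⟩
        rw [← this]
        simp [Nat.card_sum, Nat.card_prod]
      have cH : Nat.card H = Nat.card G * Nat.card P := by
        rw [← Nat.card_prod]
        exact Nat.card_congr e
      simp only [Nat.card_sum, Nat.card_prod]
      rw [cA]
      generalize hq : Nat.card Q = q at *
      have : Nat.card H * q = Nat.card H * Nat.card K + Nat.card H * Nat.card J * Nat.card P := by
        rw [cQ]; ring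
      have h5 : Nat.card H * Nat.card K = Nat.card K * Nat.card G * Nat.card P := by
        rw [cH]; ring
      nlinarith


section Tail

variable {S : Type u} [PartialOrder S] [Finite S]

open Classical in
/-- Sparse sets have many disjoint shifts in one direction. -/
lemma shift_exists (R : Set S) (w : S) (hw : w ∈ R) (q : ℕ) :
    ∃ φ : {x : Fin (Nat.card S * (q + 1)) → S // ∀ i, x i ∉ R} → Fin q →
        (Fin (Nat.card S * (q + 1)) → S),
      Function.Injective (Function.uncurry φ) ∧
      ∀ x j, ∃ i, φ x j = Function.update x.1 i w := by
  have hne : Nonempty S := ⟨w⟩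
  have hm : 0 < Nat.card S := Nat.card_pos
  set m := Nat.card S with hm_def
  let code : S ≃ Fin m := Finite.equivFin S
  have hn : 0 < m * (q + 1) := by positivity
  let pos : {x : Fin (m * (q + 1)) → S // ∀ i, x i ∉ R} → Fin q → Fin (m * (q + 1)) :=
    fun x j => ⟨(∑ i, (code (x.1 i) : ℕ) + m * j) % (m * (q + 1)), Nat.mod_lt _ hn⟩
  refine ⟨fun x j => Function.update x.1 (pos x j) w, ?_, fun x j => ⟨_, rfl⟩⟩
  rintro ⟨x, j⟩ ⟨x', j'⟩ h
  simp only [Function.uncurry] at h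
  have hpos : pos x j = pos x' j' := by
    by_contra hne
    have := congrFun h (pos x j)
    rw [Function.update_self, Function.update_of_ne hne] at this
    exact x'.2 _ (this ▸ hw)
  have hoff : ∀ i, i ≠ pos x j → x.1 i = x'.1 i := by
    intro i hi
    have := congrFun h i
    rwa [Function.update_of_ne hi, Function.update_of_ne (hpos ▸ hi)] at this
  have hsum : ∀ y : Fin (m * (q + 1)) → S, ∑ i, (code (y i) : ℕ) =
      code (y (pos x j)) + ∑ i ∈ Finset.univ.erase (pos x j), (code (y i) : ℕ) := by
    intro y
    exact (Finset.add_sum_erase Finset.univ (fun i => (code (y i) : ℕ)) (Finset.mem_univ _)).symm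
  have hrest : ∑ i ∈ Finset.univ.erase (pos x j), (code (x.1 i) : ℕ) =
      ∑ i ∈ Finset.univ.erase (pos x j), (code (x'.1 i) : ℕ) :=
    Finset.sum_congr rfl fun i hi => by rw [hoff i (Finset.ne_of_mem_erase hi)]
  have hval : (∑ i, (code (x.1 i) : ℕ) + m * j) ≡ (∑ i, (code (x'.1 i) : ℕ) + m * j')
      [MOD m * (q + 1)] := congrArg Fin.val hpos
  rw [hsum x.1, hsum x'.1, hrest] at hval
  generalize ∑ i ∈ Finset.univ.erase (pos x j), (code (x'.1 i) : ℕ) = r at hval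
  have hval' : ((code (x.1 (pos x j)) : ℕ) + m * j) ≡ ((code (x'.1 (pos x j)) : ℕ) + m * j')
      [MOD m * (q + 1)] := by
    refine Nat.ModEq.add_right_cancel' r ?_
    convert hval using 1 <;> ring
  have hlt : ∀ (a : Fin m) (j : Fin q), (a : ℕ) + m * j < m * (q + 1) := by
    intro a j
    have h1 := a.2
    have h2 := j.2
    nlinarith
  have heq := Nat.ModEq.eq_of_lt_of_lt hval' (hlt _ _) (hlt _ _)
  have hj : (j : ℕ) = j' := by
    have := congrArg (· / m) heq
    simpa [Nat.add_mul_div_left _ _ hm, Nat.div_eq_of_lt] using this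
  have hc : code (x.1 (pos x j)) = code (x'.1 (pos x j)) := by
    rw [hj] at heq
    exact Fin.ext (by omega)
  have hx : x = x' := by
    refine Subtype.ext (funext fun i => ?_)
    by_cases hi : i = pos x j
    · rw [hi]
      exact code.injective hc
    · exact hoff i hi
  exact Prod.ext hx (Fin.ext hj)

open Classical in
lemma tail_exists {P : Type u} [PartialOrder P] [BoundedOrder P] [BoundedOrder S]
    (E : P → S) (hE : ∀ a b, E a ≤ E b ↔ a ≤ b) (hbot : E ⊥ = ⊥) (htop : E ⊤ = ⊤) (q : ℕ) :
    ∃ n : ℕ, ∃ (K : Set (Fin n → S)) (J : Type u) (t : J → P → (Fin n → S)),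
      (∀ i a b, t i a ≤ t i b ↔ a ≤ b) ∧ Function.Injective (Function.uncurry t) ∧
      (∀ x, x ∉ K ↔ ∃ j p, t j p = x) ∧
      ∃ φ ψ : K → Fin q → (Fin n → S), Function.Injective (Function.uncurry φ) ∧
        Function.Injective (Function.uncurry ψ) ∧
        (∀ x s, x.1 ≤ φ x s) ∧ (∀ x s, ψ x s ≤ x.1) := by
  have hEinj : Function.Injective E := fun a b h =>
    le_antisymm ((hE _ _).1 h.le) ((hE _ _).1 h.ge)
  obtain ⟨φ, hφ, hφ'⟩ := shift_exists (Set.range E) ⊤ ⟨⊤, htop⟩ q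
  obtain ⟨ψ, hψ, hψ'⟩ := shift_exists (Set.range E) ⊥ ⟨⊥, hbot⟩ q
  let n := Nat.card S * (q + 1)
  refine ⟨n, {x | ∀ i, x i ∉ Set.range E},
    {c : ULift.{u} (Fin n) × (Fin n → S) // c.2 c.1.down = ⊥ ∧ ∀ j < c.1.down, c.2 j ∉ Set.range E},
    fun c p => Function.update c.1.2 c.1.1.down (E p), ?_, ?_, ?_, φ, ψ, hφ, hψ, ?_, ?_⟩
  · rintro ⟨⟨i, x⟩, h⟩ a b
    rw [update_le_update_iff]
    simp [hE]
  · rintro ⟨⟨⟨⟨i⟩, x⟩, h1, h2⟩, p⟩ ⟨⟨⟨⟨i'⟩, x'⟩, h1', h2'⟩, p'⟩ h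
    simp only [Function.uncurry] at h h1 h2 h1' h2'
    have hi : i = i' := by
      rcases lt_trichotomy i i' with hlt | heq | hlt
      · have := congrFun h i
        rw [Function.update_self, Function.update_of_ne hlt.ne] at this
        exact absurd ⟨p, this⟩ (h2' i hlt)
      · exact heq
      · have := congrFun h i'
        rw [Function.update_self, Function.update_of_ne hlt.ne] at this
        exact absurd ⟨p', this.symm⟩ (h2 i' hlt)
    subst hi
    have hp : p = p' := by
      have := congrFun h i
      rw [Function.update_self, Function.update_self] at this
      exact hEinj this
    have hx : x = x' := by
      funext j
      by_cases hj : j = i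
      · rw [hj, h1, h1']
      · have := congrFun h j
        rwa [Function.update_of_ne hj, Function.update_of_ne hj] at this
    subst hp hx
    rfl
  · intro x
    constructor
    · intro hx
      simp only [Set.mem_ofPred_eq, not_forall, not_not] at hx
      let s : Finset (Fin n) := Finset.univ.filter fun i => x i ∈ Set.range E
      have hs : s.Nonempty := by
        obtain ⟨i, hi⟩ := hx
        exact ⟨i, by simpa [s] using hi⟩
      have hmin := Finset.min'_mem s hs
      obtain ⟨p, hp⟩ : x (s.min' hs) ∈ Set.range E := (Finset.mem_filter.1 hmin).2
      refine ⟨⟨(⟨s.min' hs⟩, Function.update x (s.min' hs) ⊥), ?_, ?_⟩, p, ?_⟩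
      · simp
      · intro j hj
        simp only at hj ⊢
        rw [Function.update_of_ne hj.ne]
        intro hmem
        exact absurd (Finset.min'_le s j (Finset.mem_filter.2 ⟨Finset.mem_univ _, hmem⟩))
          (not_le.2 hj)
      · simp [hp]
    · rintro ⟨⟨⟨⟨i⟩, y⟩, h⟩, p, rfl⟩ hx
      exact hx i ⟨p, by simp⟩
  · intro x s
    obtain ⟨i, hi⟩ := hφ' x s
    rw [hi]
    exact le_update_iff.2 ⟨le_top, fun _ _ => le_rfl⟩
  · intro x s
    obtain ⟨i, hi⟩ := hψ' x s
    rw [hi]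
    exact update_le_iff.2 ⟨bot_le, fun _ _ => le_rfl⟩

end Tail

section Boolean

/-- Product of two order isomorphisms. -/
def prodIso {A B C D : Type*} [PartialOrder A] [PartialOrder B] [PartialOrder C] [PartialOrder D]
    (e : A ≃o B) (f : C ≃o D) : A × C ≃o B × D where
  toEquiv := Equiv.prodCongr e.toEquiv f.toEquiv
  map_rel_iff' := by
    rintro ⟨a, b⟩ ⟨c, d⟩
    simp [Prod.le_def]

/-- Posets isomorphic to a finite power set. -/
def IsBool (R : Type u) [PartialOrder R] : Prop :=
  ∃ X : Type u, Finite X ∧ Nonempty (R ≃o Set X)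

lemma IsBool.set (X : Type u) [Finite X] : IsBool (Set X) := ⟨X, ‹_›, ⟨OrderIso.refl _⟩⟩

lemma IsBool.prod {R T : Type u} [PartialOrder R] [PartialOrder T] (hR : IsBool R)
    (hT : IsBool T) : IsBool (R × T) := by
  obtain ⟨X, hX, ⟨e⟩⟩ := hR
  obtain ⟨Y, hY, ⟨f⟩⟩ := hT
  let g : Set X × Set Y ≃o Set (X ⊕ Y) :=
    { toFun := fun s => Sum.elim s.1 s.2
      invFun := fun s => (fun x => s (Sum.inl x), fun x => s (Sum.inr x))
      left_inv := fun s => rfl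
      right_inv := fun s => by
        funext x
        rcases x with x | x <;> rfl
      map_rel_iff' := by
        rintro ⟨a, b⟩ ⟨c, d⟩
        constructor
        · intro h
          exact ⟨fun x hx => h (a := Sum.inl x) hx, fun x hx => h (a := Sum.inr x) hx⟩
        · rintro ⟨h, h'⟩ (x | x) hx
          · exact h hx
          · exact h' hx }
  exact ⟨X ⊕ Y, inferInstance, ⟨(prodIso e f).trans g⟩⟩

lemma IsBool.pi {D : Type u} [Finite D] (n : ℕ) : IsBool (Fin n → Set D) := by
  let g : (Fin n → Set D) ≃o Set (ULift.{u} (Fin n) × D) :=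
    { toFun := fun s => {x | x.2 ∈ s x.1.down}
      invFun := fun s i => {x | (⟨i⟩, x) ∈ s}
      left_inv := fun s => rfl
      right_inv := fun s => rfl
      map_rel_iff' := by
        intro a b
        constructor
        · intro h i x hx
          exact h (a := (⟨i⟩, x)) hx
        · rintro h ⟨⟨i⟩, x⟩ hx
          exact h i hx }
  exact ⟨_, inferInstance, ⟨g⟩⟩

lemma IsBool.card {R : Type u} [PartialOrder R] (hR : IsBool R) : ∃ m, Nat.card R = 2 ^ m := by
  obtain ⟨X, hX, ⟨e⟩⟩ := hR
  have := Fintype.ofFinite X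
  exact ⟨Fintype.card X, by rw [Nat.card_congr e.toEquiv, Nat.card_eq_fintype_card, Fintype.card_set]⟩

lemma finset_iso_of_equiv {X : Type u} {n : ℕ} (e : X ≃ Fin n) : Nonempty (Set X ≃o Finset (Fin n)) := by
  classical
  exact ⟨
    { toFun := fun s => Finset.univ.filter fun i => e.symm i ∈ s
      invFun := fun s => {x | e x ∈ s}
      left_inv := fun s => by ext; simp
      right_inv := fun s => by ext; simp
      map_rel_iff' := by
        intro a b
        constructor
        · intro h x hx
          have := @h (e x) (by simpa using hx)
          simpa using this
        · intro h i hi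
          simp only [Equiv.coe_fn_mk, Finset.mem_filter, Finset.mem_univ, true_and] at hi ⊢
          exact h hi }⟩

lemma finset_prod_iso (m k : ℕ) :
    Nonempty ((Finset (Fin m) × Finset (Fin k)) ≃o Finset (Fin (m + k))) := by
  obtain ⟨X, hX, ⟨e⟩⟩ := IsBool.prod (IsBool.set (Fin m)) (IsBool.set (Fin k))
  obtain ⟨a⟩ := finset_iso_of_equiv (Equiv.refl (Fin m))
  obtain ⟨b⟩ := finset_iso_of_equiv (Equiv.refl (Fin k))
  have hc : Nat.card X = m + k := by
    have h1 := Nat.card_congr e.toEquiv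
    have := Fintype.ofFinite X
    rw [Nat.card_prod, Nat.card_eq_fintype_card, Nat.card_eq_fintype_card, Nat.card_eq_fintype_card,
      Fintype.card_set, Fintype.card_set, Fintype.card_set, ← pow_add] at h1
    rw [Nat.card_eq_fintype_card]
    simpa using (Nat.pow_right_injective le_rfl h1).symm
  obtain ⟨c⟩ := finset_iso_of_equiv ((Finite.equivFin X).trans (finCongr hc))
  exact ⟨((prodIso a.symm b.symm).trans e).trans c⟩

lemma til_finset {P : Type u} [PartialOrder P] {R : Type u} [PartialOrder R] (hR : IsBool R)
    (h : Til P R) : ∃ n₀ : ℕ, ∀ n, n₀ ≤ n → Til P (Finset (Fin n)) := by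
  obtain ⟨X, hX, ⟨e⟩⟩ := hR
  obtain ⟨a⟩ := finset_iso_of_equiv (Finite.equivFin X)
  refine ⟨Nat.card X, fun n hn => ?_⟩
  obtain ⟨k, rfl⟩ := Nat.exists_eq_add_of_le hn
  obtain ⟨b⟩ := finset_prod_iso (Nat.card X) k
  exact (h.congr (e.trans a)).prod.congr b

end Boolean

section Geometry
open Combinatorics

lemma line_inj {α : Type u} {ι : Type} (l : Line α ι) : Function.Injective (l : α → ι → α) := by
  intro a b h
  obtain ⟨i, hi⟩ := l.proper
  have := congrFun h i
  rwa [Line.apply_none _ _ _ hi, Line.apply_none _ _ _ hi] at this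

lemma line_eq {α : Type u} {ι : Type} (l l' : Line α ι) {a b a' b' : α} (hab : a ≠ b)
    (h1 : l' a' = l a) (h2 : l' b' = l b) : l = l' := by
  have hab' : a' ≠ b' := by
    rintro rfl
    exact hab (line_inj l (h1.symm.trans h2))
  have key : l.idxFun = l'.idxFun := by
    funext i
    have e1 := congrFun h1 i
    have e2 := congrFun h2 i
    simp only [Line.coe_apply] at e1 e2
    rcases h : l.idxFun i with _ | c <;> rcases h' : l'.idxFun i with _ | c' <;>
      simp_all
  cases l; cases l'
  simp_all

lemma line_image {P : Type u} {ι : Type} (l l' : Line (P ⊕ Bool) ι) {M M' : Set P}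
    (h : l '' (Sum.inl '' M ∪ Set.range Sum.inr) = l' '' (Sum.inl '' M' ∪ Set.range Sum.inr)) :
    l = l' ∧ M = M' := by
  have hm : ∀ b, l (Sum.inr b) ∈ l' '' (Sum.inl '' M' ∪ Set.range Sum.inr) := by
    intro b
    rw [← h]
    exact ⟨_, Or.inr ⟨b, rfl⟩, rfl⟩
  obtain ⟨x, -, hx⟩ := hm true
  obtain ⟨y, -, hy⟩ := hm false
  have hl : l = l' := line_eq l l' (by simp) hx hy
  subst hl
  refine ⟨rfl, ?_⟩
  have := (Set.image_injective.2 (line_inj l)) h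
  ext p
  have := Set.ext_iff.1 this (Sum.inl p)
  simpa using this

lemma line_image_subset {P : Type u} {ι : Type} (l : Line (P ⊕ Bool) ι) {M M' : Set P} :
    l '' (Sum.inl '' M ∪ Set.range Sum.inr) ⊆ l '' (Sum.inl '' M' ∪ Set.range Sum.inr) ↔
      M ⊆ M' := by
  rw [Set.image_subset_image_iff (line_inj l)]
  constructor
  · intro h p hp
    have := h (Or.inl ⟨p, hp, rfl⟩)
    simpa using this
  · intro h
    exact Set.union_subset_union_left _ (Set.image_mono h)

end Geometry

section Final
open Combinatorics

/-- The part of a line used by a tile. -/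
def Z {P : Type u} {ι : Type} (l : Line (P ⊕ Bool) ι) (M : Set P) : Set (ι → P ⊕ Bool) :=
  l '' (Sum.inl '' M ∪ Set.range Sum.inr)

lemma Z_ne {P : Type u} {ι : Type} (l : Line (P ⊕ Bool) ι) (M : Set P) : (Z l M).Nonempty :=
  ⟨_, _, Or.inr ⟨true, rfl⟩, rfl⟩

lemma Iic_sub {P : Type u} [PartialOrder P] {a b : P} :
    ({q | q ≤ a} : Set P) ⊆ {q | q ≤ b} ↔ a ≤ b :=
  ⟨fun h => h (le_refl a), fun h _ hq => le_trans hq h⟩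

lemma Iic_inj {P : Type u} [PartialOrder P] {a b : P}
    (h : ({q | q ≤ a} : Set P) = {q | q ≤ b}) : a = b :=
  le_antisymm (Iic_sub.1 h.subset) (Iic_sub.1 h.superset)

lemma nIic_sub {P : Type u} [PartialOrder P] {a b : P} :
    ({q | ¬ q ≤ b} : Set P) ⊆ {q | ¬ q ≤ a} ↔ a ≤ b :=
  ⟨fun h => by
    by_contra hab
    exact h hab (le_refl a), fun h _ hq hq' => hq (le_trans hq' h)⟩

/-- The head poset. -/
abbrev Head (P : Type u) (ι : Type) : Type u :=
  Set (ι → P ⊕ Bool) × Set (P ⊕ P) × Set P × Set P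

variable {P : Type u} [PartialOrder P] {ι : Type}

/-- The upper tiles. -/
def tU : Option (Line (P ⊕ Bool) ι) → P → Head P ι
  | none, p => (Set.univ, Set.univ, Set.univ, {q | q ≤ p})
  | some l, p => ((Z l {q | ¬ q ≤ p})ᶜ, Set.univ, Set.univ, Set.univ)

/-- The lower tiles. -/
def tL (l : Line (P ⊕ Bool) ι) (p : P) : Head P ι := (Z l {q | q ≤ p}, ∅, ∅, ∅)

open Classical in
/-- The bridge tiles. -/
noncomputable def tB [BoundedOrder P] (p q : P) : Head P ι :=
  if q = ⊤ then (∅, Set.univ, {p' | p' ≤ p}, ∅)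
  else (∅, Sum.inl '' {q' | q' ≤ q} ∪ {Sum.inr p}, ∅, ∅)

lemma tB_top [BoundedOrder P] (p : P) :
    (tB p ⊤ : Head P ι) = (∅, Set.univ, {p' | p' ≤ p}, ∅) := if_pos rfl

lemma tB_ne [BoundedOrder P] (p : P) {q : P} (hq : q ≠ ⊤) :
    (tB p q : Head P ι) = (∅, Sum.inl '' {q' | q' ≤ q} ∪ {Sum.inr p}, ∅, ∅) := if_neg hq

lemma tU_le (i : Option (Line (P ⊕ Bool) ι)) (a b : P) : tU i a ≤ tU i b ↔ a ≤ b := by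
  rcases i with _ | l
  · exact ⟨fun h => Iic_sub.1 h.2.2.2, fun h => ⟨le_rfl, le_rfl, le_rfl, Iic_sub.2 h⟩⟩
  · refine ⟨fun h => ?_, fun h => ⟨?_, le_rfl, le_rfl, le_rfl⟩⟩
    · exact nIic_sub.1 ((line_image_subset l).1 (Set.compl_subset_compl.1 h.1))
    · exact Set.compl_subset_compl.2 ((line_image_subset l).2 (nIic_sub.2 h))

lemma tL_le (l : Line (P ⊕ Bool) ι) (a b : P) : tL l a ≤ tL l b ↔ a ≤ b :=
  ⟨fun h => Iic_sub.1 ((line_image_subset l).1 h.1),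
    fun h => ⟨(line_image_subset l).2 (Iic_sub.2 h), le_rfl, le_rfl, le_rfl⟩⟩

lemma tB_le [BoundedOrder P] (p a b : P) : (tB p a : Head P ι) ≤ tB p b ↔ a ≤ b := by
  by_cases ha : a = ⊤ <;> by_cases hb : b = ⊤
  · simp [ha, hb]
  · subst ha
    rw [tB_top, tB_ne p hb]
    constructor
    · intro h
      exact absurd (h.2.2.1 (le_refl p)) (Set.notMem_empty p)
    · intro h
      exact absurd (top_le_iff.1 h) hb
  · subst hb
    rw [tB_top, tB_ne p ha]
    exact ⟨fun _ => le_top, fun _ => ⟨le_rfl, Set.subset_univ _, Set.empty_subset _, le_rfl⟩⟩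
  · rw [tB_ne p ha, tB_ne p hb]
    constructor
    · intro h
      have := h.2.1 (Or.inl ⟨a, le_refl a, rfl⟩)
      simpa using this
    · intro h
      exact ⟨le_rfl, Set.union_subset_union_left _ (Set.image_mono (Iic_sub.2 h)), le_rfl, le_rfl⟩

lemma tB_top_le [BoundedOrder P] (a b : P) : (tB a ⊤ : Head P ι) ≤ tB b ⊤ ↔ a ≤ b := by
  rw [tB_top, tB_top]
  exact ⟨fun h => Iic_sub.1 h.2.2.1, fun h => ⟨le_rfl, le_rfl, Iic_sub.2 h, le_rfl⟩⟩

lemma tU_four [Nonempty P] (i : Option (Line (P ⊕ Bool) ι)) (p : P) :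
    (tU i p).2.2.2.Nonempty := by
  rcases i with _ | l
  · exact ⟨p, le_refl p⟩
  · exact ⟨p, trivial⟩

lemma tU_two (i : Option (Line (P ⊕ Bool) ι)) (p : P) : (tU i p).2.1 = Set.univ := by
  rcases i with _ | l <;> rfl

lemma tU_three (i : Option (Line (P ⊕ Bool) ι)) (p : P) : (tU i p).2.2.1 = Set.univ := by
  rcases i with _ | l <;> rfl

lemma tB_one [BoundedOrder P] (p q : P) : (tB p q : Head P ι).1 = ∅ := by
  unfold tB; split_ifs <;> rfl

lemma tB_four [BoundedOrder P] (p q : P) : (tB p q : Head P ι).2.2.2 = ∅ := by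
  unfold tB; split_ifs <;> rfl

lemma tB_two [BoundedOrder P] (p q : P) : Sum.inr p ∈ (tB p q : Head P ι).2.1 := by
  unfold tB; split_ifs
  · trivial
  · exact Or.inr rfl

lemma tB_lt [BoundedOrder P] (i : Option (Line (P ⊕ Bool) ι)) (p q : P) (hq : q ≠ ⊤) :
    (tB p q : Head P ι) < tU i ⊥ := by
  refine lt_of_le_of_ne ⟨?_, ?_, ?_, ?_⟩ ?_
  · rw [tB_one]; exact Set.empty_subset _
  · rw [tU_two]; exact Set.subset_univ _
  · rw [tU_three]; exact Set.subset_univ _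
  · rw [tB_four]; exact Set.empty_subset _
  · intro h
    have h4 := tU_four i (⊥ : P)
    rw [← h, tB_four] at h4
    exact Set.not_nonempty_empty h4

lemma tB_inj [BoundedOrder P] {p q p' q' : P} (h : (tB p q : Head P ι) = tB p' q') :
    p = p' ∧ q = q' := by
  by_cases ha : q = ⊤ <;> by_cases hb : q' = ⊤
  · subst ha hb
    exact ⟨le_antisymm ((tB_top_le _ _).1 h.le) ((tB_top_le _ _).1 h.ge), rfl⟩
  · subst ha
    rw [tB_top, tB_ne _ hb] at h
    have h' : {x | x ≤ p} = (∅ : Set P) := congrArg (fun z : Head P ι => z.2.2.1) h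
    exact absurd (h'.subset (le_refl p)) (Set.notMem_empty p)
  · subst hb
    rw [tB_top, tB_ne _ ha] at h
    have h' : (∅ : Set P) = {x | x ≤ p'} := congrArg (fun z : Head P ι => z.2.2.1) h
    exact absurd (h'.superset (le_refl p')) (Set.notMem_empty p')
  · have hp : p = p' := by
      have := tB_two (ι := ι) p q
      rw [h, tB_ne _ hb] at this
      simpa using this
    subst hp
    exact ⟨rfl, le_antisymm ((tB_le _ _ _).1 h.le) ((tB_le _ _ _).1 h.ge)⟩

lemma tU_inj {i i' : Option (Line (P ⊕ Bool) ι)} {p p' : P} (h : tU i p = tU i' p') :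
    i = i' ∧ p = p' := by
  have hi : i = i' := by
    rcases i with _ | l <;> rcases i' with _ | l'
    · rfl
    · have h' : Set.univ = (Z l' {q | ¬ q ≤ p'})ᶜ := congrArg Prod.fst h
      obtain ⟨x, hx⟩ := Z_ne l' {q | ¬ q ≤ p'}
      exact absurd hx (h'.subset (Set.mem_univ x))
    · have h' : (Z l {q | ¬ q ≤ p})ᶜ = Set.univ := congrArg Prod.fst h
      obtain ⟨x, hx⟩ := Z_ne l {q | ¬ q ≤ p}
      exact absurd hx (h'.superset (Set.mem_univ x))
    · have h' : (Z l {q | ¬ q ≤ p})ᶜ = (Z l' {q | ¬ q ≤ p'})ᶜ := congrArg Prod.fst h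
      rw [(line_image l l' (compl_injective h')).1]
  subst hi
  exact ⟨rfl, le_antisymm ((tU_le _ _ _).1 h.le) ((tU_le _ _ _).1 h.ge)⟩

lemma tL_inj {i i' : Line (P ⊕ Bool) ι} {p p' : P} (h : tL i p = tL i' p') :
    i = i' ∧ p = p' := by
  have h' : Z i {q | q ≤ p} = Z i' {q | q ≤ p'} := congrArg Prod.fst h
  have hi := line_image i i' h'
  exact ⟨hi.1, Iic_inj hi.2⟩

/-- All the head tiles. -/
noncomputable def tF [BoundedOrder P] : Option (Line (P ⊕ Bool) ι) ⊕ Line (P ⊕ Bool) ι ⊕ P → P → Head P ι :=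
  Sum.elim tU (Sum.elim tL tB)

lemma tUL {i : Option (Line (P ⊕ Bool) ι)} {p p' : P} {l : Line (P ⊕ Bool) ι} :
    tU i p ≠ tL l p' := by
  intro h
  have h2 := congrArg (fun z : Head P ι => z.2.1) h
  simp only [tU_two] at h2
  exact Set.notMem_empty (Sum.inl p) (h2.subset (Set.mem_univ _))

lemma tUB [BoundedOrder P] {i : Option (Line (P ⊕ Bool) ι)} {p a b : P} : tU i p ≠ tB a b := by
  intro h
  have h4 := tU_four i p
  rw [h, tB_four] at h4
  exact Set.not_nonempty_empty h4

lemma tLB [BoundedOrder P] {l : Line (P ⊕ Bool) ι} {p a b : P} : tL l p ≠ tB a b := by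
  intro h
  have h4 := tB_two (ι := ι) a b
  rw [← h] at h4
  exact Set.notMem_empty _ h4

lemma tF_inj [BoundedOrder P] : Function.Injective (Function.uncurry (tF (P := P) (ι := ι))) := by
  rintro ⟨i, p⟩ ⟨i', p'⟩ h
  rcases i with i | i | i <;> rcases i' with i' | i' | i' <;>
    simp only [Function.uncurry, tF, Sum.elim_inl, Sum.elim_inr] at h
  · obtain ⟨rfl, rfl⟩ := tU_inj h; rfl
  · exact absurd h tUL
  · exact absurd h tUB
  · exact absurd h.symm tUL
  · obtain ⟨rfl, rfl⟩ := tL_inj h; rfl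
  · exact absurd h tLB
  · exact absurd h.symm tUB
  · exact absurd h.symm tLB
  · obtain ⟨rfl, rfl⟩ := tB_inj h; rfl

lemma head_card [BoundedOrder P] [Finite P] [Finite ι] {k : ℕ} (hk : Nat.card P = 2 ^ k) :
    ∃ c, Nat.card {a : Head P ι // ∀ i p, tF i p ≠ a} = c * Nat.card P := by
  classical
  have hb : IsBool (Head P ι) :=
    (IsBool.set _).prod ((IsBool.set _).prod ((IsBool.set _).prod (IsBool.set _)))
  obtain ⟨m, hm⟩ := hb.card
  have : Finite (Head P ι) := inferInstance
  let r : Set (Head P ι) := Set.range (Function.uncurry (tF (P := P) (ι := ι)))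
  have h1 : Nat.card r = Nat.card (Option (Line (P ⊕ Bool) ι) ⊕ Line (P ⊕ Bool) ι ⊕ P) *
      Nat.card P := by
    rw [← Nat.card_prod]
    exact (Nat.card_congr (Equiv.ofInjective _ tF_inj)).symm
  have h2 : Nat.card {a : Head P ι // ∀ i p, tF i p ≠ a} = Nat.card (rᶜ : Set (Head P ι)) := by
    refine Nat.card_congr (Equiv.subtypeEquivRight fun a => ?_)
    simp [r, Function.uncurry]
  have h3 : Nat.card r + Nat.card (rᶜ : Set (Head P ι)) = Nat.card (Head P ι) := by
    rw [← Nat.card_sum]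
    exact Nat.card_congr (Equiv.Set.sumCompl r)
  have h4 : Nat.card P ≤ Nat.card (Head P ι) := by
    refine Nat.card_le_card_of_injective (fun p => (tU none p : Head P ι)) ?_
    intro a b hab
    exact (tU_inj hab).2
  have h5 : Nat.card P ∣ Nat.card (Head P ι) := by
    rw [hk, hm] at h4 ⊢
    exact pow_dvd_pow 2 ((Nat.pow_le_pow_iff_right (by norm_num)).1 h4)
  have h6 : Nat.card P ∣ Nat.card (rᶜ : Set (Head P ι)) := by
    rw [← h3, h1] at h5
    exact (Nat.dvd_add_right (Dvd.intro_left _ rfl)).1 h5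
  obtain ⟨c, hc⟩ := h6
  exact ⟨c, by rw [h2, hc, mul_comm]⟩

theorem til_main [BoundedOrder P] [Finite P] {k : ℕ} (hk : Nat.card P = 2 ^ k) :
    ∃ n₀ : ℕ, ∀ n, n₀ ≤ n → Til P (Finset (Fin n)) := by
  classical
  have hfin := Fintype.ofFinite P
  obtain ⟨ι, hι, hline⟩ := Line.exists_mono_in_high_dimension (P ⊕ Bool) Bool
  have hmono : ∀ s : Set (ι → P ⊕ Bool), ∃ l : Line (P ⊕ Bool) ι,
      (∀ x, l x ∈ s) ∨ (∀ x, l x ∉ s) := by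
    intro s
    obtain ⟨l, c, hc⟩ := hline fun x => decide (x ∈ s)
    refine ⟨l, ?_⟩
    cases c
    · exact Or.inr fun x => by simpa using hc x
    · exact Or.inl fun x => by simpa using hc x
  choose ln hln using hmono
  let H := {a : Head P ι // ∀ i p, tF i p ≠ a}
  obtain ⟨c, hc⟩ := head_card (ι := ι) hk
  have he : Nonempty (H ≃ ULift.{u} (Fin c) × P) := by
    refine ⟨(Finite.equivFin H).trans ((finCongr ?_).trans (Finite.equivFin _).symm)⟩
    rw [Nat.card_prod, hc]
    simp
  obtain ⟨e⟩ := he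
  let E : P → Set {q : P // q ≠ ⊥} := fun p => {x | x.1 ≤ p}
  have hE : ∀ a b, E a ≤ E b ↔ a ≤ b := by
    intro a b
    constructor
    · intro h
      by_cases ha : a = ⊥
      · rw [ha]; exact bot_le
      · exact h (a := ⟨a, ha⟩) (le_refl a)
    · intro h x hx
      exact le_trans hx h
  have hbot : E ⊥ = ⊥ := by
    ext x
    simp [E, x.2]
  have htop : E ⊤ = ⊤ := by
    ext x
    simp [E]
  obtain ⟨n, K, J, t, ht, htinj, htr, φ, ψ, hφ, hψ, hφ', hψ'⟩ :=
    tail_exists E hE hbot htop (Nat.card H)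
  let g : H ≃ Fin (Nat.card H) := Finite.equivFin H
  have hg : ∀ f : K → Fin (Nat.card H) → (Fin n → Set {q : P // q ≠ ⊥}),
      Function.Injective (Function.uncurry f) →
      Function.Injective (Function.uncurry fun x (s : H) => f x (g s)) := by
    rintro f hf ⟨x, s⟩ ⟨x', s'⟩ h
    have := hf (a₁ := (x, g s)) (a₂ := (x', g s')) h
    simp only [Prod.mk.injEq, EmbeddingLike.apply_eq_iff_eq] at this
    exact Prod.ext this.1 this.2
  have key : Til P (Head P ι × (Fin n → Set {q : P // q ≠ ⊥})) := by
    refine assembly K t ht htinj htr tU tL tB tU_le tL_le tB_le tB_top_le tF rfl tF_inj e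
      (fun s => if ∀ x, ln s.1.1 x ∈ s.1.1 then none else some (ln s.1.1))
      (fun s => if ∀ x, ln s.1.1 x ∈ s.1.1 then some (ln s.1.1) else none)
      ?_ ?_ tB_lt (fun x s => φ x (g s)) (fun x s => ψ x (g s)) (hg φ hφ) (hg ψ hψ)
      (fun x s => hφ' x _) (fun x s => hψ' x _)
    · intro s hs
      have hs' : ¬ ∀ x, ln s.1.1 x ∈ s.1.1 := by
        intro h
        simp [h] at hs
      simp only [if_neg hs']
      have hno := (hln s.1.1).resolve_left hs'
      refine ⟨?_, Set.subset_univ _, Set.subset_univ _, Set.subset_univ _⟩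
      rintro y hy ⟨x, -, rfl⟩
      exact hno x hy
    · intro s d hd
      have hs' : ∀ x, ln s.1.1 x ∈ s.1.1 := by
        by_contra h
        simp only [if_neg h] at hd
        exact absurd hd (by simp)
      simp only [if_pos hs', Option.some.injEq] at hd ⊢
      subst hd
      refine ⟨⟨?_, Set.empty_subset _, Set.empty_subset _, Set.empty_subset _⟩,
        ⟨Set.subset_univ _, Set.empty_subset _, Set.empty_subset _, Set.empty_subset _⟩⟩
      rintro y ⟨x, -, rfl⟩
      exact hs' x
  refine til_finset (IsBool.prod ?_ (IsBool.pi n)) key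
  exact (IsBool.set _).prod ((IsBool.set _).prod ((IsBool.set _).prod (IsBool.set _)))

end Final

end GLT

/-- **Gruslys–Leader–Tomon.** Let `P` be a finite poset with a unique maximal and a unique
minimal element whose size is a power of `2`. Then for all sufficiently large `n`, the
Boolean lattice `2^[n]` (modelled as `Finset (Fin n)` ordered by inclusion) can be
partitioned into copies of `P`. -/
theorem boolean_lattice_partition_into_copies (P : Type*) [PartialOrder P] [Fintype P]
    (hmax : ∃! x : P, IsMax x) (hmin : ∃! x : P, IsMin x)
    (hcard : ∃ k : ℕ, Fintype.card P = 2 ^ k) :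
    ∃ n₀ : ℕ, ∀ n : ℕ, n₀ ≤ n →
      PartitionedIntoCopies P (Set.univ : Set (Finset (Fin n))) := by
  classical
  obtain ⟨a, ha, hau⟩ := hmax
  obtain ⟨b, hb, hbu⟩ := hmin
  obtain ⟨k, hk⟩ := hcard
  have hle : ∀ x : P, x ≤ a := by
    intro x
    obtain ⟨m, hxm, hm⟩ := Set.Finite.exists_le_maximal (Set.finite_univ (α := P)) (Set.mem_univ x)
    have : IsMax m := fun y hy => hm.2 (Set.mem_univ y) hy
    exact hau m this ▸ hxm
  have hge : ∀ x : P, b ≤ x := by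
    intro x
    obtain ⟨m, hxm, hm⟩ := Set.Finite.exists_le_minimal (Set.finite_univ (α := P)) (Set.mem_univ x)
    have : IsMin m := fun y hy => hm.2 (Set.mem_univ y) hy
    exact hbu m this ▸ hxm
  letI : BoundedOrder P :=
    { top := a
      le_top := hle
      bot := b
      bot_le := hge }
  obtain ⟨n₀, h⟩ := GLT.til_main (P := P) (k := k) (by rw [Nat.card_eq_fintype_card, hk])
  exact ⟨n₀, fun n hn => (h n hn).partitioned⟩
end
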